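/- arXiv:2502.09983 — 8 statements merged into one kernel-verified Lean document; each statement's English description precedes it below -/
import Mathlib

section
/- Let α > 0 and suppose f is an entire function on ℂ that belongs to the Fock space F_α^{p₀} for some p₀ ≥ 1. Then lim_{p→∞} ‖f‖_{p,α} = ‖f‖_{∞,α}, i.e. lim_{p→∞} [(pα/(2π)) ∫_ℂ |f(z) e^{-α|z|²/2}|^p dA(z)]^{1/p} = sup_{z∈ℂ} |f(z)| e^{-α|z|²/2}. -/
open MeasureTheory Filter Metric
open scoped ENNReal Topology

/-- The Gaussian weight `e^{-α|z|^2/2}`. -/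
noncomputable def gauss (α : ℝ) (z : ℂ) : ℝ := Real.exp (-α * ‖z‖ ^ 2 / 2)

/-- The Fock norm `‖f‖_{p,α} = [(pα/(2π)) ∫ (|f| e^{-α|z|²/2})^p dA]^{1/p}` (as an `ℝ≥0∞`). -/
noncomputable def fockNormP (α p : ℝ) (f : ℂ → ℂ) : ℝ≥0∞ :=
  (ENNReal.ofReal (p * α / (2 * Real.pi)) *
    ∫⁻ z : ℂ, ENNReal.ofReal ((‖f z‖ * gauss α z) ^ p)) ^ (1 / p)

/-- The Fock sup-norm `‖f‖_{∞,α} = sup_z |f z| e^{-α|z|²/2}` (as an `ℝ≥0∞`). -/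
noncomputable def fockNormInf (α : ℝ) (f : ℂ → ℂ) : ℝ≥0∞ :=
  ⨆ z : ℂ, ENNReal.ofReal (‖f z‖ * gauss α z)

/-- Membership in the Fock space `F_α^p`. -/
def MemFock (α p : ℝ) (f : ℂ → ℂ) : Prop :=
  Differentiable ℂ f ∧ fockNormP α p f ≠ ⊤

/-- Membership in the Fock space `F_α^∞`. -/
def MemFockInf (α : ℝ) (f : ℂ → ℂ) : Prop :=
  Differentiable ℂ f ∧ fockNormInf α f ≠ ⊤

/-- `∫_ℂ (|f(z)| e^{-α|z|²/2})^q dμ(z)` as an `ℝ≥0∞`. -/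
noncomputable def carlesonInt (α q : ℝ) (μ : Measure ℂ) (f : ℂ → ℂ) : ℝ≥0∞ :=
  ∫⁻ z : ℂ, ENNReal.ofReal ((‖f z‖ * gauss α z) ^ q) ∂μ

/-- `μ` is an `(∞,q)` Fock-Carleson measure. -/
def IsInfqCarleson (α q : ℝ) (μ : Measure ℂ) : Prop :=
  ∃ C > (0 : ℝ), ∀ f : ℂ → ℂ, MemFockInf α f →
    (carlesonInt α q μ f) ^ (1 / q) ≤ ENNReal.ofReal C * fockNormInf α f

/-- The `t`-Berezin transform of a measure:
`μ̃_t(z) = (α/π) ∫ e^{-(αt/2)|z-ω|²} dμ(ω)` (as an `ℝ≥0∞`). -/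
noncomputable def berezinM (α t : ℝ) (μ : Measure ℂ) (z : ℂ) : ℝ≥0∞ :=
  ENNReal.ofReal (α / Real.pi) *
    ∫⁻ ω : ℂ, ENNReal.ofReal (Real.exp (-(α * t / 2) * ‖z - ω‖ ^ 2)) ∂μ

lemma tendsto_aux (A : ℝ) (hA : 0 < A) (c : ℝ) :
    Tendsto (fun p : ℝ => ENNReal.ofReal (c * (p * A) ^ (1 / p))) atTop
      (𝓝 (ENNReal.ofReal c)) := by
  apply ENNReal.tendsto_ofReal
  have h1 : Tendsto (fun p : ℝ => p ^ (1 / p)) atTop (𝓝 1) := tendsto_rpow_div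
  have h0 : Tendsto (fun p : ℝ => 1 / p) atTop (𝓝 0) := by
    simpa using tendsto_inv_atTop_zero (𝕜 := ℝ)
  have h2 : Tendsto (fun p : ℝ => A ^ (1 / p)) atTop (𝓝 1) := by
    have := ((Real.continuous_const_rpow hA.ne').tendsto 0).comp h0
    simpa [Function.comp_def] using this
  have h3 : Tendsto (fun p : ℝ => c * (p ^ (1 / p) * A ^ (1 / p))) atTop (𝓝 c) := by
    simpa using (h1.mul h2).const_mul c
  refine h3.congr' ?_
  filter_upwards [eventually_gt_atTop 0] with p hp
  rw [Real.mul_rpow hp.le hA.le]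

lemma root_aux (c p B : ℝ) (hc : 0 < c) (hp : 0 < p) (hB : 0 < B) :
    (ENNReal.ofReal (c ^ p * B)) ^ (1 / p) = ENNReal.ofReal (c * B ^ (1 / p)) := by
  rw [ENNReal.ofReal_rpow_of_nonneg (by positivity) (by positivity),
    Real.mul_rpow (by positivity) hB.le, ← Real.rpow_mul hc.le,
    mul_one_div_cancel hp.ne', Real.rpow_one]

/-- If an entire `f` belongs to `F_α^{p₀}` for some `p₀ ≥ 1`, then
`lim_{p→∞} ‖f‖_{p,α} = ‖f‖_{∞,α}`. -/
theorem stmt0 (α : ℝ) (hα : 0 < α) (f : ℂ → ℂ) (hf : Differentiable ℂ f)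
    (p₀ : ℝ) (hp₀ : 1 ≤ p₀) (hfp₀ : fockNormP α p₀ f ≠ ⊤) :
    Tendsto (fun p : ℝ => fockNormP α p f) atTop (𝓝 (fockNormInf α f)) := by
  have hK : 0 < α / (2 * Real.pi) := by positivity
  set g : ℂ → ℝ := fun z => ‖f z‖ * gauss α z with hg
  have hg0 : ∀ z, 0 ≤ g z := fun z => mul_nonneg (norm_nonneg _) (Real.exp_pos _).le
  have hgc : Continuous g := by
    have := hf.continuous
    simp only [hg, gauss]
    fun_prop
  have hI : (∫⁻ z : ℂ, ENNReal.ofReal (g z ^ p₀)) ≠ ⊤ := by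
    intro h
    apply hfp₀
    unfold fockNormP
    change (_ * ∫⁻ z : ℂ, ENNReal.ofReal (g z ^ p₀)) ^ _ = _
    have h1 : 0 < p₀ * α / (2 * Real.pi) := by positivity
    rw [h, ENNReal.mul_top (ENNReal.ofReal_pos.2 h1).ne', ENNReal.top_rpow_of_pos (by positivity)]
  set I : ℝ := (∫⁻ z : ℂ, ENNReal.ofReal (g z ^ p₀)).toReal with hIdef
  have hI0 : 0 ≤ I := ENNReal.toReal_nonneg
  refine tendsto_order.2 ⟨fun a ha => ?_, fun b hb => ?_⟩
  · obtain ⟨c, hac, hcS⟩ := ENNReal.lt_iff_exists_nnreal_btwn.1 ha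
    have hc : 0 < (c : ℝ) := by
      have : (0 : ℝ≥0∞) < c := lt_of_le_of_lt (zero_le) hac
      exact_mod_cast this
    obtain ⟨z₀, hz₀⟩ := lt_iSup_iff.1 hcS
    have hz₀' : (c : ℝ) < g z₀ := by
      rw [← ENNReal.ofReal_coe_nnreal] at hz₀
      exact (ENNReal.ofReal_lt_ofReal_iff_of_nonneg hc.le).1 hz₀
    set U : Set ℂ := {z | (c : ℝ) < g z} with hU
    have hUo : IsOpen U := isOpen_lt continuous_const hgc
    have hUm : 0 < volume U := hUo.measure_pos volume ⟨z₀, hz₀'⟩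
    set m : ℝ := (min (volume U) 1).toReal with hm
    have hmt : min (volume U) 1 ≠ ⊤ := ne_top_of_le_ne_top ENNReal.one_ne_top (min_le_right _ _)
    have hm0 : 0 < m := ENNReal.toReal_pos (by simp [hUm.ne']) hmt
    have hmU : ENNReal.ofReal m ≤ volume U := by
      rw [hm, ENNReal.ofReal_toReal hmt]; exact min_le_left _ _
    have ht := tendsto_aux (α / (2 * Real.pi) * m) (by positivity) c
    rw [ENNReal.ofReal_coe_nnreal] at ht
    filter_upwards [ht.eventually (lt_mem_nhds hac), eventually_gt_atTop 0] with p hp hp0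
    refine lt_of_lt_of_le hp ?_
    rw [← root_aux c p _ hc hp0 (by positivity)]
    unfold fockNormP
    refine ENNReal.rpow_le_rpow ?_ (by positivity)
    change _ ≤ _ * ∫⁻ z : ℂ, ENNReal.ofReal (g z ^ p)
    have e : (c : ℝ) ^ p * (p * (α / (2 * Real.pi) * m))
        = (p * α / (2 * Real.pi)) * ((c : ℝ) ^ p * m) := by ring
    rw [e, ENNReal.ofReal_mul (by positivity), ENNReal.ofReal_mul (by positivity)]
    gcongr
    calc ENNReal.ofReal ((c : ℝ) ^ p) * ENNReal.ofReal m
        ≤ ENNReal.ofReal ((c : ℝ) ^ p) * volume U := by gcongr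
      _ = ∫⁻ z in U, ENNReal.ofReal ((c : ℝ) ^ p) := by simp
      _ ≤ ∫⁻ z in U, ENNReal.ofReal (g z ^ p) := by
          refine setLIntegral_mono' hUo.measurableSet fun z hz => ?_
          exact ENNReal.ofReal_le_ofReal (Real.rpow_le_rpow hc.le (le_of_lt hz) hp0.le)
      _ ≤ _ := setLIntegral_le_lintegral _ _
  · obtain ⟨c, hSc, hcb⟩ := ENNReal.lt_iff_exists_nnreal_btwn.1 hb
    have hc : 0 < (c : ℝ) := by
      have : (0 : ℝ≥0∞) < c := lt_of_le_of_lt (zero_le) hSc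
      exact_mod_cast this
    have hgle : ∀ z, g z ≤ c := fun z => by
      have h1 : ENNReal.ofReal (g z) ≤ c :=
        (le_iSup (fun z => ENNReal.ofReal (g z)) z).trans hSc.le
      rw [← ENNReal.ofReal_coe_nnreal] at h1
      exact (ENNReal.ofReal_le_ofReal_iff hc.le).1 h1
    have hcp : 0 < (c : ℝ) ^ (-p₀) := Real.rpow_pos_of_pos hc _
    have ht := tendsto_aux (α / (2 * Real.pi) * ((c : ℝ) ^ (-p₀) * (I + 1))) (by positivity) c
    rw [ENNReal.ofReal_coe_nnreal] at ht
    filter_upwards [ht.eventually (gt_mem_nhds hcb), eventually_gt_atTop p₀] with p hp hpp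
    have hp0 : 0 < p := by linarith
    refine lt_of_le_of_lt ?_ hp
    rw [← root_aux c p _ hc hp0 (by positivity)]
    unfold fockNormP
    refine ENNReal.rpow_le_rpow ?_ (by positivity)
    change _ * ∫⁻ z : ℂ, ENNReal.ofReal (g z ^ p) ≤ _
    have e : (c : ℝ) ^ p * (p * (α / (2 * Real.pi) * ((c : ℝ) ^ (-p₀) * (I + 1))))
        = (p * α / (2 * Real.pi)) * ((c : ℝ) ^ (p - p₀) * (I + 1)) := by
      rw [sub_eq_add_neg, Real.rpow_add hc]; ring
    rw [e, ENNReal.ofReal_mul (by positivity), ENNReal.ofReal_mul (by positivity)]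
    gcongr
    calc ∫⁻ z : ℂ, ENNReal.ofReal (g z ^ p)
        ≤ ∫⁻ z : ℂ, ENNReal.ofReal ((c : ℝ) ^ (p - p₀)) * ENNReal.ofReal (g z ^ p₀) := by
          refine lintegral_mono fun z => ?_
          rw [← ENNReal.ofReal_mul (by positivity)]
          refine ENNReal.ofReal_le_ofReal ?_
          have e2 : g z ^ p = g z ^ (p - p₀) * g z ^ p₀ := by
            rw [← Real.rpow_add_of_nonneg (hg0 z) (by linarith) (by linarith)]
            congr 1; ring
          rw [e2]
          exact mul_le_mul_of_nonneg_right
            (Real.rpow_le_rpow (hg0 z) (hgle z) (by linarith)) (Real.rpow_nonneg (hg0 z) _)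
      _ = ENNReal.ofReal ((c : ℝ) ^ (p - p₀)) * ∫⁻ z : ℂ, ENNReal.ofReal (g z ^ p₀) :=
          lintegral_const_mul' _ _ ENNReal.ofReal_ne_top
      _ ≤ _ := by
          gcongr
          rw [← ENNReal.ofReal_toReal hI]
          exact ENNReal.ofReal_le_ofReal (by linarith)
end

section
/- Let α > 0, 0 < q < ∞, and let μ be a positive Borel measure on ℂ. Then μ is an (∞,q) Fock-Carleson measure if and only if there exists a constant C > 0 such that for every p ∈ [1,∞) and every f ∈ F_α^p one has (∫_ℂ |f(z) e^{-α|z|²/2}|^q dμ(z))^{1/q} ≤ C ‖f‖_{p,α}; that is, if and only if μ is a (p,q) Fock-Carleson measure for every p ≥ 1 with a constant independent of p. -/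
open MeasureTheory Filter Metric
open scoped ENNReal Topology

lemma lint_gauss (b : ℝ) (hb : 0 < b) :
    ∫⁻ z : ℂ, ENNReal.ofReal (Real.exp (-b * ‖z‖ ^ 2)) = ENNReal.ofReal (Real.pi / b) := by
  have h := GaussianFourier.integral_rexp_neg_mul_sq_norm (V := ℂ) hb
  have h2 : ∫ v : ℂ, Real.exp (-b * ‖v‖ ^ 2) = Real.pi / b := by
    rw [h]; simp
  rw [← h2, ofReal_integral_eq_lintegral_ofReal]
  · refine Integrable.of_integral_ne_zero ?_
    rw [h2]; positivity
  · exact Eventually.of_forall fun _ => (Real.exp_pos _).le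

lemma convex_norm_rpow (p : ℝ) (hp : 1 ≤ p) :
    ConvexOn ℝ Set.univ (fun z : ℂ => ‖z‖ ^ p) := by
  refine ⟨convex_univ, fun x _ y _ a b ha hb hab => ?_⟩
  have h1 := (convexOn_univ_norm (E := ℂ)).2 (Set.mem_univ x) (Set.mem_univ y) ha hb hab
  have h2 := (convexOn_rpow hp).2 (Set.mem_Ici.2 (norm_nonneg x))
    (Set.mem_Ici.2 (norm_nonneg y)) ha hb hab
  exact (Real.rpow_le_rpow (norm_nonneg _) h1 (by linarith)).trans h2

lemma circle_ineq (p : ℝ) (hp : 1 ≤ p) (g : ℂ → ℂ) (hg : Differentiable ℂ g) (r : ℝ) :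
    ∫⁻ _ in Set.Ioo (-Real.pi) Real.pi, ENNReal.ofReal (‖g 0‖ ^ p) ≤
    ∫⁻ θ in Set.Ioo (-Real.pi) Real.pi,
      ENNReal.ofReal (‖g (Complex.polarCoord.symm (r, θ))‖ ^ p) := by
  have hpi := Real.pi_pos
  have hp0 : 0 ≤ p := by linarith
  have hgc := hg.continuous
  have hmap : ∀ θ : ℝ, Complex.polarCoord.symm (r, θ) = circleMap 0 r θ := by
    intro θ
    simp [circleMap, Complex.exp_mul_I]
  simp only [hmap]
  have hc1 : Continuous (fun θ : ℝ => g (circleMap 0 r θ)) :=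
    hgc.comp (continuous_circleMap 0 r)
  have hc0 : Continuous (fun z : ℂ => ‖z‖ ^ p) :=
    continuous_norm.rpow_const (fun _ => Or.inr hp0)
  have hc2 : Continuous (fun θ : ℝ => ‖g (circleMap 0 r θ)‖ ^ p) := hc0.comp hc1
  have hi1 : IntegrableOn (fun θ : ℝ => g (circleMap 0 r θ)) (Set.Ioo (-Real.pi) Real.pi) :=
    (hc1.integrableOn_Icc).mono_set Set.Ioo_subset_Icc_self
  have hi2 : IntegrableOn (fun θ : ℝ => ‖g (circleMap 0 r θ)‖ ^ p)
      (Set.Ioo (-Real.pi) Real.pi) :=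
    (hc2.integrableOn_Icc).mono_set Set.Ioo_subset_Icc_self
  have hvol : (volume : Measure ℝ) (Set.Ioo (-Real.pi) Real.pi) =
      ENNReal.ofReal (2 * Real.pi) := by rw [Real.volume_Ioo]; congr 1; ring
  have hvr : (volume : Measure ℝ).real (Set.Ioo (-Real.pi) Real.pi) = 2 * Real.pi := by
    rw [measureReal_def, hvol, ENNReal.toReal_ofReal (by positivity)]
  have hJ := (convex_norm_rpow p hp).map_set_average_le (μ := volume)
    (t := Set.Ioo (-Real.pi) Real.pi) (f := fun θ : ℝ => g (circleMap 0 r θ))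
    hc0.continuousOn isClosed_univ (by rw [hvol]; simp [hpi]) (by rw [hvol]; exact ENNReal.ofReal_ne_top)
    (by simp) hi1 hi2
  have hav : ⨍ θ in Set.Ioo (-Real.pi) Real.pi, g (circleMap 0 r θ) = g 0 := by
    have h1 : Real.circleAverage g 0 r = g 0 := DiffContOnCl.circleAverage hg.diffContOnCl
    rw [← h1, Real.circleAverage_eq_integral_add (-Real.pi), setAverage_eq, hvr]
    congr 1
    have h3 := intervalIntegral.integral_comp_add_right (a := 0) (b := 2 * Real.pi)
      (fun θ => g (circleMap 0 r θ)) (-Real.pi)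
    rw [h3, zero_add, show 2 * Real.pi + -Real.pi = Real.pi by ring,
      intervalIntegral.integral_of_le (by linarith), integral_Ioc_eq_integral_Ioo]
  rw [hav, setAverage_eq, hvr, smul_eq_mul] at hJ
  rw [setLIntegral_const, hvol, ← ofReal_integral_eq_lintegral_ofReal hi2
    (Eventually.of_forall fun _ => by positivity), ← ENNReal.ofReal_mul (by positivity)]
  apply ENNReal.ofReal_le_ofReal
  rw [inv_mul_eq_div, le_div_iff₀ (by positivity)] at hJ
  exact hJ

lemma gauss_mean (p b : ℝ) (hp : 1 ≤ p) (g : ℂ → ℂ) (hg : Differentiable ℂ g) :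
    ENNReal.ofReal (‖g 0‖ ^ p) * ∫⁻ w : ℂ, ENNReal.ofReal (Real.exp (-b * ‖w‖ ^ 2)) ≤
    ∫⁻ w : ℂ, ENNReal.ofReal (‖g w‖ ^ p) * ENNReal.ofReal (Real.exp (-b * ‖w‖ ^ 2)) := by
  have hp0 : 0 ≤ p := by linarith
  have hgc := hg.continuous
  have hc0 : Continuous (fun z : ℂ => ‖g z‖ ^ p) :=
    hgc.norm.rpow_const (fun _ => Or.inr hp0)
  have hcs : Continuous (fun x : ℝ × ℝ => Complex.polarCoord.symm x) := by
    simp only [Complex.polarCoord_symm_apply]; fun_prop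
  have hc1 : Continuous (fun x : ℝ × ℝ => ‖g (Complex.polarCoord.symm x)‖ ^ p) := hc0.comp hcs
  rw [← lintegral_const_mul' _ _ ENNReal.ofReal_ne_top,
    ← Complex.lintegral_comp_polarCoord_symm, ← Complex.lintegral_comp_polarCoord_symm,
    polarCoord_target, Measure.volume_eq_prod, setLIntegral_prod, setLIntegral_prod]
  · refine lintegral_mono fun r => ?_
    have := circle_ineq p hp g hg r
    simp only [Complex.norm_polarCoord_symm, smul_eq_mul]
    have e1 : ∀ x : ℝ≥0∞, ENNReal.ofReal r * (x * ENNReal.ofReal (Real.exp (-b * |r| ^ 2))) =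
      (ENNReal.ofReal r * ENNReal.ofReal (Real.exp (-b * |r| ^ 2))) * x := fun x => by ring
    simp only [e1]
    rw [lintegral_const_mul' _ _ (by finiteness), lintegral_const_mul' _ _ (by finiteness)]
    gcongr
  · refine Measurable.aemeasurable ?_
    simp only [Complex.norm_polarCoord_symm, smul_eq_mul]
    fun_prop
  · refine Measurable.aemeasurable ?_
    simp only [Complex.norm_polarCoord_symm, smul_eq_mul]
    have := hc1.measurable
    fun_prop

lemma gauss_rpow (α p x : ℝ) (hx : 0 ≤ x) (w : ℂ) :
    (x * gauss α w) ^ p = x ^ p * Real.exp (-(p * α / 2) * ‖w‖ ^ 2) := by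
  unfold gauss
  rw [Real.mul_rpow hx (Real.exp_pos _).le, ← Real.exp_mul]
  congr 2; ring

lemma shift_norm (α : ℝ) (f : ℂ → ℂ) (z w : ℂ) :
    ‖f (z + w)‖ * gauss α (z + w) =
    gauss α z * (‖f (z + w) * Complex.exp (-(α : ℂ) * w * (starRingEnd ℂ) z)‖ * gauss α w) := by
  unfold gauss
  rw [norm_mul, Complex.norm_exp]
  have h : Real.exp (-α * ‖z + w‖ ^ 2 / 2) = Real.exp (-α * ‖z‖ ^ 2 / 2) *
      Real.exp ((-(α : ℂ) * w * (starRingEnd ℂ) z).re) * Real.exp (-α * ‖w‖ ^ 2 / 2) := by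
    rw [← Real.exp_add, ← Real.exp_add]
    congr 1
    simp only [Complex.sq_norm, Complex.normSq_apply]
    simp
    ring
  rw [h]; ring

lemma fock_sup_le (α p : ℝ) (hα : 0 < α) (hp : 1 ≤ p) (f : ℂ → ℂ) (hf : Differentiable ℂ f) :
    fockNormInf α f ≤ fockNormP α p f := by
  have hp0 : 0 < p := by linarith
  have hpi := Real.pi_pos
  refine iSup_le fun z => ?_
  unfold fockNormP
  rw [one_div, ENNReal.le_rpow_inv_iff hp0,
    ENNReal.ofReal_rpow_of_nonneg (by unfold gauss; positivity) hp0.le]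
  set g : ℂ → ℂ := fun w => f (z + w) * Complex.exp (-(α : ℂ) * w * (starRingEnd ℂ) z) with hgdef
  have hg : Differentiable ℂ g := by
    refine (hf.comp (differentiable_id.const_add z)).mul ?_
    fun_prop
  have hg0 : g 0 = f z := by simp [hgdef]
  have hm := gauss_mean p (p * α / 2) hp g hg
  rw [lint_gauss _ (by positivity), hg0] at hm
  have hG : 0 ≤ gauss α z := (Real.exp_pos _).le
  have hint : ∫⁻ w : ℂ, ENNReal.ofReal ((‖f w‖ * gauss α w) ^ p) =
      ENNReal.ofReal (gauss α z ^ p) * ∫⁻ w : ℂ, ENNReal.ofReal (‖g w‖ ^ p) *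
        ENNReal.ofReal (Real.exp (-(p * α / 2) * ‖w‖ ^ 2)) := by
    rw [← lintegral_const_mul' _ _ ENNReal.ofReal_ne_top,
      ← lintegral_add_left_eq_self _ z]
    refine lintegral_congr fun w => ?_
    rw [shift_norm, Real.mul_rpow hG (by unfold gauss; positivity),
      gauss_rpow _ _ _ (norm_nonneg _), ENNReal.ofReal_mul (by positivity),
      ENNReal.ofReal_mul (by positivity)]
  rw [hint, Real.mul_rpow (norm_nonneg _) hG, ENNReal.ofReal_mul (by positivity)]
  calc ENNReal.ofReal (‖f z‖ ^ p) * ENNReal.ofReal (gauss α z ^ p)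
      = ENNReal.ofReal (p * α / (2 * Real.pi)) * (ENNReal.ofReal (gauss α z ^ p) *
        (ENNReal.ofReal (‖f z‖ ^ p) * ENNReal.ofReal (Real.pi / (p * α / 2)))) := by
        rw [← ENNReal.ofReal_mul (by positivity), ← ENNReal.ofReal_mul (by positivity),
          ← ENNReal.ofReal_mul (by positivity), ← ENNReal.ofReal_mul (by positivity)]
        congr 1
        field_simp
    _ ≤ _ := by gcongr

lemma dil_bound (α r p : ℝ) (hα : 0 < α) (hr0 : 0 ≤ r) (hr : r < 1) (hp : 1 ≤ p)
    (f : ℂ → ℂ) (hfin : fockNormInf α f ≠ ⊤) :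
    fockNormP α p (fun z => f (r * z)) ≤
      ENNReal.ofReal ((1 - r ^ 2)⁻¹) ^ (1 / p) * fockNormInf α f := by
  have hp0 : 0 < p := by linarith
  have hpi := Real.pi_pos
  have hr2 : 0 < 1 - r ^ 2 := by nlinarith
  set M := (fockNormInf α f).toReal with hM
  have hM0 : 0 ≤ M := ENNReal.toReal_nonneg
  have hb : ∀ z, ‖f z‖ * gauss α z ≤ M := by
    intro z
    rw [hM, ← ENNReal.ofReal_le_iff_le_toReal hfin]
    exact le_iSup (fun z => ENNReal.ofReal (‖f z‖ * gauss α z)) z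
  have hN : fockNormInf α f = ENNReal.ofReal M := (ENNReal.ofReal_toReal hfin).symm
  have hpt : ∀ z : ℂ, ‖f (r * z)‖ * gauss α z ≤ M * gauss (α * (1 - r ^ 2)) z := by
    intro z
    have h1 : gauss α z = gauss α (r * z) * gauss (α * (1 - r ^ 2)) z := by
      unfold gauss
      rw [← Real.exp_add, norm_mul, Complex.norm_real, Real.norm_eq_abs, mul_pow, sq_abs]
      congr 1; ring
    rw [h1, ← mul_assoc]
    exact mul_le_mul_of_nonneg_right (hb _) (Real.exp_pos _).le
  rw [hN]
  unfold fockNormP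
  rw [one_div, ENNReal.rpow_inv_le_iff hp0, ENNReal.mul_rpow_of_nonneg _ _ hp0.le,
    ENNReal.rpow_inv_rpow hp0.ne']
  calc _ ≤ ENNReal.ofReal (p * α / (2 * Real.pi)) *
        ∫⁻ z : ℂ, ENNReal.ofReal (M ^ p) *
          ENNReal.ofReal (Real.exp (-(p * (α * (1 - r ^ 2)) / 2) * ‖z‖ ^ 2)) := by
        gcongr with z
        rw [← ENNReal.ofReal_mul (by positivity), ← gauss_rpow _ _ _ hM0]
        apply ENNReal.ofReal_le_ofReal
        exact Real.rpow_le_rpow (by unfold gauss; positivity) (hpt z) hp0.le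
    _ = _ := by
        rw [lintegral_const_mul' _ _ ENNReal.ofReal_ne_top, lint_gauss _ (by positivity),
          ENNReal.ofReal_rpow_of_nonneg hM0 hp0.le, ← ENNReal.ofReal_mul (by positivity),
          ← ENNReal.ofReal_mul (by positivity), ← ENNReal.ofReal_mul (by positivity)]
        congr 1
        field_simp

/-- `μ` is an `(∞,q)` Fock-Carleson measure iff it is a `(p,q)` Fock-Carleson
measure for every `p ≥ 1`, with a constant independent of `p`. -/
theorem stmt1 (α q : ℝ) (hα : 0 < α) (hq : 0 < q) (μ : Measure ℂ) :
    IsInfqCarleson α q μ ↔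
      ∃ C > (0 : ℝ), ∀ p : ℝ, 1 ≤ p → ∀ f : ℂ → ℂ, MemFock α p f →
        (carlesonInt α q μ f) ^ (1 / q) ≤ ENNReal.ofReal C * fockNormP α p f := by
  constructor
  · rintro ⟨C, hC, h⟩
    refine ⟨C, hC, fun p hp f hf => ?_⟩
    have hle := fock_sup_le α p hα hp f hf.1
    refine (h f ⟨hf.1, ne_top_of_le_ne_top hf.2 hle⟩).trans ?_
    gcongr
  · rintro ⟨C, hC, h⟩
    refine ⟨C, hC, fun f hf => ?_⟩
    obtain ⟨hd, hfin⟩ := hf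
    set K : ℝ≥0∞ := ENNReal.ofReal C * fockNormInf α f with hK
    have key : ∀ r : ℝ, 0 ≤ r → r < 1 →
        carlesonInt α q μ (fun z => f (r * z)) ≤ K ^ q := by
      intro r hr0 hr
      have hr2 : 0 < 1 - r ^ 2 := by nlinarith
      have hdil : Differentiable ℂ (fun z : ℂ => f (r * z)) :=
        hd.comp (differentiable_id.const_mul (r : ℂ))
      have h1 : ∀ p : ℝ, 1 ≤ p → (carlesonInt α q μ (fun z => f (r * z))) ^ (1 / q) ≤
          ENNReal.ofReal ((1 - r ^ 2)⁻¹) ^ (1 / p) * K := by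
        intro p hp
        have hp0 : 0 < p := by linarith
        have hb := dil_bound α r p hα hr0 hr hp f hfin
        have ht : ENNReal.ofReal ((1 - r ^ 2)⁻¹) ^ (1 / p) * fockNormInf α f ≠ ⊤ :=
          ENNReal.mul_ne_top (ENNReal.rpow_ne_top_of_nonneg (by positivity)
            ENNReal.ofReal_ne_top) hfin
        refine (h p hp _ ⟨hdil, ne_top_of_le_ne_top ht hb⟩).trans ?_
        calc _ ≤ ENNReal.ofReal C *
              (ENNReal.ofReal ((1 - r ^ 2)⁻¹) ^ (1 / p) * fockNormInf α f) := by gcongr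
          _ = _ := by rw [hK]; ring
      have hlim : Tendsto (fun p : ℝ => ENNReal.ofReal ((1 - r ^ 2)⁻¹) ^ (1 / p) * K) atTop
          (𝓝 (1 * K)) := by
        refine ENNReal.Tendsto.mul_const ?_ (Or.inl one_ne_zero)
        have hx : 0 < (1 - r ^ 2)⁻¹ := by positivity
        have h2 : Tendsto (fun p : ℝ => ((1 - r ^ 2)⁻¹) ^ (1 / p)) atTop (𝓝 1) := by
          have h3 : Tendsto (fun p : ℝ => 1 / p) atTop (𝓝 0) := by
            simpa using tendsto_inv_atTop_zero (𝕜 := ℝ)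
          have h4 := (Real.continuousAt_const_rpow hx.ne' (b := 0)).tendsto.comp h3
          simpa [Function.comp_def] using h4
        have h5 := ENNReal.tendsto_ofReal h2
        rw [ENNReal.ofReal_one] at h5
        refine h5.congr fun p => ?_
        rw [ENNReal.ofReal_rpow_of_pos hx]
      have h6 := ge_of_tendsto hlim (eventually_atTop.2 ⟨1, h1⟩)
      rw [one_mul, one_div, ENNReal.rpow_inv_le_iff hq] at h6
      exact h6
    rw [one_div, ENNReal.rpow_inv_le_iff hq]
    set r : ℕ → ℝ := fun n => 1 - 1 / ((n : ℝ) + 1) with hrdef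
    have hrt : Tendsto r atTop (𝓝 1) := by
      simpa [hrdef] using (tendsto_one_div_add_atTop_nhds_zero_nat (𝕜 := ℝ)).const_sub 1
    have hc : Continuous (fun w : ℂ × ℂ => ENNReal.ofReal ((‖f w.1‖ * gauss α w.2) ^ q)) := by
      refine ENNReal.continuous_ofReal.comp ?_
      refine Continuous.rpow_const ?_ (fun _ => Or.inr hq.le)
      have := hd.continuous
      unfold gauss
      fun_prop
    have hpt : ∀ z : ℂ, ENNReal.ofReal ((‖f z‖ * gauss α z) ^ q) =
        liminf (fun n : ℕ => ENNReal.ofReal ((‖f (r n * z)‖ * gauss α z) ^ q)) atTop := by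
      intro z
      symm
      apply Tendsto.liminf_eq
      have h7 : Tendsto (fun n : ℕ => (((r n : ℂ) * z, z) : ℂ × ℂ)) atTop (𝓝 (z, z)) := by
        refine Tendsto.prodMk_nhds ?_ tendsto_const_nhds
        have h8 : Tendsto (fun n => (r n : ℂ)) atTop (𝓝 ((1 : ℝ) : ℂ)) :=
          (Complex.continuous_ofReal.tendsto 1).comp hrt
        simpa using h8.mul_const z
      have h10 := (hc.tendsto (z, z)).comp h7
      simp only [Function.comp_def] at h10
      exact h10
    unfold carlesonInt
    rw [lintegral_congr hpt]
    have hmeas : ∀ n : ℕ, Measurable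
        (fun z : ℂ => ENNReal.ofReal ((‖f (r n * z)‖ * gauss α z) ^ q)) := by
      intro n
      have h9 : Continuous (fun z : ℂ => (((r n : ℂ) * z, z) : ℂ × ℂ)) := by fun_prop
      have h11 := (hc.comp h9).measurable
      simp only [Function.comp_def] at h11
      exact h11
    refine (lintegral_liminf_le hmeas).trans ?_
    · refine liminf_le_of_le (by isBoundedDefault) fun b hb => ?_
      obtain ⟨n, hn⟩ := hb.exists
      refine hn.trans (key (r n) ?_ ?_)
      · have : 1 / ((n : ℝ) + 1) ≤ 1 := by
          rw [div_le_one (by positivity)]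
          have : (0 : ℝ) ≤ n := n.cast_nonneg
          linarith
        simp only [hrdef]; linarith
      · have : 0 < 1 / ((n : ℝ) + 1) := by positivity
        simp only [hrdef]; linarith
end

section
/- Let α > 0, 0 < q < ∞, and let μ be a positive Borel measure on ℂ. If μ is an (∞,q) Fock-Carleson measure, then for every t > 0 the t-Berezin transform μ̃_t is integrable on ℂ: ∫_ℂ μ̃_t(z) dA(z) < ∞. -/
open MeasureTheory Filter Metric
open scoped ENNReal Topology

/-- The doubly periodic modulus of the theta function. -/
noncomputable def thetaG (w : ℂ) : ℝ :=
  ‖jacobiTheta₂ w Complex.I‖ * Real.exp (-Real.pi * w.im ^ 2)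

lemma thetaG_periodic_one : Function.Periodic thetaG 1 := by
  intro w
  simp [thetaG, jacobiTheta₂_add_left]

lemma thetaG_periodic_I : Function.Periodic thetaG Complex.I := by
  intro w
  have hre : (-(Real.pi : ℂ) * Complex.I * (Complex.I + 2 * w)).re
      = Real.pi + 2 * Real.pi * w.im := by
    simp
    ring
  simp only [thetaG, jacobiTheta₂_add_left', norm_mul, Complex.norm_exp, hre]
  rw [mul_right_comm, ← Real.exp_add, mul_comm]
  congr 2
  simp
  ring

lemma thetaG_continuous : Continuous thetaG := by
  have h : Differentiable ℂ (fun w => jacobiTheta₂ w Complex.I) :=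
    fun w => differentiableAt_jacobiTheta₂_fst w (by simp)
  have := h.continuous
  have h2 := Complex.continuous_im
  unfold thetaG
  fun_prop

lemma thetaG_zero_pos : 0 < thetaG 0 := by
  have hs := hasSum_jacobiTheta₂_term 0 (τ := Complex.I) (by simp)
  have hr := Complex.hasSum_re hs
  have hterm : ∀ n : ℤ, (jacobiTheta₂_term n 0 Complex.I).re = Real.exp (-Real.pi * n ^ 2) := by
    intro n
    have : jacobiTheta₂_term n 0 Complex.I = ((Real.exp (-Real.pi * n ^ 2) : ℝ) : ℂ) := by
      rw [jacobiTheta₂_term]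
      push_cast
      congr 1
      linear_combination (Real.pi * (n : ℂ) ^ 2) * Complex.I_sq
    rw [this, Complex.ofReal_re]
  have hpos : 0 < (jacobiTheta₂ 0 Complex.I).re := by
    have h0 := hr.summable.tsum_pos (fun n => by rw [hterm]; positivity) (0 : ℤ)
      (by rw [hterm]; positivity)
    rwa [hr.tsum_eq] at h0
  have : jacobiTheta₂ 0 Complex.I ≠ 0 := by
    intro h0
    rw [h0] at hpos
    simp at hpos
  unfold thetaG
  positivity

lemma square_reduce (w : ℂ) : ∃ k ∈ (Set.Icc (0 : ℝ) 1 ×ℂ Set.Icc (0 : ℝ) 1), ∀ b,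
    thetaG (w - b) = thetaG (k - b) := by
  refine ⟨w - (⌊w.re⌋ : ℂ) * 1 - (⌊w.im⌋ : ℂ) * Complex.I, ?_, ?_⟩
  · rw [Complex.mem_reProdIm]
    have h1 := Int.floor_le w.re
    have h2 := Int.lt_floor_add_one w.re
    have h3 := Int.floor_le w.im
    have h4 := Int.lt_floor_add_one w.im
    simp only [Set.mem_Icc]
    simp
    exact ⟨(Int.fract_lt_one _).le, (Int.fract_lt_one _).le⟩
  · intro b
    have e : w - (⌊w.re⌋ : ℂ) * 1 - (⌊w.im⌋ : ℂ) * Complex.I - b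
        = (w - b) - (⌊w.re⌋ : ℂ) * 1 - (⌊w.im⌋ : ℂ) * Complex.I := by ring
    rw [e, (thetaG_periodic_I.int_mul _).sub_eq, (thetaG_periodic_one.int_mul _).sub_eq]

lemma square_compact : IsCompact (Set.Icc (0 : ℝ) 1 ×ℂ Set.Icc (0 : ℝ) 1) :=
  isCompact_Icc.reProdIm isCompact_Icc

lemma thetaG_bdd : ∃ M : ℝ, ∀ w, thetaG w ≤ M := by
  obtain ⟨M, hM⟩ := square_compact.bddAbove_image thetaG_continuous.continuousOn
  refine ⟨M, fun w => ?_⟩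
  obtain ⟨k, hk, hkb⟩ := square_reduce w
  have := hkb 0
  simp only [sub_zero] at this
  rw [this]
  exact hM ⟨k, hk, rfl⟩

lemma thetaG_cover : ∃ T : Finset ℂ, ∀ w, ∃ b ∈ T, thetaG 0 / 2 < thetaG (w - b) := by
  have hp := thetaG_zero_pos
  obtain ⟨T, hT⟩ := square_compact.elim_finite_subcover
    (fun b : ℂ => {w : ℂ | thetaG 0 / 2 < thetaG (w - b)})
    (fun b => isOpen_lt continuous_const (thetaG_continuous.comp (continuous_sub_right b)))
    (fun w _ => Set.mem_iUnion.2 ⟨w, by simp; linarith⟩)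
  refine ⟨T, fun w => ?_⟩
  obtain ⟨k, hk, hkb⟩ := square_reduce w
  have := hT hk
  simp only [Set.mem_iUnion, Set.mem_ofPred_eq, exists_prop] at this
  obtain ⟨b, hb, h⟩ := this
  exact ⟨b, hb, by rw [hkb]; exact h⟩

/-- Weyl translates of the (entire) theta function. -/
noncomputable def testF (α s : ℝ) (a z : ℂ) : ℂ :=
  Complex.exp (α * (z - a) ^ 2 / 2 + α * (starRingEnd ℂ a) * z - α * (‖a‖ : ℂ) ^ 2 / 2) *
    jacobiTheta₂ (s * (z - a)) Complex.I

lemma testF_diff (α s : ℝ) (a : ℂ) : Differentiable ℂ (testF α s a) := by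
  have h : Differentiable ℂ (fun w => jacobiTheta₂ w Complex.I) :=
    fun w => differentiableAt_jacobiTheta₂_fst w (by simp)
  have h2 : Differentiable ℂ (fun z => jacobiTheta₂ (s * (z - a)) Complex.I) :=
    h.comp (f := fun z : ℂ => (s : ℂ) * (z - a)) (by fun_prop)
  unfold testF
  fun_prop

lemma testF_norm (α s : ℝ) (hs : Real.pi * s ^ 2 = α) (a z : ℂ) :
    ‖testF α s a z‖ * gauss α z = thetaG (s * (z - a)) := by
  unfold testF gauss thetaG
  rw [norm_mul, Complex.norm_exp, mul_comm (Real.exp _), mul_assoc, ← Real.exp_add]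
  congr 2
  have h1 : ‖a‖ ^ 2 = a.re ^ 2 + a.im ^ 2 := by
    rw [Complex.sq_norm, Complex.normSq_apply]; ring
  have h2 : ‖z‖ ^ 2 = z.re ^ 2 + z.im ^ 2 := by
    rw [Complex.sq_norm, Complex.normSq_apply]; ring
  have h3 : ((α : ℂ) * (‖a‖ : ℂ) ^ 2 / 2).re = α * (a.re ^ 2 + a.im ^ 2) / 2 := by
    rw [← h1, ← Complex.ofReal_re (α * ‖a‖ ^ 2 / 2)]
    push_cast
    rfl
  have h4 : ((α : ℂ) * (z - a) ^ 2 / 2).re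
      = α * ((z.re - a.re) ^ 2 - (z.im - a.im) ^ 2) / 2 := by
    have : ((α : ℂ) * (z - a) ^ 2 / 2) = ((α / 2 : ℝ) : ℂ) * ((z - a) * (z - a)) := by
      push_cast; ring
    rw [this, Complex.re_ofReal_mul, Complex.mul_re]
    simp only [Complex.sub_re, Complex.sub_im]
    ring
  have h5 : ((α : ℂ) * (starRingEnd ℂ a) * z).re = α * (a.re * z.re + a.im * z.im) := by
    rw [mul_assoc, Complex.re_ofReal_mul, Complex.mul_re]
    simp
  have h6 : ((s : ℂ) * (z - a)).im = s * (z.im - a.im) := by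
    rw [Complex.im_ofReal_mul, Complex.sub_im]
  rw [Complex.sub_re, Complex.add_re, h3, h4, h5, h2, h6, ← hs]
  ring

lemma carleson_finite (α q : ℝ) (hα : 0 < α) (hq : 0 < q) (μ : Measure ℂ)
    (h : IsInfqCarleson α q μ) : μ Set.univ < ⊤ := by
  obtain ⟨C, hC, h⟩ := h
  obtain ⟨M, hM⟩ := thetaG_bdd
  obtain ⟨T, hT⟩ := thetaG_cover
  have hp := thetaG_zero_pos
  set s : ℝ := Real.sqrt (α / Real.pi) with hsdef
  have hs0 : 0 < s := Real.sqrt_pos.2 (by positivity)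
  have hs : Real.pi * s ^ 2 = α := by
    rw [hsdef, Real.sq_sqrt (by positivity)]
    field_simp
  have key : ∀ b : ℂ, μ {z : ℂ | thetaG 0 / 2 < thetaG (s * z - b)} < ⊤ := by
    intro b
    set a : ℂ := b / s with ha
    have hsa : ∀ z : ℂ, (s : ℂ) * (z - a) = s * z - b := by
      intro z
      have : (s : ℂ) ≠ 0 := by exact_mod_cast hs0.ne'
      rw [ha]; field_simp
    have hn : ∀ z, ‖testF α s a z‖ * gauss α z = thetaG (s * z - b) := by
      intro z; rw [testF_norm α s hs, hsa]
    have hfin : fockNormInf α (testF α s a) ≠ ⊤ := by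
      refine ne_top_of_le_ne_top (ENNReal.ofReal_ne_top (r := M)) (iSup_le fun z => ?_)
      rw [hn]
      exact ENNReal.ofReal_le_ofReal (hM _)
    have h1 := h _ ⟨testF_diff α s a, hfin⟩
    have h2 : carlesonInt α q μ (testF α s a) ≠ ⊤ := by
      intro htop
      rw [htop, ENNReal.top_rpow_of_pos (by positivity)] at h1
      exact ENNReal.mul_ne_top ENNReal.ofReal_ne_top hfin (top_le_iff.1 h1)
    unfold carlesonInt at h2
    simp_rw [hn] at h2
    have hcont : Continuous (fun z : ℂ => thetaG (s * z - b)) :=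
      thetaG_continuous.comp (by fun_prop)
    have hmeas : Measurable (fun z : ℂ => ENNReal.ofReal (thetaG (s * z - b) ^ q)) :=
      (hcont.measurable.pow_const q).ennreal_ofReal
    have hε : ENNReal.ofReal ((thetaG 0 / 2) ^ q) ≠ 0 := by
      rw [Ne, ENNReal.ofReal_eq_zero, not_le]; positivity
    have hmk := meas_ge_le_lintegral_div (μ := μ) hmeas.aemeasurable hε ENNReal.ofReal_ne_top
    refine lt_of_le_of_lt ((measure_mono ?_).trans hmk) (ENNReal.div_lt_top h2 hε)
    intro z hz
    exact ENNReal.ofReal_le_ofReal (Real.rpow_le_rpow (by positivity) (le_of_lt hz) hq.le)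
  have hcov : (Set.univ : Set ℂ) ⊆ ⋃ b ∈ T, {z : ℂ | thetaG 0 / 2 < thetaG (s * z - b)} := by
    intro z _
    obtain ⟨b, hb, hlt⟩ := hT (s * z)
    exact Set.mem_biUnion (show b ∈ (T : Set ℂ) from hb) hlt
  refine lt_of_le_of_lt ((measure_mono hcov).trans (measure_biUnion_finset_le T _)) ?_
  exact ENNReal.sum_lt_top.2 fun b _ => key b

/-- If `μ` is an `(∞,q)` Fock-Carleson measure, then for every `t > 0` the
`t`-Berezin transform `μ̃_t` is integrable on `ℂ`. -/
theorem stmt2 (α q : ℝ) (hα : 0 < α) (hq : 0 < q) (μ : Measure ℂ)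
    (h : IsInfqCarleson α q μ) (t : ℝ) (ht : 0 < t) :
    (∫⁻ z : ℂ, berezinM α t μ z) < ⊤ := by
  have : IsFiniteMeasure μ := ⟨carleson_finite α q hα hq μ h⟩
  unfold berezinM
  have hb : 0 < α * t / 2 := by positivity
  set b := α * t / 2
  have hint : Integrable (fun z : ℂ => Real.exp (-b * ‖z‖ ^ 2)) := by
    have h1 := (GaussianFourier.integrable_cexp_neg_mul_sq_norm_add (V := ℂ) (b := (b : ℂ))
      (by simpa using hb) 0 0).norm
    refine h1.congr (Eventually.of_forall fun z => ?_)
    simp only [Complex.norm_exp, zero_mul, add_zero]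
    congr 1
    have : (-(b : ℂ) * (‖z‖ : ℂ) ^ 2) = ((-b * ‖z‖ ^ 2 : ℝ) : ℂ) := by push_cast; rfl
    rw [this, Complex.ofReal_re]
  have hI : (∫⁻ z : ℂ, ENNReal.ofReal (Real.exp (-b * ‖z‖ ^ 2))) < ⊤ := hint.lintegral_lt_top
  rw [lintegral_const_mul' _ _ ENNReal.ofReal_ne_top]
  refine ENNReal.mul_lt_top ENNReal.ofReal_lt_top ?_
  rw [lintegral_lintegral_swap]
  · have : ∀ ω : ℂ, (∫⁻ z : ℂ, ENNReal.ofReal (Real.exp (-b * ‖z - ω‖ ^ 2)))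
        = ∫⁻ z : ℂ, ENNReal.ofReal (Real.exp (-b * ‖z‖ ^ 2)) := fun ω =>
      lintegral_sub_right_eq_self (fun z : ℂ => ENNReal.ofReal (Real.exp (-b * ‖z‖ ^ 2))) ω
    simp_rw [this]
    rw [lintegral_const]
    exact ENNReal.mul_lt_top hI (measure_lt_top μ _)
  · refine Measurable.aemeasurable ?_
    refine Measurable.ennreal_ofReal ?_
    refine Continuous.measurable ?_
    fun_prop
end

section
/- Let α > 0 and let μ be a positive Borel measure on ℂ satisfying condition (M). Then the Toeplitz operator T_μ is bounded on F_α^∞ if and only if the 1-Berezin transform μ̃_1 is bounded on ℂ, i.e. sup_{z∈ℂ} (α/π) ∫_ℂ e^{-(α/2)|z−ω|²} dμ(ω) < ∞. -/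
open MeasureTheory Filter Metric
open scoped ENNReal Topology

/-- Condition (M): `∫ e^{2α Re(z̄ω)} e^{-α|ω|²} dμ(ω) < ∞` for every `z`. -/
def ConditionM (α : ℝ) (μ : Measure ℂ) : Prop :=
  ∀ z : ℂ, (∫⁻ ω : ℂ,
    ENNReal.ofReal (Real.exp (2 * α * ((starRingEnd ℂ) z * ω).re - α * ‖ω‖ ^ 2)) ∂μ) < ⊤

/-- The Toeplitz operator with symbol `μ`:
`T_μ f(z) = (α/π) ∫ f(ω) e^{α z ω̄} e^{-α|ω|²} dμ(ω)`. -/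
noncomputable def toeplitzM (α : ℝ) (μ : Measure ℂ) (f : ℂ → ℂ) (z : ℂ) : ℂ :=
  ((α / Real.pi : ℝ) : ℂ) *
    ∫ ω : ℂ, f ω * Complex.exp ((α : ℂ) * z * (starRingEnd ℂ) ω - ((α * ‖ω‖ ^ 2 : ℝ) : ℂ)) ∂μ

lemma aux_norm_sub_sq (z w : ℂ) :
    ‖z - w‖ ^ 2 = ‖z‖ ^ 2 + ‖w‖ ^ 2 - 2 * (z * (starRingEnd ℂ) w).re := by
  simp only [Complex.sq_norm, Complex.normSq_apply, Complex.sub_re, Complex.sub_im,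
    Complex.mul_re, Complex.conj_re, Complex.conj_im]
  ring

lemma aux_midpoint (z w m : ℂ) :
    ‖z - m‖ ^ 2 + ‖m - w‖ ^ 2 = 2 * ‖m - (z + w) / 2‖ ^ 2 + ‖z - w‖ ^ 2 / 2 := by
  have e : (z + w) / 2 = ((1 / 2 : ℝ) : ℂ) * (z + w) := by push_cast; ring
  rw [e]
  simp only [Complex.sq_norm, Complex.normSq_apply, Complex.sub_re, Complex.sub_im,
    Complex.re_ofReal_mul, Complex.im_ofReal_mul, Complex.add_re, Complex.add_im]
  ring

lemma aux_norm_exp (α : ℝ) (z w : ℂ) :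
    ‖Complex.exp ((α : ℂ) * z * (starRingEnd ℂ) w - ((α * ‖w‖ ^ 2 : ℝ) : ℂ))‖
      = Real.exp (α * (z * (starRingEnd ℂ) w).re - α * ‖w‖ ^ 2) := by
  rw [Complex.norm_exp, Complex.sub_re, Complex.ofReal_re, mul_assoc, Complex.re_ofReal_mul]

lemma aux_four (c : ℝ) (hc : 0 ≤ c) (w : ℂ) :
    Real.exp (c * ‖w‖) ≤ Real.exp (c * (w.re + w.im)) + Real.exp (c * (w.re - w.im)) +
      Real.exp (c * (-w.re + w.im)) + Real.exp (c * (-w.re - w.im)) := by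
  have h : ‖w‖ ≤ |w.re| + |w.im| := Complex.norm_le_abs_re_add_abs_im w
  have h2 : Real.exp (c * ‖w‖) ≤ Real.exp (c * (|w.re| + |w.im|)) :=
    Real.exp_le_exp.mpr (mul_le_mul_of_nonneg_left h hc)
  have p1 := Real.exp_pos (c * (w.re + w.im))
  have p2 := Real.exp_pos (c * (w.re - w.im))
  have p3 := Real.exp_pos (c * (-w.re + w.im))
  have p4 := Real.exp_pos (c * (-w.re - w.im))
  rcases abs_cases w.re with ⟨h3, -⟩ | ⟨h3, -⟩ <;> rcases abs_cases w.im with ⟨h4, -⟩ | ⟨h4, -⟩ <;>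
    rw [h3, h4] at h2 <;> first | linarith | (rw [← sub_eq_add_neg] at h2; linarith)

lemma aux_gauss_finite (b : ℝ) (hb : 0 < b) :
    (∫⁻ m : ℂ, ENNReal.ofReal (Real.exp (-b * ‖m‖ ^ 2))) < ⊤ := by
  have h := GaussianFourier.integrable_cexp_neg_mul_sq_norm_add (V := ℂ) (b := (b : ℂ))
    (by simpa using hb) 0 0
  have h2 := h.norm.lintegral_lt_top
  refine lt_of_eq_of_lt (lintegral_congr fun m => ?_) h2
  congr 1
  rw [Complex.norm_exp]
  congr 1
  simp [← Complex.ofReal_pow]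

lemma aux_gauss_ne_zero (b : ℝ) :
    (∫⁻ m : ℂ, ENNReal.ofReal (Real.exp (-b * ‖m‖ ^ 2))) ≠ 0 := by
  rw [ne_eq, lintegral_eq_zero_iff (by fun_prop)]
  intro h
  have : ∀ᵐ m : ℂ, False := by
    filter_upwards [h] with m hm
    simp only [Pi.zero_apply, ENNReal.ofReal_eq_zero] at hm
    exact absurd hm (not_le.mpr (Real.exp_pos _))

  exact (NeZero.ne (volume : Measure ℂ)) (by simpa using this)

/-- Convolution of two Gaussians. -/
lemma aux_conv (α : ℝ) (z w : ℂ) :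
    (∫⁻ m : ℂ, ENNReal.ofReal (Real.exp (-α * ‖z - m‖ ^ 2)) *
      ENNReal.ofReal (Real.exp (-α * ‖m - w‖ ^ 2))) =
    (∫⁻ m : ℂ, ENNReal.ofReal (Real.exp (-(2 * α) * ‖m‖ ^ 2))) *
      ENNReal.ofReal (Real.exp (-(α * 1 / 2) * ‖z - w‖ ^ 2)) := by
  rw [← lintegral_sub_right_eq_self
    (fun m : ℂ => ENNReal.ofReal (Real.exp (-(2 * α) * ‖m‖ ^ 2))) ((z + w) / 2),
    ← lintegral_mul_const' _ _ ENNReal.ofReal_ne_top]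
  refine lintegral_congr fun m => ?_
  rw [← ENNReal.ofReal_mul (Real.exp_pos _).le, ← ENNReal.ofReal_mul (Real.exp_pos _).le,
    ← Real.exp_add, ← Real.exp_add]
  congr 2
  linear_combination -α * aux_midpoint z w m

lemma aux_sfinite (α : ℝ) (μ : Measure ℂ) (hM : ConditionM α μ) : SFinite μ := by
  set g : ℂ → ℝ≥0∞ := fun ω =>
    ENNReal.ofReal (Real.exp (2 * α * ((starRingEnd ℂ) 0 * ω).re - α * ‖ω‖ ^ 2)) with hg
  have hgm : Measurable g := by
    refine (Continuous.measurable ?_).ennreal_ofReal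
    fun_prop
  have hfin : IsFiniteMeasure (μ.withDensity g) := isFiniteMeasure_withDensity (hM 0).ne
  have := withDensity_inv_same (μ := μ) hgm
    (Eventually.of_forall fun x => (ENNReal.ofReal_pos.mpr (Real.exp_pos _)).ne')
    (Eventually.of_forall fun x => ENNReal.ofReal_ne_top)
  rw [← this]
  infer_instance

lemma aux_forward (α : ℝ) (hα : 0 < α) (μ : Measure ℂ) (hM : ConditionM α μ) (C : ℝ) (hC : 0 < C)
    (hT : ∀ f : ℂ → ℂ, MemFockInf α f →
        fockNormInf α (toeplitzM α μ f) ≤ ENNReal.ofReal C * fockNormInf α f) (z : ℂ) :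
    ENNReal.ofReal (α / Real.pi) *
      (∫⁻ ω : ℂ, ENNReal.ofReal (Real.exp (-α * ‖z - ω‖ ^ 2)) ∂μ) ≤ ENNReal.ofReal C := by
  set f : ℂ → ℂ := fun ω => Complex.exp ((α : ℂ) * (starRingEnd ℂ) z * ω) with hf
  have hfn : fockNormInf α f ≤ ENNReal.ofReal (Real.exp (α * ‖z‖ ^ 2 / 2)) := by
    refine iSup_le fun ω => ENNReal.ofReal_le_ofReal ?_
    rw [hf, gauss, Complex.norm_exp, ← Real.exp_add, mul_assoc, Complex.re_ofReal_mul]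
    refine Real.exp_le_exp.mpr ?_
    have h := aux_norm_sub_sq ω z
    rw [mul_comm ω] at h
    nlinarith [mul_nonneg hα.le (sq_nonneg ‖ω - z‖)]
  have hmem : MemFockInf α f := ⟨by fun_prop, (hfn.trans_lt ENNReal.ofReal_lt_top).ne⟩
  have h1 := (hT f hmem).trans (mul_le_mul_right hfn _)
  rw [← ENNReal.ofReal_mul hC.le] at h1
  have h2 := (le_iSup (fun z : ℂ => ENNReal.ofReal (‖toeplitzM α μ f z‖ * gauss α z)) z).trans h1
  set g : ℂ → ℝ := fun ω =>
    Real.exp (2 * α * ((starRingEnd ℂ) z * ω).re - α * ‖ω‖ ^ 2) with hg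
  have hgc : Continuous g := by fun_prop
  have hgi : Integrable g μ := by
    refine ⟨hgc.aestronglyMeasurable, ?_⟩
    rw [hasFiniteIntegral_iff_ofReal (Eventually.of_forall fun x => (Real.exp_pos _).le)]
    exact hM z
  have h3 : toeplitzM α μ f z = ((α / Real.pi * ∫ ω, g ω ∂μ : ℝ) : ℂ) := by
    rw [toeplitzM, Complex.ofReal_mul, ← integral_complex_ofReal]
    congr 1
    refine integral_congr_ae (Eventually.of_forall fun ω => ?_)
    simp only [hf, hg]
    rw [← Complex.exp_add, Complex.ofReal_exp]
    congr 1
    apply Complex.ext <;> simp [Complex.mul_re, Complex.mul_im, ← Complex.ofReal_pow] <;> ring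
  have hI : 0 ≤ ∫ ω, g ω ∂μ := integral_nonneg fun ω => (Real.exp_pos _).le
  have hpi : 0 ≤ α / Real.pi := by positivity
  rw [h3, Complex.norm_real, Real.norm_of_nonneg (mul_nonneg hpi hI),
    ENNReal.ofReal_le_ofReal_iff (by positivity)] at h2
  have h4 : (∫⁻ ω : ℂ, ENNReal.ofReal (Real.exp (-α * ‖z - ω‖ ^ 2)) ∂μ)
      = ENNReal.ofReal (Real.exp (-α * ‖z‖ ^ 2) * ∫ ω, g ω ∂μ) := by
    rw [ENNReal.ofReal_mul (Real.exp_pos _).le,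
      ofReal_integral_eq_lintegral_ofReal hgi (Eventually.of_forall fun x => (Real.exp_pos _).le),
      ← lintegral_const_mul' _ _ ENNReal.ofReal_ne_top]
    refine lintegral_congr fun ω => ?_
    rw [← ENNReal.ofReal_mul (Real.exp_pos _).le, hg, ← Real.exp_add, aux_norm_sub_sq]
    congr 2
    have : (z * (starRingEnd ℂ) ω).re = ((starRingEnd ℂ) z * ω).re := by
      simp [Complex.mul_re]
    rw [this]; ring
  rw [h4, ← ENNReal.ofReal_mul hpi]
  refine ENNReal.ofReal_le_ofReal ?_
  have h5 := mul_le_mul_of_nonneg_right h2 (Real.exp_pos (-α * ‖z‖ ^ 2 / 2)).le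
  rw [gauss, mul_assoc, mul_assoc C, ← Real.exp_add, ← Real.exp_add] at h5
  have e1 : -α * ‖z‖ ^ 2 / 2 + -α * ‖z‖ ^ 2 / 2 = -α * ‖z‖ ^ 2 := by ring
  have e2 : α * ‖z‖ ^ 2 / 2 + -α * ‖z‖ ^ 2 / 2 = 0 := by ring
  rw [e1, e2, Real.exp_zero] at h5
  linarith

lemma aux_fock_bound (α : ℝ) (f : ℂ → ℂ) (hf : MemFockInf α f) (ω : ℂ) :
    ‖f ω‖ ≤ (fockNormInf α f).toReal * Real.exp (α * ‖ω‖ ^ 2 / 2) := by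
  have h := le_iSup (fun z : ℂ => ENNReal.ofReal (‖f z‖ * gauss α z)) ω
  have h2 := (ENNReal.ofReal_le_iff_le_toReal hf.2).mp h
  have h3 := mul_le_mul_of_nonneg_right h2 (Real.exp_pos (α * ‖ω‖ ^ 2 / 2)).le
  rw [gauss, mul_assoc, ← Real.exp_add] at h3
  have e1 : -α * ‖ω‖ ^ 2 / 2 + α * ‖ω‖ ^ 2 / 2 = 0 := by ring
  rwa [e1, Real.exp_zero, mul_one] at h3

lemma aux_integrable (α : ℝ) (hα : 0 < α) (μ : Measure ℂ) (M : ℝ)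
    (hB : ∀ z : ℂ, berezinM α 1 μ z ≤ ENNReal.ofReal M) (z : ℂ) :
    Integrable (fun ω : ℂ => Real.exp (α * (z * (starRingEnd ℂ) ω).re - α * ‖ω‖ ^ 2 / 2)) μ := by
  have h0 : Integrable (fun ω : ℂ => Real.exp (-(α * 1 / 2) * ‖z - ω‖ ^ 2)) μ := by
    refine ⟨Continuous.aestronglyMeasurable (by fun_prop), ?_⟩
    rw [hasFiniteIntegral_iff_ofReal (Eventually.of_forall fun x => (Real.exp_pos _).le)]
    have h := (hB z).trans_lt ENNReal.ofReal_lt_top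
    rw [berezinM] at h
    exact ENNReal.lt_top_of_mul_ne_top_right h.ne
      (ENNReal.ofReal_pos.mpr (by positivity)).ne'
  refine (h0.const_mul (Real.exp (α * ‖z‖ ^ 2 / 2))).congr (Eventually.of_forall fun ω => ?_)
  simp only
  rw [← Real.exp_add, aux_norm_sub_sq]
  congr 1
  ring

lemma aux_differentiable (α : ℝ) (hα : 0 < α) (μ : Measure ℂ) (M : ℝ)
    (hB : ∀ z : ℂ, berezinM α 1 μ z ≤ ENNReal.ofReal M) (f : ℂ → ℂ) (hf : MemFockInf α f) :
    Differentiable ℂ (toeplitzM α μ f) := by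
  intro z₀
  refine DifferentiableAt.const_mul ?_ _
  set N := (fockNormInf α f).toReal with hN
  have hN0 : 0 ≤ N := ENNReal.toReal_nonneg
  have hfc : Continuous f := hf.1.continuous
  set G : ℂ → ℂ → ℝ := fun z ω =>
    Real.exp (α * (z * (starRingEnd ℂ) ω).re - α * ‖ω‖ ^ 2 / 2) with hG
  have hGi : ∀ z, Integrable (G z) μ := aux_integrable α hα μ M hB
  have hFb : ∀ z ω, ‖f ω * Complex.exp ((α : ℂ) * z * (starRingEnd ℂ) ω -
      ((α * ‖ω‖ ^ 2 : ℝ) : ℂ))‖ ≤ N * G z ω := by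
    intro z ω
    rw [norm_mul, aux_norm_exp]
    refine (mul_le_mul_of_nonneg_right (aux_fock_bound α f hf ω) (Real.exp_pos _).le).trans ?_
    rw [mul_assoc, ← Real.exp_add]
    refine le_of_eq ?_
    rw [hG]
    congr 2
    ring
  refine (hasDerivAt_integral_of_dominated_loc_of_deriv_le (𝕜 := ℂ)
    (F' := fun z ω => f ω * Complex.exp ((α : ℂ) * z * (starRingEnd ℂ) ω -
      ((α * ‖ω‖ ^ 2 : ℝ) : ℂ)) * ((α : ℂ) * (starRingEnd ℂ) ω))
    (bound := fun ω => N * (G (z₀ + ⟨2, 2⟩) ω + G (z₀ + ⟨2, -2⟩) ω + G (z₀ + ⟨-2, 2⟩) ω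
      + G (z₀ + ⟨-2, -2⟩) ω))
    (ball_mem_nhds z₀ one_pos) ?_ ?_ ?_ ?_ ?_ ?_).2.differentiableAt
  · exact Eventually.of_forall fun z => Continuous.aestronglyMeasurable (by fun_prop)
  · exact ((hGi z₀).const_mul N).mono' (Continuous.aestronglyMeasurable (by fun_prop))
      (Eventually.of_forall fun ω => hFb z₀ ω)
  · exact Continuous.aestronglyMeasurable (by fun_prop)
  · refine Eventually.of_forall fun ω z hz => ?_
    rw [norm_mul]
    refine (mul_le_mul_of_nonneg_right (hFb z ω) (norm_nonneg _)).trans ?_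
    rw [mul_assoc]
    refine mul_le_mul_of_nonneg_left ?_ hN0
    have e1 : ‖(α : ℂ) * (starRingEnd ℂ) ω‖ ≤ Real.exp (α * ‖ω‖) := by
      rw [norm_mul, Complex.norm_real, Real.norm_of_nonneg hα.le, Complex.norm_conj]
      linarith [Real.add_one_le_exp (α * ‖ω‖)]
    have e2 : (z * (starRingEnd ℂ) ω).re ≤ (z₀ * (starRingEnd ℂ) ω).re + ‖ω‖ := by
      have a1 : ((z - z₀) * (starRingEnd ℂ) ω).re ≤ ‖(z - z₀) * (starRingEnd ℂ) ω‖ :=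
        Complex.re_le_norm _
      rw [norm_mul, Complex.norm_conj] at a1
      have a2 : ‖z - z₀‖ * ‖ω‖ ≤ 1 * ‖ω‖ :=
        mul_le_mul_of_nonneg_right (mem_ball_iff_norm.mp hz).le (norm_nonneg _)
      rw [sub_mul, Complex.sub_re] at a1
      linarith
    have e3 : G z ω ≤ G z₀ ω * Real.exp (α * ‖ω‖) := by
      simp only [hG]
      rw [← Real.exp_add]
      refine Real.exp_le_exp.mpr ?_
      nlinarith
    calc G z ω * ‖(α : ℂ) * (starRingEnd ℂ) ω‖
        ≤ (G z₀ ω * Real.exp (α * ‖ω‖)) * Real.exp (α * ‖ω‖) :=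
          mul_le_mul e3 e1 (norm_nonneg _) (by positivity)
      _ = G z₀ ω * Real.exp (2 * α * ‖ω‖) := by
          rw [mul_assoc, ← Real.exp_add]; congr 2; ring
      _ ≤ _ := mul_le_mul_of_nonneg_left (aux_four (2 * α) (by positivity) ω) (Real.exp_pos _).le
      _ = _ := by
          simp only [hG, mul_add, ← Real.exp_add]
          congr 1
          · congr 1
            · congr 1
              · congr 1
                simp [Complex.mul_re]; ring
              · congr 1
                simp [Complex.mul_re]; ring
            · congr 1
              simp [Complex.mul_re]; ring
          · congr 1
            simp [Complex.mul_re]; ring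
  · exact ((((hGi _).add (hGi _)).add (hGi _)).add (hGi _)).const_mul N
  · refine Eventually.of_forall fun ω z hz => ?_
    have h1 : HasDerivAt (fun z : ℂ => (α : ℂ) * z * (starRingEnd ℂ) ω -
        ((α * ‖ω‖ ^ 2 : ℝ) : ℂ)) ((α : ℂ) * (starRingEnd ℂ) ω) z := by
      simpa using (((hasDerivAt_id z).const_mul (α : ℂ)).mul_const
        ((starRingEnd ℂ) ω)).sub_const ((α * ‖ω‖ ^ 2 : ℝ) : ℂ)
    have h2 := h1.cexp.const_mul (f ω)
    rw [← mul_assoc] at h2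
    exact h2

lemma aux_norm_bound (α : ℝ) (hα : 0 < α) (μ : Measure ℂ) (M : ℝ)
    (hB : ∀ z : ℂ, berezinM α 1 μ z ≤ ENNReal.ofReal M) (f : ℂ → ℂ) (hf : MemFockInf α f) :
    fockNormInf α (toeplitzM α μ f) ≤ ENNReal.ofReal M * fockNormInf α f := by
  refine iSup_le fun z => ?_
  have hpi : 0 ≤ α / Real.pi := by positivity
  have hN0 : 0 ≤ (fockNormInf α f).toReal := ENNReal.toReal_nonneg
  rw [toeplitzM, norm_mul, Complex.norm_real, Real.norm_of_nonneg hpi, mul_assoc,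
    ENNReal.ofReal_mul hpi]
  refine le_trans ?_ (mul_le_mul_left (hB z) _)
  rw [berezinM, mul_assoc]
  refine mul_le_mul_right ?_ _
  rw [ENNReal.ofReal_mul (norm_nonneg _), ofReal_norm]
  refine (mul_le_mul_left (enorm_integral_le_lintegral_enorm _) _).trans ?_
  rw [← lintegral_mul_const' _ _ ENNReal.ofReal_ne_top, ← lintegral_mul_const' _ _ hf.2]
  refine lintegral_mono fun ω => ?_
  rw [← ENNReal.ofReal_toReal hf.2, ← ofReal_norm, ← ENNReal.ofReal_mul (norm_nonneg _),
    ← ENNReal.ofReal_mul (Real.exp_pos _).le, norm_mul, aux_norm_exp]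
  refine ENNReal.ofReal_le_ofReal ?_
  have h := aux_fock_bound α f hf ω
  rw [mul_assoc, gauss, ← Real.exp_add]
  refine (mul_le_mul_of_nonneg_right h (Real.exp_pos _).le).trans (le_of_eq ?_)
  rw [mul_assoc, ← Real.exp_add, mul_comm, aux_norm_sub_sq]
  congr 2
  ring

/-- `T_μ` is bounded on `F_α^∞` iff the `1`-Berezin transform `μ̃_1` is bounded on `ℂ`. -/
theorem stmt11 (α : ℝ) (hα : 0 < α) (μ : Measure ℂ) (hM : ConditionM α μ) :
    ((∀ f : ℂ → ℂ, MemFockInf α f → MemFockInf α (toeplitzM α μ f)) ∧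
      ∃ C > (0 : ℝ), ∀ f : ℂ → ℂ, MemFockInf α f →
        fockNormInf α (toeplitzM α μ f) ≤ ENNReal.ofReal C * fockNormInf α f) ↔
      ∃ M : ℝ, ∀ z : ℂ, berezinM α 1 μ z ≤ ENNReal.ofReal M := by
  constructor
  · rintro ⟨-, C, hC, hT⟩
    have h2 := aux_forward α hα μ hM C hC hT
    have := aux_sfinite α μ hM
    set K := ∫⁻ m : ℂ, ENNReal.ofReal (Real.exp (-(2 * α) * ‖m‖ ^ 2)) with hK
    set L := ∫⁻ m : ℂ, ENNReal.ofReal (Real.exp (-α * ‖m‖ ^ 2)) with hL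
    have hK0 : K ≠ 0 := aux_gauss_ne_zero (2 * α)
    have hKt : K ≠ ⊤ := (aux_gauss_finite (2 * α) (by positivity)).ne
    have hLt : L ≠ ⊤ := (aux_gauss_finite α hα).ne
    have key : ∀ z, K * berezinM α 1 μ z ≤ L * ENNReal.ofReal C := by
      intro z
      have e1 : K * berezinM α 1 μ z = ENNReal.ofReal (α / Real.pi) *
          ∫⁻ ω, ∫⁻ m : ℂ, ENNReal.ofReal (Real.exp (-α * ‖z - m‖ ^ 2)) *
            ENNReal.ofReal (Real.exp (-α * ‖m - ω‖ ^ 2)) ∂volume ∂μ := by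
        simp_rw [aux_conv]
        rw [lintegral_const_mul' _ _ hKt, berezinM, mul_left_comm]
      have e2 : L = ∫⁻ m : ℂ, ENNReal.ofReal (Real.exp (-α * ‖z - m‖ ^ 2)) :=
        (lintegral_sub_left_eq_self
          (fun m : ℂ => ENNReal.ofReal (Real.exp (-α * ‖m‖ ^ 2))) z).symm
      rw [e1, lintegral_lintegral_swap (by fun_prop), e2,
        ← lintegral_const_mul' _ _ ENNReal.ofReal_ne_top,
        ← lintegral_mul_const' _ _ ENNReal.ofReal_ne_top]
      refine lintegral_mono fun m => ?_
      simp only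
      rw [lintegral_const_mul' _ _ ENNReal.ofReal_ne_top, mul_left_comm]
      exact mul_le_mul_right (h2 m) _
    refine ⟨(L * ENNReal.ofReal C / K).toReal, fun z => ?_⟩
    rw [ENNReal.ofReal_toReal (ENNReal.div_ne_top (ENNReal.mul_ne_top hLt ENNReal.ofReal_ne_top) hK0),
      ENNReal.le_div_iff_mul_le (Or.inl hK0) (Or.inl hKt), mul_comm]
    exact key z
  · rintro ⟨M, hB⟩
    have hB' : ∀ z : ℂ, berezinM α 1 μ z ≤ ENNReal.ofReal (|M| + 1) := fun z =>
      (hB z).trans (ENNReal.ofReal_le_ofReal (by linarith [le_abs_self M]))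
    refine ⟨fun f hf => ⟨aux_differentiable α hα μ _ hB' f hf, ?_⟩, |M| + 1, by positivity,
      fun f hf => aux_norm_bound α hα μ _ hB' f hf⟩
    exact ((aux_norm_bound α hα μ _ hB' f hf).trans_lt
      (ENNReal.mul_lt_top ENNReal.ofReal_lt_top hf.2.lt_top)).ne
end

section
/- Let α > 0 and let μ be a positive Borel measure on ℂ satisfying condition (M). Then the Toeplitz operator T_μ is compact on F_α^∞ if and only if the 1-Berezin transform μ̃_1 vanishes at infinity, i.e. μ̃_1(z) → 0 as |z| → ∞. -/
open MeasureTheory Filter Metric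
open scoped ENNReal Topology

/-- The Gaussian integral of `μ` around `z`. -/
noncomputable def gInt (b : ℝ) (μ : Measure ℂ) (z : ℂ) : ℝ≥0∞ :=
  ∫⁻ ω : ℂ, ENNReal.ofReal (Real.exp (-b * ‖z - ω‖ ^ 2)) ∂μ

lemma normsq_c (z : ℂ) : ‖z‖ ^ 2 = z.re ^ 2 + z.im ^ 2 := by
  rw [Complex.sq_norm, Complex.normSq_apply]; ring

lemma cocompact_cg : (cocompact ℂ).IsCountablyGenerated := by
  rw [← Metric.cobounded_eq_cocompact, ← comap_norm_atTop]
  infer_instance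

lemma four_points (b R : ℝ) (hb : 0 ≤ b) (hR : 0 ≤ R) (ω : ℂ) :
    Real.exp (-b * ‖ω‖ ^ 2 + 2 * b * R * ‖ω‖) ≤ Real.exp (b * (4 * R ^ 2)) *
      (Real.exp (-b * ‖((2 * R : ℝ) : ℂ) - ω‖ ^ 2) + Real.exp (-b * ‖((-(2 * R) : ℝ) : ℂ) - ω‖ ^ 2)
      + Real.exp (-b * ‖((2 * R : ℝ) : ℂ) * Complex.I - ω‖ ^ 2)
      + Real.exp (-b * ‖((-(2 * R) : ℝ) : ℂ) * Complex.I - ω‖ ^ 2)) := by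
  have h1 : ‖ω‖ ≤ |ω.re| + |ω.im| := Complex.norm_le_abs_re_add_abs_im ω
  have hbR : 0 ≤ b * R := mul_nonneg hb hR
  simp only [mul_add, ← Real.exp_add]
  set A := Real.exp (b * (4 * R ^ 2) + -b * ‖((2 * R : ℝ) : ℂ) - ω‖ ^ 2) with hA
  set B := Real.exp (b * (4 * R ^ 2) + -b * ‖((-(2 * R) : ℝ) : ℂ) - ω‖ ^ 2) with hB
  set C := Real.exp (b * (4 * R ^ 2) + -b * ‖((2 * R : ℝ) : ℂ) * Complex.I - ω‖ ^ 2) with hC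
  set D := Real.exp (b * (4 * R ^ 2) + -b * ‖((-(2 * R) : ℝ) : ℂ) * Complex.I - ω‖ ^ 2) with hD
  have pA : 0 < A := Real.exp_pos _
  have pB : 0 < B := Real.exp_pos _
  have pC : 0 < C := Real.exp_pos _
  have pD : 0 < D := Real.exp_pos _
  have key : ∀ t : ℝ, ‖ω‖ ≤ 2 * t →
      Real.exp (-b * ‖ω‖ ^ 2 + 2 * b * R * ‖ω‖) ≤ Real.exp (-b * ‖ω‖ ^ 2 + 4 * (b * R) * t) := by
    intro t ht
    apply Real.exp_le_exp.2
    nlinarith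
  have eA : A = Real.exp (-b * ‖ω‖ ^ 2 + 4 * (b * R) * ω.re) := by
    rw [hA]; congr 1; rw [normsq_c, normsq_c]; simp; ring
  have eB : B = Real.exp (-b * ‖ω‖ ^ 2 + 4 * (b * R) * (-ω.re)) := by
    rw [hB]; congr 1; rw [normsq_c, normsq_c]; simp; ring
  have eC : C = Real.exp (-b * ‖ω‖ ^ 2 + 4 * (b * R) * ω.im) := by
    rw [hC]; congr 1; rw [normsq_c, normsq_c]; simp; ring
  have eD : D = Real.exp (-b * ‖ω‖ ^ 2 + 4 * (b * R) * (-ω.im)) := by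
    rw [hD]; congr 1; rw [normsq_c, normsq_c]; simp; ring
  rcases le_total |ω.re| |ω.im| with h | h
  · rcases abs_cases ω.im with ⟨h2, _⟩ | ⟨h2, _⟩
    · have := key ω.im (by linarith)
      linarith
    · have := key (-ω.im) (by linarith)
      linarith
  · rcases abs_cases ω.re with ⟨h2, _⟩ | ⟨h2, _⟩
    · have := key ω.re (by linarith)
      linarith
    · have := key (-ω.re) (by linarith)
      linarith

lemma big_finite (b R : ℝ) (hb : 0 ≤ b) (hR : 0 ≤ R) (μ : Measure ℂ)
    (h : ∀ z : ℂ, ‖z‖ = 2 * R → gInt b μ z < ⊤) :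
    ∫⁻ ω : ℂ, ENNReal.ofReal (Real.exp (-b * ‖ω‖ ^ 2 + 2 * b * R * ‖ω‖)) ∂μ < ⊤ := by
  have h1 := h ((2 * R : ℝ) : ℂ) (by simp [abs_of_nonneg hR])
  have h2 := h ((-(2 * R) : ℝ) : ℂ) (by simp [abs_of_nonneg hR])
  have h3 := h (((2 * R : ℝ) : ℂ) * Complex.I) (by simp [abs_of_nonneg hR])
  have h4 := h (((-(2 * R) : ℝ) : ℂ) * Complex.I) (by simp [abs_of_nonneg hR])
  have hm : ∀ z : ℂ, Measurable fun ω : ℂ => ENNReal.ofReal (Real.exp (-b * ‖z - ω‖ ^ 2)) := by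
    intro z; fun_prop
  calc _ ≤ ∫⁻ ω : ℂ, ENNReal.ofReal (Real.exp (b * (4 * R ^ 2))) *
      (ENNReal.ofReal (Real.exp (-b * ‖((2 * R : ℝ) : ℂ) - ω‖ ^ 2))
      + ENNReal.ofReal (Real.exp (-b * ‖((-(2 * R) : ℝ) : ℂ) - ω‖ ^ 2))
      + ENNReal.ofReal (Real.exp (-b * ‖((2 * R : ℝ) : ℂ) * Complex.I - ω‖ ^ 2))
      + ENNReal.ofReal (Real.exp (-b * ‖((-(2 * R) : ℝ) : ℂ) * Complex.I - ω‖ ^ 2))) ∂μ := by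
        apply lintegral_mono
        intro ω
        refine (ENNReal.ofReal_le_ofReal (four_points b R hb hR ω)).trans (le_of_eq ?_)
        rw [ENNReal.ofReal_mul (by positivity), ENNReal.ofReal_add (by positivity) (by positivity),
          ENNReal.ofReal_add (by positivity) (by positivity),
          ENNReal.ofReal_add (by positivity) (by positivity)]
    _ = ENNReal.ofReal (Real.exp (b * (4 * R ^ 2))) * (gInt b μ ((2 * R : ℝ) : ℂ) +
          gInt b μ ((-(2 * R) : ℝ) : ℂ) + gInt b μ (((2 * R : ℝ) : ℂ) * Complex.I) +
          gInt b μ (((-(2 * R) : ℝ) : ℂ) * Complex.I)) := by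
        rw [lintegral_const_mul' _ _ ENNReal.ofReal_ne_top, lintegral_add_right _ (hm _),
          lintegral_add_right _ (hm _), lintegral_add_right _ (hm _)]
        rfl
    _ < ⊤ := by
        apply ENNReal.mul_lt_top ENNReal.ofReal_lt_top
        simp only [ENNReal.add_lt_top]
        exact ⟨⟨⟨h1, h2⟩, h3⟩, h4⟩

lemma kernel_le (b R : ℝ) (hb : 0 ≤ b) (z ω : ℂ) (hz : ‖z‖ ≤ R) :
    Real.exp (-b * ‖z - ω‖ ^ 2) ≤ Real.exp (-b * ‖ω‖ ^ 2 + 2 * b * R * ‖ω‖) := by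
  apply Real.exp_le_exp.2
  have h1 : ‖ω‖ - ‖z‖ ≤ ‖z - ω‖ := by
    rw [norm_sub_rev]; exact norm_sub_norm_le _ _
  have h2 : ‖ω‖ ^ 2 - 2 * R * ‖ω‖ ≤ ‖z - ω‖ ^ 2 := by
    by_cases h : 0 ≤ ‖ω‖ - ‖z‖
    · nlinarith [norm_nonneg ω, norm_nonneg z]
    · nlinarith [norm_nonneg ω, norm_nonneg z, sq_nonneg ‖z - ω‖]
  nlinarith

lemma gInt_of_M {α : ℝ} {μ : Measure ℂ} (hM : ConditionM α μ) (z : ℂ) : gInt α μ z < ⊤ := by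
  have : gInt α μ z = ENNReal.ofReal (Real.exp (-α * ‖z‖ ^ 2)) * (∫⁻ ω : ℂ,
    ENNReal.ofReal (Real.exp (2 * α * ((starRingEnd ℂ) z * ω).re - α * ‖ω‖ ^ 2)) ∂μ) := by
    rw [← lintegral_const_mul' _ _ ENNReal.ofReal_ne_top]
    apply lintegral_congr
    intro ω
    rw [← ENNReal.ofReal_mul (by positivity), ← Real.exp_add]
    congr 2
    simp only [normsq_c]; simp; ring
  rw [this]
  exact ENNReal.mul_lt_top ENNReal.ofReal_lt_top (hM z)

lemma sfinite_of_M {α : ℝ} {μ : Measure ℂ} (hM : ConditionM α μ) : SFinite μ := by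
  have hf := gInt_of_M hM 0
  set φ : ℂ → ℝ≥0∞ := fun ω => ENNReal.ofReal (Real.exp (-α * ‖0 - ω‖ ^ 2)) with hφ
  have hm : Measurable φ := by fun_prop
  have : IsFiniteMeasure (μ.withDensity φ) := isFiniteMeasure_withDensity hf.ne
  have hac : μ ≪ μ.withDensity φ := withDensity_absolutelyContinuous' hm.aemeasurable
    (Eventually.of_forall fun ω => by simp [hφ, Real.exp_pos])
  exact sFinite_of_absolutelyContinuous hac

lemma gauss_finite (b : ℝ) (hb : 0 < b) :
    ∫⁻ v : ℂ, ENNReal.ofReal (Real.exp (-b * ‖v‖ ^ 2)) ≠ ⊤ := by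
  have h := GaussianFourier.integrable_cexp_neg_mul_sq_norm_add (V := ℂ) (b := (b : ℂ))
    (by simpa using hb) 0 0
  have h2 := h.norm
  simp only [Complex.norm_exp] at h2
  have h3 : Integrable fun v : ℂ => Real.exp (-b * ‖v‖ ^ 2) := by
    convert h2 using 3 with v
    simp [← Complex.ofReal_pow]
  exact (h3.lintegral_lt_top).ne

lemma gauss_pos (b : ℝ) : ∫⁻ v : ℂ, ENNReal.ofReal (Real.exp (-b * ‖v‖ ^ 2)) ≠ 0 := by
  intro h
  rw [lintegral_eq_zero_iff (by fun_prop)] at h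
  have : ∀ᵐ v : ℂ, False := by
    filter_upwards [h] with v hv
    have := Real.exp_pos (-b * ‖v‖ ^ 2)
    have hv' : ENNReal.ofReal (Real.exp (-b * ‖v‖ ^ 2)) = 0 := hv
    rw [ENNReal.ofReal_eq_zero] at hv'
    linarith
  have h0 : (volume : Measure ℂ) = 0 := by simpa using this
  exact NeZero.ne _ h0

lemma conv_identity (α : ℝ) (μ : Measure ℂ) [SFinite μ] (z : ℂ) :
    ∫⁻ v : ℂ, ENNReal.ofReal (Real.exp (-α * ‖v‖ ^ 2)) * gInt α μ (z - v) =
      (∫⁻ v : ℂ, ENNReal.ofReal (Real.exp (-(2 * α) * ‖v‖ ^ 2))) * gInt (α / 2) μ z := by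
  unfold gInt
  simp_rw [← lintegral_const_mul' _ _ ENNReal.ofReal_ne_top]
  rw [lintegral_lintegral_swap (by
    apply Measurable.aemeasurable
    unfold Function.uncurry
    fun_prop)]
  rw [← lintegral_const_mul _ (by fun_prop)]
  apply lintegral_congr
  intro ω
  rw [← lintegral_mul_const _ (by fun_prop)]
  rw [← lintegral_sub_right_eq_self (μ := volume) (fun v : ℂ =>
    ENNReal.ofReal (Real.exp (-(2 * α) * ‖v‖ ^ 2)) *
      ENNReal.ofReal (Real.exp (-(α / 2) * ‖z - ω‖ ^ 2))) ((z - ω) / 2)]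
  apply lintegral_congr
  intro v
  rw [← ENNReal.ofReal_mul (by positivity), ← ENNReal.ofReal_mul (by positivity),
    ← Real.exp_add, ← Real.exp_add]
  congr 2
  simp only [normsq_c]; simp; ring

lemma gInt_half_tendsto {α : ℝ} (hα : 0 < α) {μ : Measure ℂ} (hM : ConditionM α μ)
    (h : Tendsto (gInt α μ) (cocompact ℂ) (𝓝 0)) :
    Tendsto (gInt (α / 2) μ) (cocompact ℂ) (𝓝 0) := by
  have := sfinite_of_M hM
  have := cocompact_cg
  -- global bound
  obtain ⟨C, hC, hbd⟩ : ∃ C : ℝ≥0∞, C ≠ ⊤ ∧ ∀ z, gInt α μ z ≤ C := by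
    have h1 : ∀ᶠ z in cocompact ℂ, gInt α μ z ≤ 1 := (ENNReal.tendsto_nhds_zero.1 h) 1 (by simp)
    rw [← Metric.cobounded_eq_cocompact, ← comap_norm_atTop, eventually_comap] at h1
    obtain ⟨R, hR⟩ := eventually_atTop.1 h1
    have hbig := big_finite α (max R 0) hα.le (le_max_right _ _) μ (fun z _ => gInt_of_M hM z)
    refine ⟨1 + ∫⁻ ω : ℂ, ENNReal.ofReal
      (Real.exp (-α * ‖ω‖ ^ 2 + 2 * α * (max R 0) * ‖ω‖)) ∂μ,
      ENNReal.add_ne_top.2 ⟨by simp, hbig.ne⟩, fun z => ?_⟩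
    by_cases hz : R ≤ ‖z‖
    · exact (hR _ hz z rfl).trans le_self_add
    · refine le_trans (lintegral_mono fun ω => ENNReal.ofReal_le_ofReal
        (kernel_le α (max R 0) hα.le z ω ((not_le.1 hz).le.trans (le_max_left _ _)))) le_add_self
  have hmeas : Measurable (gInt α μ) := by
    unfold gInt
    apply Measurable.lintegral_prod_right'
      (f := fun p : ℂ × ℂ => ENNReal.ofReal (Real.exp (-α * ‖p.1 - p.2‖ ^ 2)))
    fun_prop
  set c := ∫⁻ v : ℂ, ENNReal.ofReal (Real.exp (-(2 * α) * ‖v‖ ^ 2)) with hc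
  have hc0 : c ≠ 0 := gauss_pos _
  have hct : c ≠ ⊤ := gauss_finite _ (by positivity)
  have hlim : Tendsto (fun z => ∫⁻ v : ℂ,
      ENNReal.ofReal (Real.exp (-α * ‖v‖ ^ 2)) * gInt α μ (z - v)) (cocompact ℂ)
      (𝓝 (∫⁻ v : ℂ, 0)) := by
    refine tendsto_lintegral_filter_of_dominated_convergence
      (fun v : ℂ => ENNReal.ofReal (Real.exp (-α * ‖v‖ ^ 2)) * C) ?_ ?_ ?_ ?_
    · refine Eventually.of_forall fun z => ?_
      have : Measurable fun v : ℂ => gInt α μ (z - v) := hmeas.comp (by fun_prop)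
      fun_prop
    · exact Eventually.of_forall fun z => Eventually.of_forall fun v => by gcongr; exact hbd _
    · rw [lintegral_mul_const _ (by fun_prop)]
      exact ENNReal.mul_ne_top (gauss_finite _ hα) hC
    · refine Eventually.of_forall fun v => ?_
      have h1 : Tendsto (fun z : ℂ => z - v) (cocompact ℂ) (cocompact ℂ) :=
        (Homeomorph.subRight v).isClosedEmbedding.tendsto_cocompact
      have h2 := ENNReal.Tendsto.const_mul (a := ENNReal.ofReal (Real.exp (-α * ‖v‖ ^ 2)))
        (h.comp h1) (Or.inr ENNReal.ofReal_ne_top)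
      simpa using h2
  simp only [lintegral_zero] at hlim
  simp_rw [conv_identity] at hlim
  have h3 := ENNReal.Tendsto.const_mul (a := c⁻¹) hlim (Or.inr (ENNReal.inv_ne_top.2 hc0))
  simp only [← mul_assoc, ← hc, ENNReal.inv_mul_cancel hc0 hct, mul_zero, one_mul] at h3
  exact h3

/-- normalized reproducing kernel -/
noncomputable def nker (α : ℝ) (z ω : ℂ) : ℂ :=
  Complex.exp ((α : ℂ) * ω * (starRingEnd ℂ) z - ((α * ‖z‖ ^ 2 / 2 : ℝ) : ℂ))

lemma norm_nker (α : ℝ) (z ω : ℂ) :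
    ‖nker α z ω‖ = Real.exp (α * (ω.re * z.re + ω.im * z.im) - α * ‖z‖ ^ 2 / 2) := by
  unfold nker
  rw [Complex.norm_exp]
  congr 1
  rw [Complex.sub_re, Complex.ofReal_re]
  simp
  ring

lemma nker_gauss (α : ℝ) (z ω : ℂ) :
    ‖nker α z ω‖ * gauss α ω = Real.exp (-(α / 2) * ‖z - ω‖ ^ 2) := by
  rw [norm_nker, gauss, ← Real.exp_add]
  congr 1
  simp only [normsq_c]; simp; ring

lemma nker_norm {α : ℝ} (hα : 0 < α) (z : ℂ) : fockNormInf α (nker α z) ≤ ENNReal.ofReal 1 := by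
  refine iSup_le fun ω => ENNReal.ofReal_le_ofReal ?_
  rw [nker_gauss, Real.exp_le_one_iff]
  nlinarith [sq_nonneg ‖z - ω‖]

lemma toeplitz_nker {α : ℝ} (hα : 0 < α) {μ : Measure ℂ} (hM : ConditionM α μ) (z : ℂ) :
    ENNReal.ofReal (‖toeplitzM α μ (nker α z) z‖ * gauss α z) =
      ENNReal.ofReal (α / Real.pi) * gInt α μ z := by
  have hint : ∀ ω : ℂ, nker α z ω *
      Complex.exp ((α : ℂ) * z * (starRingEnd ℂ) ω - ((α * ‖ω‖ ^ 2 : ℝ) : ℂ)) =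
      ((Real.exp (α * ‖z‖ ^ 2 / 2) * Real.exp (-α * ‖z - ω‖ ^ 2) : ℝ) : ℂ) := by
    intro ω
    rw [nker, ← Complex.exp_add, ← Real.exp_add, Complex.ofReal_exp]
    congr 1
    simp only [normsq_c]
    apply Complex.ext <;> simp [-Complex.ofReal_pow] <;> ring
  have hI : Integrable (fun ω : ℂ => Real.exp (-α * ‖z - ω‖ ^ 2)) μ := by
    refine ⟨by fun_prop, ?_⟩
    rw [hasFiniteIntegral_iff_ofReal (Eventually.of_forall fun _ => by positivity)]
    exact gInt_of_M hM z
  have hg : gInt α μ z = ENNReal.ofReal (∫ ω, Real.exp (-α * ‖z - ω‖ ^ 2) ∂μ) :=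
    (ofReal_integral_eq_lintegral_ofReal hI (Eventually.of_forall fun _ => by positivity)).symm
  have hpos : 0 ≤ ∫ ω, Real.exp (-α * ‖z - ω‖ ^ 2) ∂μ := integral_nonneg fun _ => by positivity
  rw [hg, ← ENNReal.ofReal_mul (by positivity)]
  congr 1
  unfold toeplitzM
  simp_rw [hint]
  rw [integral_complex_ofReal, ← Complex.ofReal_mul, Complex.norm_real, integral_const_mul,
    Real.norm_of_nonneg (by positivity), gauss]
  have : Real.exp (α * ‖z‖ ^ 2 / 2) * Real.exp (-α * ‖z‖ ^ 2 / 2) = 1 := by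
    rw [← Real.exp_add, ← Real.exp_zero]; congr 1; ring
  linear_combination (α / Real.pi * ∫ ω, Real.exp (-α * ‖z - ω‖ ^ 2) ∂μ) * this

lemma nker_tendsto {α : ℝ} (hα : 0 < α) (z : ℕ → ℂ) (hz : Tendsto z atTop (cocompact ℂ))
    (K : Set ℂ) (hK : IsCompact K) :
    TendstoUniformlyOn (fun n => nker α (z n)) (fun _ => 0) atTop K := by
  obtain ⟨R, hR⟩ := hK.isBounded.exists_norm_le
  have hz' : Tendsto (fun n => ‖z n‖) atTop atTop := tendsto_norm_cocompact_atTop.comp hz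
  have hlim : Tendsto (fun n => Real.exp (α * ‖z n‖ * (R - ‖z n‖ / 2))) atTop (𝓝 0) := by
    apply Real.tendsto_exp_atBot.comp
    apply Tendsto.atTop_mul_atBot₀ (hz'.const_mul_atTop hα)
    apply tendsto_atBot_add_const_left
    exact tendsto_neg_atTop_atBot.comp (hz'.atTop_div_const (by norm_num))
  rw [Metric.tendstoUniformlyOn_iff]
  intro ε hε
  filter_upwards [hlim.eventually (gt_mem_nhds hε)] with n hn ω hω
  rw [dist_zero_left, norm_nker]
  refine lt_of_le_of_lt (Real.exp_le_exp.2 ?_) hn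
  have h1 : ω.re * (z n).re + ω.im * (z n).im ≤ R * ‖z n‖ := by
    have e : ω.re * (z n).re + ω.im * (z n).im = (ω * (starRingEnd ℂ) (z n)).re := by simp
    rw [e]
    refine (Complex.re_le_norm _).trans ?_
    rw [norm_mul, RCLike.norm_conj]
    gcongr
    exact hR ω hω
  nlinarith

lemma toeplitz_le {α : ℝ} (hα : 0 < α) (μ : Measure ℂ) (f : ℂ → ℂ) (z : ℂ) :
    ENNReal.ofReal (‖toeplitzM α μ f z‖ * gauss α z) ≤ ENNReal.ofReal (α / Real.pi) *
      ∫⁻ ω, ENNReal.ofReal (‖f ω‖ * gauss α ω) *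
        ENNReal.ofReal (Real.exp (-(α / 2) * ‖z - ω‖ ^ 2)) ∂μ := by
  unfold toeplitzM
  rw [norm_mul, Complex.norm_real, Real.norm_of_nonneg (by positivity), mul_assoc,
    ENNReal.ofReal_mul (by positivity)]
  gcongr
  rw [ENNReal.ofReal_mul (by positivity), ofReal_norm, mul_comm]
  refine (mul_le_mul_right (enorm_integral_le_lintegral_enorm _) _).trans ?_
  rw [← lintegral_const_mul' _ _ ENNReal.ofReal_ne_top]
  apply lintegral_mono
  intro ω
  apply le_of_eq
  simp only
  rw [← ofReal_norm, ← ENNReal.ofReal_mul (by unfold gauss; positivity),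
    ← ENNReal.ofReal_mul (by unfold gauss; positivity)]
  congr 1
  rw [norm_mul, Complex.norm_exp]
  unfold gauss
  rw [mul_left_comm, ← Real.exp_add, mul_assoc ‖f ω‖, ← Real.exp_add]
  congr 2
  rw [Complex.sub_re, Complex.ofReal_re]
  simp only [normsq_c]; simp; ring

lemma forward_dir {α : ℝ} (hα : 0 < α) {μ : Measure ℂ} (hM : ConditionM α μ)
    (H : ∀ f : ℕ → ℂ → ℂ, (∀ n, MemFockInf α (f n)) →
      (∃ M : ℝ, ∀ n, fockNormInf α (f n) ≤ ENNReal.ofReal M) →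
      (∀ K : Set ℂ, IsCompact K → TendstoUniformlyOn (fun n => f n) (fun _ => 0) atTop K) →
      Tendsto (fun n => fockNormInf α (toeplitzM α μ (f n))) atTop (𝓝 0)) :
    Tendsto (gInt α μ) (cocompact ℂ) (𝓝 0) := by
  have := cocompact_cg
  apply tendsto_of_seq_tendsto
  intro z hz
  have h := H (fun n => nker α (z n))
    (fun n => ⟨by unfold nker; fun_prop,
      ((nker_norm hα (z n)).trans_lt ENNReal.ofReal_lt_top).ne⟩)
    ⟨1, fun n => nker_norm hα (z n)⟩ (nker_tendsto hα z hz)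
  have h2 : Tendsto (fun n => ENNReal.ofReal (α / Real.pi) * gInt α μ (z n)) atTop (𝓝 0) := by
    refine tendsto_of_tendsto_of_tendsto_of_le_of_le tendsto_const_nhds h (fun _ => bot_le)
      fun n => ?_
    rw [← toeplitz_nker hα hM]
    exact le_iSup (fun w => ENNReal.ofReal (‖toeplitzM α μ (nker α (z n)) w‖ * gauss α w)) (z n)
  have hc0 : ENNReal.ofReal (α / Real.pi) ≠ 0 := by
    simp; positivity
  have h3 := ENNReal.Tendsto.const_mul (a := (ENNReal.ofReal (α / Real.pi))⁻¹) h2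
    (Or.inr (ENNReal.inv_ne_top.2 hc0))
  simp only [← mul_assoc, ENNReal.inv_mul_cancel hc0 ENNReal.ofReal_ne_top, mul_zero,
    one_mul] at h3
  exact h3

lemma reverse_dir {α : ℝ} (hα : 0 < α) {μ : Measure ℂ}
    (H : Tendsto (gInt (α / 2) μ) (cocompact ℂ) (𝓝 0))
    (f : ℕ → ℂ → ℂ) (hf : ∀ n, MemFockInf α (f n))
    (M : ℝ) (hfM : ∀ n, fockNormInf α (f n) ≤ ENNReal.ofReal M)
    (hK : ∀ K : Set ℂ, IsCompact K → TendstoUniformlyOn (fun n => f n) (fun _ => 0) atTop K) :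
    Tendsto (fun n => fockNormInf α (toeplitzM α μ (f n))) atTop (𝓝 0) := by
  have hle : ∀ n ω, ENNReal.ofReal (‖f n ω‖ * gauss α ω) ≤ ENNReal.ofReal M := fun n ω =>
    (le_iSup (fun w => ENNReal.ofReal (‖f n w‖ * gauss α w)) ω).trans (hfM n)
  set c := ENNReal.ofReal (α / Real.pi) with hc
  have hct : c ≠ ⊤ := ENNReal.ofReal_ne_top
  rw [ENNReal.tendsto_nhds_zero]
  intro ε hε
  have H2 : Tendsto (fun z => c * (ENNReal.ofReal M * gInt (α / 2) μ z)) (cocompact ℂ) (𝓝 0) := by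
    have := ENNReal.Tendsto.const_mul (a := c) (ENNReal.Tendsto.const_mul
      (a := ENNReal.ofReal M) H (Or.inr ENNReal.ofReal_ne_top)) (Or.inr hct)
    simpa using this
  have h1 := ((ENNReal.tendsto_nhds_zero.1 H2) ε hε).and
    ((ENNReal.tendsto_nhds_zero.1 H) 1 (by simp))
  rw [← Metric.cobounded_eq_cocompact, ← comap_norm_atTop, eventually_comap] at h1
  obtain ⟨R₀, hR₀⟩ := eventually_atTop.1 h1
  set R := max R₀ 0 with hR
  have hR0 : 0 ≤ R := le_max_right _ _
  have hRR : R₀ ≤ R := le_max_left _ _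
  have hbig := big_finite (α / 2) R (by positivity) hR0 μ (fun z hz =>
    ((hR₀ ‖z‖ (by linarith) z rfl).2).trans_lt (by simp))
  have hlim : Tendsto (fun n => ∫⁻ ω, ENNReal.ofReal (‖f n ω‖ * gauss α ω) * ENNReal.ofReal
      (Real.exp (-(α / 2) * ‖ω‖ ^ 2 + 2 * (α / 2) * R * ‖ω‖)) ∂μ) atTop (𝓝 (∫⁻ ω, 0 ∂μ)) := by
    refine tendsto_lintegral_of_dominated_convergence (fun ω => ENNReal.ofReal M * ENNReal.ofReal
      (Real.exp (-(α / 2) * ‖ω‖ ^ 2 + 2 * (α / 2) * R * ‖ω‖))) ?_ ?_ ?_ ?_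
    · intro n
      have := (hf n).1.continuous.measurable
      unfold gauss
      fun_prop
    · exact fun n => Eventually.of_forall fun ω => by
        exact mul_le_mul_left (hle n ω) _
    · rw [lintegral_const_mul' _ _ ENNReal.ofReal_ne_top]
      exact ENNReal.mul_ne_top ENNReal.ofReal_ne_top hbig.ne
    · refine Eventually.of_forall fun ω => ?_
      have h2 : Tendsto (fun n => f n ω) atTop (𝓝 0) :=
        (hK {ω} isCompact_singleton).tendsto_at rfl
      have h3 : Tendsto (fun n => ENNReal.ofReal (‖f n ω‖ * gauss α ω)) atTop (𝓝 0) := by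
        have := ENNReal.tendsto_ofReal (h2.norm.mul_const (gauss α ω))
        simpa using this
      have h4 := ENNReal.Tendsto.mul_const (b := ENNReal.ofReal
        (Real.exp (-(α / 2) * ‖ω‖ ^ 2 + 2 * (α / 2) * R * ‖ω‖))) h3
        (Or.inr ENNReal.ofReal_ne_top)
      simpa using h4
  have hlim2 := ENNReal.Tendsto.const_mul (a := c) hlim (Or.inr hct)
  simp only [lintegral_zero, mul_zero] at hlim2
  filter_upwards [(ENNReal.tendsto_nhds_zero.1 hlim2) ε hε] with n hn
  refine iSup_le fun z => (toeplitz_le hα μ (f n) z).trans ?_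
  by_cases hz : R ≤ ‖z‖
  · refine le_trans ?_ (hR₀ ‖z‖ (hRR.trans hz) z rfl).1
    gcongr
    unfold gInt
    rw [← lintegral_const_mul' _ _ ENNReal.ofReal_ne_top]
    exact lintegral_mono fun ω => mul_le_mul_left (hle n ω) _
  · refine le_trans ?_ hn
    refine mul_le_mul_right (lintegral_mono fun ω => mul_le_mul_right ?_ _) _
    exact ENNReal.ofReal_le_ofReal (kernel_le (α / 2) R (by positivity) z ω (not_le.1 hz).le)

lemma berezin_eq (α : ℝ) (μ : Measure ℂ) (z : ℂ) :
    berezinM α 1 μ z = ENNReal.ofReal (α / Real.pi) * gInt (α / 2) μ z := by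
  unfold berezinM gInt
  rw [mul_one]

/-- `T_μ` is compact on `F_α^∞` iff the `1`-Berezin transform `μ̃_1` vanishes at infinity. -/
theorem stmt13 (α : ℝ) (hα : 0 < α) (μ : Measure ℂ) (hM : ConditionM α μ) :
    (∀ f : ℕ → ℂ → ℂ, (∀ n, MemFockInf α (f n)) →
      (∃ M : ℝ, ∀ n, fockNormInf α (f n) ≤ ENNReal.ofReal M) →
      (∀ K : Set ℂ, IsCompact K → TendstoUniformlyOn (fun n => f n) (fun _ => 0) atTop K) →
      Tendsto (fun n => fockNormInf α (toeplitzM α μ (f n))) atTop (𝓝 0)) ↔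
      Tendsto (fun z => berezinM α 1 μ z) (cocompact ℂ) (𝓝 0) := by
  have hc0 : ENNReal.ofReal (α / Real.pi) ≠ 0 := by
    simp; positivity
  simp_rw [berezin_eq]
  constructor
  · intro H
    have h := ENNReal.Tendsto.const_mul (a := ENNReal.ofReal (α / Real.pi))
      (gInt_half_tendsto hα hM (forward_dir hα hM H)) (Or.inr ENNReal.ofReal_ne_top)
    simpa using h
  · rintro H f hf ⟨M, hfM⟩ hK
    refine reverse_dir hα ?_ f hf M hfM hK
    have h3 := ENNReal.Tendsto.const_mul (a := (ENNReal.ofReal (α / Real.pi))⁻¹) H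
      (Or.inr (ENNReal.inv_ne_top.2 hc0))
    simp only [← mul_assoc, ENNReal.inv_mul_cancel hc0 ENNReal.ofReal_ne_top, mul_zero,
      one_mul] at h3
    exact h3
end

section
/- Let α > 0 and let φ : ℂ → [0,∞) be Lebesgue measurable satisfying condition (I₁). Then the Toeplitz operator T_φ is bounded on F_α^∞ if and only if for every t > 0 the t-Berezin transform φ̃_t is bounded on ℂ. -/
open MeasureTheory Filter Metric
open scoped ENNReal Topology

/-- Condition (I₁) for a real symbol:
`(α/π) ∫ |φ(ω)| e^{2α Re(z̄ω)} e^{-α|ω|²} dA(ω) < ∞` for every `z`. -/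
def CondI1 (α : ℝ) (φ : ℂ → ℝ) : Prop :=
  ∀ z : ℂ, (∫⁻ ω : ℂ,
    ENNReal.ofReal (|φ ω| * Real.exp (2 * α * ((starRingEnd ℂ) z * ω).re - α * ‖ω‖ ^ 2))) < ⊤

/-- The Toeplitz operator with real symbol `φ`:
`T_φ f(z) = (α/π) ∫ φ(ω) f(ω) e^{α z ω̄} e^{-α|ω|²} dA(ω)`. -/
noncomputable def toeplitzF (α : ℝ) (φ : ℂ → ℝ) (f : ℂ → ℂ) (z : ℂ) : ℂ :=
  ((α / Real.pi : ℝ) : ℂ) *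
    ∫ ω : ℂ, (φ ω : ℂ) * f ω *
      Complex.exp ((α : ℂ) * z * (starRingEnd ℂ) ω - ((α * ‖ω‖ ^ 2 : ℝ) : ℂ))

/-- The `t`-Berezin transform of a nonnegative symbol `φ`:
`φ̃_t(z) = (α/π) ∫ φ(ω) e^{-(αt/2)|z-ω|²} dA(ω)` (as an `ℝ≥0∞`). -/
noncomputable def berezinF (α t : ℝ) (φ : ℂ → ℝ) (z : ℂ) : ℝ≥0∞ :=
  ENNReal.ofReal (α / Real.pi) *
    ∫⁻ ω : ℂ, ENNReal.ofReal (φ ω * Real.exp (-(α * t / 2) * ‖z - ω‖ ^ 2))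


lemma st_nsq (z ω : ℂ) : ‖z - ω‖ ^ 2 = ‖z‖ ^ 2 - 2 * ((starRingEnd ℂ) z * ω).re + ‖ω‖ ^ 2 := by
  simp only [Complex.sq_norm, Complex.normSq_apply, Complex.sub_re, Complex.sub_im,
    Complex.mul_re, Complex.conj_re, Complex.conj_im]
  ring

lemma st_re (α : ℝ) (z ω : ℂ) :
    ((α : ℂ) * z * (starRingEnd ℂ) ω - ((α * ‖ω‖ ^ 2 : ℝ) : ℂ)).re
      = α * ((starRingEnd ℂ) z * ω).re - α * ‖ω‖ ^ 2 := by
  rw [Complex.sub_re, Complex.ofReal_re]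
  simp only [Complex.mul_re, Complex.mul_im, Complex.conj_re, Complex.conj_im,
    Complex.ofReal_re, Complex.ofReal_im]
  ring

lemma st_gauss_int (s : ℝ) (hs : 0 < s) :
    Integrable (fun u : ℂ => Real.exp (-s * ‖u‖ ^ 2)) := by
  have := GaussianFourier.integrable_cexp_neg_mul_sq_norm_add (V := ℂ) (b := (s : ℂ))
    (by simpa using hs) 0 0
  refine this.norm.congr (Eventually.of_forall fun u => ?_)
  simp only [Complex.norm_exp]
  congr 1
  have : (-(s : ℂ) * (‖u‖ : ℂ) ^ 2 + 0 * (inner ℝ (0 : ℂ) u : ℂ)) = ((-s * ‖u‖ ^ 2 : ℝ) : ℂ) := by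
    push_cast; ring
  rw [this, Complex.ofReal_re]

/-- From one bounded Gaussian average to all of them. -/
lemma st_all (α : ℝ) (hα : 0 < α) (φ : ℂ → ℝ) (hmeas : Measurable φ)
    (hpos : ∀ ω : ℂ, 0 ≤ φ ω) (C : ℝ)
    (h : ∀ z : ℂ, ∫⁻ ω : ℂ, ENNReal.ofReal (φ ω * Real.exp (-α * ‖z - ω‖ ^ 2)) ≤ ENNReal.ofReal C)
    (s : ℝ) (hs : 0 < s) :
    ∃ M : ℝ≥0∞, M ≠ ⊤ ∧ ∀ z : ℂ,
      ∫⁻ ω : ℂ, ENNReal.ofReal (φ ω * Real.exp (-(2 * s) * ‖z - ω‖ ^ 2)) ≤ M := by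
  set I : ℝ≥0∞ := ∫⁻ u : ℂ, ENNReal.ofReal (Real.exp (-s * ‖u‖ ^ 2)) with hIdef
  have hI : I ≠ ⊤ := (st_gauss_int s hs).lintegral_lt_top.ne
  set V : ℝ≥0∞ := volume (ball (0 : ℂ) 1) with hV
  have hV0 : V ≠ 0 := (measure_ball_pos volume (0 : ℂ) one_pos).ne'
  have hVt : V ≠ ⊤ := measure_ball_lt_top.ne
  set κ : ℝ≥0∞ := ENNReal.ofReal (Real.exp (-(2 * s) - α)) with hκ
  have hκ0 : κ ≠ 0 := by
    rw [hκ]; simp [Real.exp_pos]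
  have hκt : κ ≠ ⊤ := ENNReal.ofReal_ne_top
  have hc0 : κ * V ≠ 0 := mul_ne_zero hκ0 hV0
  have hct : κ * V ≠ ⊤ := ENNReal.mul_ne_top hκt hVt
  refine ⟨(κ * V)⁻¹ * (ENNReal.ofReal C * I), ?_, fun z => ?_⟩
  · exact ENNReal.mul_ne_top (ENNReal.inv_ne_top.2 hc0) (ENNReal.mul_ne_top ENNReal.ofReal_ne_top hI)
  -- pointwise lower bound
  have key : ∀ ω : ℂ, (κ * V) * ENNReal.ofReal (φ ω * Real.exp (-(2 * s) * ‖z - ω‖ ^ 2))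
      ≤ ∫⁻ u : ℂ, ENNReal.ofReal (Real.exp (-s * ‖z - u‖ ^ 2)) *
        ENNReal.ofReal (φ ω * Real.exp (-α * ‖u - ω‖ ^ 2)) := by
    intro ω
    have hb : volume (ball ω 1) = V := by
      rw [hV]; exact Measure.addHaar_ball_center volume ω 1
    calc (κ * V) * ENNReal.ofReal (φ ω * Real.exp (-(2 * s) * ‖z - ω‖ ^ 2))
        = ∫⁻ u in ball ω 1, κ * ENNReal.ofReal (φ ω * Real.exp (-(2 * s) * ‖z - ω‖ ^ 2)) := by
          rw [setLIntegral_const, hb]; ring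
      _ ≤ ∫⁻ u in ball ω 1, ENNReal.ofReal (Real.exp (-s * ‖z - u‖ ^ 2)) *
        ENNReal.ofReal (φ ω * Real.exp (-α * ‖u - ω‖ ^ 2)) := by
          refine setLIntegral_mono' measurableSet_ball fun u hu => ?_
          rw [mem_ball, dist_eq_norm] at hu
          rw [hκ, ← ENNReal.ofReal_mul (Real.exp_pos _).le, ← ENNReal.ofReal_mul (Real.exp_pos _).le]
          apply ENNReal.ofReal_le_ofReal
          rw [mul_left_comm, mul_left_comm (Real.exp (-s * _)), ← Real.exp_add, ← Real.exp_add]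
          refine mul_le_mul_of_nonneg_left (Real.exp_le_exp.2 ?_) (hpos ω)
          have h1 : ‖z - u‖ ≤ ‖z - ω‖ + ‖u - ω‖ := by
            have := norm_sub_le (z - ω) (u - ω)
            simpa using this
          have h0 := norm_nonneg (z - u)
          have h2 := norm_nonneg (u - ω)
          have h3 : ‖u - ω‖ ^ 2 ≤ 1 := by nlinarith
          have h4 : ‖z - u‖ ^ 2 ≤ 2 * ‖z - ω‖ ^ 2 + 2 := by
            nlinarith [sq_nonneg (‖z - ω‖ - ‖u - ω‖)]
          nlinarith
      _ ≤ _ := setLIntegral_le_lintegral _ _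
  have hm : Measurable (fun p : ℂ × ℂ => ENNReal.ofReal (Real.exp (-s * ‖z - p.2‖ ^ 2)) *
        ENNReal.ofReal (φ p.1 * Real.exp (-α * ‖p.2 - p.1‖ ^ 2))) := by
    fun_prop
  have hfin : (κ * V) * ∫⁻ ω : ℂ, ENNReal.ofReal (φ ω * Real.exp (-(2 * s) * ‖z - ω‖ ^ 2))
      ≤ ENNReal.ofReal C * I := by
    rw [← lintegral_const_mul _ (by fun_prop)]
    calc _ ≤ ∫⁻ ω : ℂ, ∫⁻ u : ℂ, ENNReal.ofReal (Real.exp (-s * ‖z - u‖ ^ 2)) *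
        ENNReal.ofReal (φ ω * Real.exp (-α * ‖u - ω‖ ^ 2)) := lintegral_mono key
      _ = ∫⁻ u : ℂ, ∫⁻ ω : ℂ, ENNReal.ofReal (Real.exp (-s * ‖z - u‖ ^ 2)) *
        ENNReal.ofReal (φ ω * Real.exp (-α * ‖u - ω‖ ^ 2)) :=
          lintegral_lintegral_swap hm.aemeasurable
      _ ≤ ∫⁻ u : ℂ, ENNReal.ofReal C * ENNReal.ofReal (Real.exp (-s * ‖z - u‖ ^ 2)) := by
          refine lintegral_mono fun u => ?_
          rw [lintegral_const_mul _ (by fun_prop), mul_comm]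
          gcongr
          exact h u
      _ = ENNReal.ofReal C * I := by
          rw [lintegral_const_mul _ (by fun_prop), hIdef]
          congr 1
          exact lintegral_sub_left_eq_self (fun u : ℂ => ENNReal.ofReal (Real.exp (-s * ‖u‖ ^ 2))) z
  calc _ = (κ * V)⁻¹ * ((κ * V) * ∫⁻ ω : ℂ, ENNReal.ofReal (φ ω * Real.exp (-(2 * s) * ‖z - ω‖ ^ 2))) := by
        rw [← mul_assoc, ENNReal.inv_mul_cancel hc0 hct, one_mul]
    _ ≤ _ := by gcongr

lemma st_norm_bound (α N : ℝ) (f : ℂ → ℂ) (hN : ∀ ω, ‖f ω‖ * gauss α ω ≤ N) (ω : ℂ) :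
    ‖f ω‖ ≤ N * Real.exp (α * ‖ω‖ ^ 2 / 2) := by
  have h := mul_le_mul_of_nonneg_right (hN ω) (Real.exp_pos (α * ‖ω‖ ^ 2 / 2)).le
  rw [gauss, mul_assoc, ← Real.exp_add] at h
  have : -α * ‖ω‖ ^ 2 / 2 + α * ‖ω‖ ^ 2 / 2 = 0 := by ring
  rwa [this, Real.exp_zero, mul_one] at h

lemma st_integrand (α N : ℝ) (φ : ℂ → ℝ) (hpos : ∀ ω : ℂ, 0 ≤ φ ω)
    (f : ℂ → ℂ) (hN : ∀ ω, ‖f ω‖ * gauss α ω ≤ N) (z ω : ℂ) :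
    ‖(φ ω : ℂ) * f ω * Complex.exp ((α : ℂ) * z * (starRingEnd ℂ) ω - ((α * ‖ω‖ ^ 2 : ℝ) : ℂ))‖
      ≤ N * (φ ω * Real.exp (α * ((starRingEnd ℂ) z * ω).re - α * ‖ω‖ ^ 2 / 2)) := by
  rw [norm_mul, norm_mul, Complex.norm_exp, st_re, Complex.norm_real, Real.norm_of_nonneg (hpos ω)]
  calc _ ≤ φ ω * (N * Real.exp (α * ‖ω‖ ^ 2 / 2)) *
        Real.exp (α * ((starRingEnd ℂ) z * ω).re - α * ‖ω‖ ^ 2) := by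
        gcongr
        · exact hpos ω
        · exact st_norm_bound α N f hN ω
    _ = N * (φ ω * (Real.exp (α * ‖ω‖ ^ 2 / 2) *
        Real.exp (α * ((starRingEnd ℂ) z * ω).re - α * ‖ω‖ ^ 2))) := by ring
    _ = _ := by
        rw [← Real.exp_add]
        congr 3
        ring

lemma st_toeplitz_bound (α : ℝ) (hα : 0 < α) (N : ℝ) (hN0 : 0 ≤ N) (φ : ℂ → ℝ)
    (hmeas : Measurable φ) (hpos : ∀ ω : ℂ, 0 ≤ φ ω)
    (f : ℂ → ℂ) (hN : ∀ ω, ‖f ω‖ * gauss α ω ≤ N) (z : ℂ) :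
    ENNReal.ofReal (‖toeplitzF α φ f z‖ * gauss α z) ≤ ENNReal.ofReal N * berezinF α 1 φ z := by
  have hπ : 0 ≤ α / Real.pi := (div_pos hα Real.pi_pos).le
  have hg : 0 ≤ gauss α z := (Real.exp_pos _).le
  rw [toeplitzF, norm_mul, Complex.norm_real, Real.norm_of_nonneg hπ, mul_assoc,
    ENNReal.ofReal_mul hπ, berezinF, mul_left_comm (ENNReal.ofReal N)]
  gcongr
  rw [ENNReal.ofReal_mul (norm_nonneg _), ofReal_norm, mul_comm]
  calc _ ≤ ENNReal.ofReal (gauss α z) * ∫⁻ ω : ℂ, ‖(φ ω : ℂ) * f ω * Complex.exp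
          ((α : ℂ) * z * (starRingEnd ℂ) ω - ((α * ‖ω‖ ^ 2 : ℝ) : ℂ))‖ₑ := by
        gcongr
        exact enorm_integral_le_lintegral_enorm _
    _ = ∫⁻ ω : ℂ, ENNReal.ofReal (gauss α z) * ‖(φ ω : ℂ) * f ω * Complex.exp
          ((α : ℂ) * z * (starRingEnd ℂ) ω - ((α * ‖ω‖ ^ 2 : ℝ) : ℂ))‖ₑ :=
        (lintegral_const_mul' _ _ ENNReal.ofReal_ne_top).symm
    _ ≤ ∫⁻ ω : ℂ, ENNReal.ofReal N *
          ENNReal.ofReal (φ ω * Real.exp (-(α * 1 / 2) * ‖z - ω‖ ^ 2)) := by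
        refine lintegral_mono fun ω => ?_
        rw [← ofReal_norm, ← ENNReal.ofReal_mul hg, ← ENNReal.ofReal_mul hN0]
        apply ENNReal.ofReal_le_ofReal
        calc _ ≤ gauss α z * _ := mul_le_mul_of_nonneg_left (st_integrand α N φ hpos f hN z ω) hg
          _ = N * (φ ω * (gauss α z *
              Real.exp (α * ((starRingEnd ℂ) z * ω).re - α * ‖ω‖ ^ 2 / 2))) := by ring
          _ = _ := by
            rw [gauss, ← Real.exp_add, st_nsq]
            congr 3
            ring
    _ = _ := lintegral_const_mul' _ _ ENNReal.ofReal_ne_top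

lemma st_diff (α : ℝ) (hα : 0 < α) (N : ℝ) (hN0 : 0 ≤ N) (φ : ℂ → ℝ)
    (hmeas : Measurable φ) (hpos : ∀ ω : ℂ, 0 ≤ φ ω)
    (hint : Integrable (fun ω : ℂ => φ ω * Real.exp (-(α / 4) * ‖ω‖ ^ 2)))
    (f : ℂ → ℂ) (hf : Continuous f) (hN : ∀ ω, ‖f ω‖ * gauss α ω ≤ N) :
    Differentiable ℂ (toeplitzF α φ f) := by
  intro z₀
  have hfm : Measurable f := hf.measurable
  set R : ℝ := ‖z₀‖ + 1 with hR
  have hre : ∀ z ∈ ball z₀ 1, ∀ ω : ℂ, ((starRingEnd ℂ) z * ω).re ≤ R * ‖ω‖ := by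
    intro z hz ω
    calc _ ≤ ‖(starRingEnd ℂ) z * ω‖ := Complex.re_le_norm _
      _ = ‖z‖ * ‖ω‖ := by rw [norm_mul, RCLike.norm_conj]
      _ ≤ _ := by
        gcongr
        rw [mem_ball, dist_eq_norm] at hz
        have := norm_le_norm_add_norm_sub' z z₀
        linarith
  set K : ℝ := (α * R + 1) ^ 2 / α with hK
  have hquad : ∀ x : ℝ, (α * R + 1) * x - α * x ^ 2 / 2 ≤ K + -(α / 4) * x ^ 2 := by
    intro x
    have : K + -(α / 4) * x ^ 2 - ((α * R + 1) * x - α * x ^ 2 / 2)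
        = ((α * R + 1) - α / 2 * x) ^ 2 / α := by
      rw [hK]; field_simp; ring
    have h2 : 0 ≤ ((α * R + 1) - α / 2 * x) ^ 2 / α := by positivity
    linarith
  -- main bound
  have hbd : ∀ z ∈ ball z₀ 1, ∀ ω : ℂ,
      (1 + ‖ω‖) * ‖(φ ω : ℂ) * f ω *
        Complex.exp ((α : ℂ) * z * (starRingEnd ℂ) ω - ((α * ‖ω‖ ^ 2 : ℝ) : ℂ))‖
      ≤ N * Real.exp K * (φ ω * Real.exp (-(α / 4) * ‖ω‖ ^ 2)) := by
    intro z hz ω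
    have h1 := st_integrand α N φ hpos f hN z ω
    have h2 : 1 + ‖ω‖ ≤ Real.exp ‖ω‖ := by
      have := Real.add_one_le_exp ‖ω‖
      linarith
    have h3 : Real.exp ‖ω‖ * Real.exp (α * ((starRingEnd ℂ) z * ω).re - α * ‖ω‖ ^ 2 / 2)
        ≤ Real.exp K * Real.exp (-(α / 4) * ‖ω‖ ^ 2) := by
      rw [← Real.exp_add, ← Real.exp_add]
      apply Real.exp_le_exp.2
      have := hquad ‖ω‖
      have h4 := mul_le_mul_of_nonneg_left (hre z hz ω) hα.le
      linarith
    calc _ ≤ Real.exp ‖ω‖ *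
          (N * (φ ω * Real.exp (α * ((starRingEnd ℂ) z * ω).re - α * ‖ω‖ ^ 2 / 2))) := by
          gcongr
      _ = N * φ ω * (Real.exp ‖ω‖ *
            Real.exp (α * ((starRingEnd ℂ) z * ω).re - α * ‖ω‖ ^ 2 / 2)) := by ring
      _ ≤ N * φ ω * (Real.exp K * Real.exp (-(α / 4) * ‖ω‖ ^ 2)) :=
          mul_le_mul_of_nonneg_left h3 (mul_nonneg hN0 (hpos ω))
      _ = _ := by ring
  have hbint := hint.const_mul (N * Real.exp K)
  have hmF : ∀ z : ℂ, AEStronglyMeasurable (fun ω : ℂ => (φ ω : ℂ) * f ω *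
        Complex.exp ((α : ℂ) * z * (starRingEnd ℂ) ω - ((α * ‖ω‖ ^ 2 : ℝ) : ℂ))) volume := by
    intro z
    have : Measurable (fun ω : ℂ => (starRingEnd ℂ) ω) := Complex.continuous_conj.measurable
    exact Measurable.aestronglyMeasurable (by fun_prop)
  have hder := hasDerivAt_integral_of_dominated_loc_of_deriv_le (𝕜 := ℂ) (μ := (volume : Measure ℂ))
    (F := fun z ω => (φ ω : ℂ) * f ω *
        Complex.exp ((α : ℂ) * z * (starRingEnd ℂ) ω - ((α * ‖ω‖ ^ 2 : ℝ) : ℂ)))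
    (F' := fun z ω => ((α : ℂ) * (starRingEnd ℂ) ω) * ((φ ω : ℂ) * f ω *
        Complex.exp ((α : ℂ) * z * (starRingEnd ℂ) ω - ((α * ‖ω‖ ^ 2 : ℝ) : ℂ))))
    (x₀ := z₀) (s := ball z₀ 1)
    (bound := fun ω => α * (N * Real.exp K * (φ ω * Real.exp (-(α / 4) * ‖ω‖ ^ 2))))
    (ball_mem_nhds z₀ one_pos) (Eventually.of_forall hmF)
    (by
      refine hbint.mono' (hmF z₀) (Eventually.of_forall fun ω => ?_)
      refine le_trans ?_ (hbd z₀ (mem_ball_self one_pos) ω)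
      exact le_mul_of_one_le_left (norm_nonneg _) (by linarith [norm_nonneg ω]))
    (by
      have : Measurable (fun ω : ℂ => (starRingEnd ℂ) ω) := Complex.continuous_conj.measurable
      exact Measurable.aestronglyMeasurable (by fun_prop))
    (by
      refine Eventually.of_forall fun ω z hz => ?_
      rw [norm_mul, norm_mul, Complex.norm_real, Real.norm_of_nonneg hα.le, RCLike.norm_conj,
        mul_assoc]
      refine mul_le_mul_of_nonneg_left (le_trans ?_ (hbd z hz ω)) hα.le
      gcongr
      linarith)
    (hbint.const_mul α)
    (by
      refine Eventually.of_forall fun ω z hz => ?_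
      have h1 : HasDerivAt (fun z : ℂ => (α : ℂ) * z * (starRingEnd ℂ) ω
          - ((α * ‖ω‖ ^ 2 : ℝ) : ℂ)) ((α : ℂ) * 1 * (starRingEnd ℂ) ω) z :=
        (((hasDerivAt_id z).const_mul (α : ℂ)).mul_const _).sub_const _
      have h2 := h1.cexp.const_mul ((φ ω : ℂ) * f ω)
      refine h2.congr_deriv ?_
      ring)
  exact (hder.2.const_mul _).differentiableAt

lemma st_norm_le (α : ℝ) (f : ℂ → ℂ) (h : fockNormInf α f ≠ ⊤) (ω : ℂ) :
    ‖f ω‖ * gauss α ω ≤ (fockNormInf α f).toReal := by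
  have h1 : ENNReal.ofReal (‖f ω‖ * gauss α ω) ≤ fockNormInf α f :=
    le_iSup (fun z : ℂ => ENNReal.ofReal (‖f z‖ * gauss α z)) ω
  exact (ENNReal.ofReal_le_iff_le_toReal h).1 h1

lemma st_test_norm (α : ℝ) (hα : 0 < α) (z : ℂ) :
    fockNormInf α (fun ω => Complex.exp ((α : ℂ) * (starRingEnd ℂ) z * ω))
      ≤ ENNReal.ofReal (Real.exp (α * ‖z‖ ^ 2 / 2)) := by
  refine iSup_le fun ω => ENNReal.ofReal_le_ofReal ?_
  rw [Complex.norm_exp, gauss, ← Real.exp_add]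
  apply Real.exp_le_exp.2
  have h1 : ((α : ℂ) * (starRingEnd ℂ) z * ω).re = α * ((starRingEnd ℂ) z * ω).re := by
    rw [mul_assoc, Complex.re_ofReal_mul]
  have h2 := st_nsq z ω
  have h3 : 0 ≤ α * ‖z - ω‖ ^ 2 := by positivity
  rw [h2] at h3
  rw [h1]
  linarith

lemma st_test_value (α : ℝ) (hα : 0 < α) (φ : ℂ → ℝ) (hmeas : Measurable φ)
    (hpos : ∀ ω : ℂ, 0 ≤ φ ω) (hI : CondI1 α φ) (z : ℂ) :
    ENNReal.ofReal (‖toeplitzF α φ (fun ω => Complex.exp ((α : ℂ) * (starRingEnd ℂ) z * ω)) z‖)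
      = ENNReal.ofReal (α / Real.pi) * (ENNReal.ofReal (Real.exp (α * ‖z‖ ^ 2)) *
        ∫⁻ ω : ℂ, ENNReal.ofReal (φ ω * Real.exp (-α * ‖z - ω‖ ^ 2))) := by
  have hπ : 0 ≤ α / Real.pi := (div_pos hα Real.pi_pos).le
  have e1 : ∀ ω : ℂ, (φ ω : ℂ) * Complex.exp ((α : ℂ) * (starRingEnd ℂ) z * ω) *
      Complex.exp ((α : ℂ) * z * (starRingEnd ℂ) ω - ((α * ‖ω‖ ^ 2 : ℝ) : ℂ))
      = ((φ ω * Real.exp (2 * α * ((starRingEnd ℂ) z * ω).re - α * ‖ω‖ ^ 2) : ℝ) : ℂ) := by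
    intro ω
    rw [mul_assoc, ← Complex.exp_add, Complex.ofReal_mul (φ ω), Complex.ofReal_exp]
    congr 2
    have : (starRingEnd ℂ) z * ω + z * (starRingEnd ℂ) ω
        = ((2 * ((starRingEnd ℂ) z * ω).re : ℝ) : ℂ) := by
      rw [← Complex.add_conj]; simp
    rw [Complex.ofReal_sub]
    have h2 : ((2 * α * ((starRingEnd ℂ) z * ω).re : ℝ) : ℂ)
        = α * ((2 * ((starRingEnd ℂ) z * ω).re : ℝ) : ℂ) := by push_cast; ring
    rw [h2, ← this]
    ring
  have hnn : ∀ ω : ℂ, 0 ≤ φ ω * Real.exp (2 * α * ((starRingEnd ℂ) z * ω).re - α * ‖ω‖ ^ 2) :=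
    fun ω => mul_nonneg (hpos ω) (Real.exp_pos _).le
  have hm : Measurable fun ω : ℂ =>
      φ ω * Real.exp (2 * α * ((starRingEnd ℂ) z * ω).re - α * ‖ω‖ ^ 2) := by fun_prop
  have hint : Integrable fun ω : ℂ =>
      φ ω * Real.exp (2 * α * ((starRingEnd ℂ) z * ω).re - α * ‖ω‖ ^ 2) := by
    refine ⟨hm.aestronglyMeasurable, ?_⟩
    rw [hasFiniteIntegral_iff_ofReal (Eventually.of_forall hnn)]
    have := hI z
    simpa only [abs_of_nonneg (hpos _)] using this
  rw [toeplitzF]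
  simp only [e1]
  rw [integral_complex_ofReal, norm_mul, Complex.norm_real, Complex.norm_real,
    Real.norm_of_nonneg hπ, Real.norm_of_nonneg (integral_nonneg hnn), ENNReal.ofReal_mul hπ,
    ofReal_integral_eq_lintegral_ofReal hint (Eventually.of_forall hnn)]
  congr 1
  rw [← lintegral_const_mul' _ _ ENNReal.ofReal_ne_top]
  refine lintegral_congr fun ω => ?_
  rw [← ENNReal.ofReal_mul (Real.exp_pos _).le, mul_left_comm, ← Real.exp_add, st_nsq]
  congr 3
  ring

/-- For measurable `φ ≥ 0` satisfying condition (I₁), the Toeplitz operator `T_φ` is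
bounded on `F_α^∞` iff for every `t > 0` the `t`-Berezin transform `φ̃_t` is bounded on `ℂ`. -/
theorem stmt14 (α : ℝ) (hα : 0 < α) (φ : ℂ → ℝ) (hmeas : Measurable φ)
    (hpos : ∀ ω : ℂ, 0 ≤ φ ω) (hI : CondI1 α φ) :
    ((∀ f : ℂ → ℂ, MemFockInf α f → MemFockInf α (toeplitzF α φ f)) ∧
      ∃ C > (0 : ℝ), ∀ f : ℂ → ℂ, MemFockInf α f →
        fockNormInf α (toeplitzF α φ f) ≤ ENNReal.ofReal C * fockNormInf α f) ↔
      ∀ t : ℝ, 0 < t → ∃ M : ℝ, ∀ z : ℂ, berezinF α t φ z ≤ ENNReal.ofReal M := by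
  have hπ : 0 < α / Real.pi := div_pos hα Real.pi_pos
  have hπ0 : ENNReal.ofReal (α / Real.pi) ≠ 0 := by simpa using hπ
  constructor
  · rintro ⟨-, C, hC, hb⟩ t ht
    have h2 : ∀ z : ℂ, ∫⁻ ω : ℂ, ENNReal.ofReal (φ ω * Real.exp (-α * ‖z - ω‖ ^ 2))
        ≤ ENNReal.ofReal ((α / Real.pi)⁻¹ * C) := by
      intro z
      have hn := st_test_norm α hα z
      have hmem : MemFockInf α (fun ω => Complex.exp ((α : ℂ) * (starRingEnd ℂ) z * ω)) :=
        ⟨by fun_prop, ne_top_of_le_ne_top ENNReal.ofReal_ne_top hn⟩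
      have h3 := (le_iSup (fun w : ℂ => ENNReal.ofReal (‖toeplitzF α φ
        (fun ω => Complex.exp ((α : ℂ) * (starRingEnd ℂ) z * ω)) w‖ * gauss α w)) z).trans
        ((hb _ hmem).trans (mul_le_mul_right hn _))
      rw [ENNReal.ofReal_mul (norm_nonneg _), st_test_value α hα φ hmeas hpos hI z] at h3
      set J := ∫⁻ ω : ℂ, ENNReal.ofReal (φ ω * Real.exp (-α * ‖z - ω‖ ^ 2)) with hJ
      have e : ENNReal.ofReal (Real.exp (α * ‖z‖ ^ 2)) * ENNReal.ofReal (gauss α z)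
          = ENNReal.ofReal (Real.exp (α * ‖z‖ ^ 2 / 2)) := by
        rw [← ENNReal.ofReal_mul (Real.exp_pos _).le, gauss, ← Real.exp_add]
        congr 2; ring
      have h4 : (ENNReal.ofReal (α / Real.pi) * J) * ENNReal.ofReal (Real.exp (α * ‖z‖ ^ 2 / 2))
          ≤ ENNReal.ofReal C * ENNReal.ofReal (Real.exp (α * ‖z‖ ^ 2 / 2)) := by
        refine le_trans (le_of_eq ?_) h3
        rw [← e]; ring
      have h5 : ENNReal.ofReal (α / Real.pi) * J ≤ ENNReal.ofReal C :=
        (ENNReal.mul_le_mul_iff_left (by simp [Real.exp_pos]) ENNReal.ofReal_ne_top).1 h4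
      rw [ENNReal.ofReal_mul (inv_pos.2 hπ).le, ENNReal.ofReal_inv_of_pos hπ]
      calc J = (ENNReal.ofReal (α / Real.pi))⁻¹ * (ENNReal.ofReal (α / Real.pi) * J) := by
            rw [← mul_assoc, ENNReal.inv_mul_cancel hπ0 ENNReal.ofReal_ne_top, one_mul]
        _ ≤ _ := by gcongr
    obtain ⟨M, hM, hMb⟩ := st_all α hα φ hmeas hpos _ h2 (α * t / 4) (by positivity)
    refine ⟨(ENNReal.ofReal (α / Real.pi) * M).toReal, fun z => ?_⟩
    rw [ENNReal.ofReal_toReal (ENNReal.mul_ne_top ENNReal.ofReal_ne_top hM), berezinF]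
    gcongr
    have := hMb z
    rwa [show 2 * (α * t / 4) = α * t / 2 by ring] at this
  · intro h
    obtain ⟨M, hM⟩ := h 1 one_pos
    obtain ⟨M', hM'⟩ := h (1 / 2) (by norm_num)
    have hint : Integrable (fun ω : ℂ => φ ω * Real.exp (-(α / 4) * ‖ω‖ ^ 2)) := by
      refine ⟨Measurable.aestronglyMeasurable (by fun_prop), ?_⟩
      rw [hasFiniteIntegral_iff_ofReal
        (Eventually.of_forall fun ω => mul_nonneg (hpos ω) (Real.exp_pos _).le)]
      have h0 := (hM' 0).trans_lt ENNReal.ofReal_lt_top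
      rw [berezinF] at h0
      have h1 := ENNReal.lt_top_of_mul_ne_top_right h0.ne hπ0
      refine lt_of_eq_of_lt (lintegral_congr fun ω => ?_) h1
      rw [zero_sub, norm_neg]
      congr 3
      ring
    have hbound : ∀ f : ℂ → ℂ, MemFockInf α f →
        fockNormInf α (toeplitzF α φ f) ≤ ENNReal.ofReal (max M 1) * fockNormInf α f := by
      intro f hf
      refine iSup_le fun z => ?_
      refine (st_toeplitz_bound α hα _ ENNReal.toReal_nonneg φ hmeas hpos f
        (st_norm_le α f hf.2) z).trans ?_
      rw [ENNReal.ofReal_toReal hf.2, mul_comm]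
      gcongr
      exact (hM z).trans (ENNReal.ofReal_le_ofReal (le_max_left _ _))
    refine ⟨fun f hf => ⟨?_, ?_⟩, max M 1, by positivity, hbound⟩
    · exact st_diff α hα _ ENNReal.toReal_nonneg φ hmeas hpos hint f hf.1.continuous
        (st_norm_le α f hf.2)
    · exact ne_top_of_le_ne_top (ENNReal.mul_ne_top ENNReal.ofReal_ne_top hf.2) (hbound f hf)
end

section
/- Let α > 0 and let φ : ℂ → [0,∞) be Lebesgue measurable satisfying condition (I₁). Then the Toeplitz operator T_φ is compact on F_α^∞ if and only if for every t > 0 the t-Berezin transform φ̃_t vanishes at infinity, i.e. φ̃_t(z) → 0 as |z| → ∞. -/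
open MeasureTheory Filter Metric
open scoped ENNReal Topology

namespace ToepAux

/-- Gaussian as an extended nonnegative real. -/
noncomputable def G (s : ℝ) (z : ℂ) : ℝ≥0∞ := ENNReal.ofReal (Real.exp (-s * ‖z‖ ^ 2))

/-- Local averages over unit balls. -/
noncomputable def Avg (Φ : ℂ → ℝ≥0∞) (u : ℂ) : ℝ≥0∞ := ∫⁻ ω in ball u 1, Φ ω

lemma G_meas (s : ℝ) : Measurable (G s) := by
  unfold G; fun_prop

lemma G_lintegral (s : ℝ) (hs : 0 < s) : ∫⁻ z, G s z ≠ ⊤ := by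
  have h := GaussianFourier.integrable_cexp_neg_mul_sq_norm_add (V := ℂ) (b := (s : ℂ))
    (by simpa using hs) 0 0
  have h2 := h.norm.lintegral_lt_top
  refine ne_of_lt (lt_of_le_of_lt (le_of_eq ?_) h2)
  refine lintegral_congr fun z => ?_
  unfold G
  congr 1
  rw [Complex.norm_exp]
  congr 1
  simp [← Complex.ofReal_pow]

lemma V_ne_zero : volume (ball (0 : ℂ) 1) ≠ 0 := (measure_ball_pos _ _ one_pos).ne'

lemma V_ne_top : volume (ball (0 : ℂ) 1) ≠ ⊤ := measure_ball_lt_top.ne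

lemma le_inv_mul_V {a b : ℝ≥0∞} (h : volume (ball (0 : ℂ) 1) * a ≤ b) :
    a ≤ (volume (ball (0 : ℂ) 1))⁻¹ * b := by
  rw [← ENNReal.inv_mul_cancel_left V_ne_zero V_ne_top (b := a)]
  gcongr

instance cocompact_cg : (cocompact ℂ).IsCountablyGenerated := by
  rw [← Metric.cobounded_eq_cocompact, ← comap_norm_atTop]
  infer_instance

lemma G_le (s : ℝ) (hs : 0 < s) (z ω u : ℂ) (h : ‖u - ω‖ ≤ 1) :
    G (2 * s) (z - ω) ≤ ENNReal.ofReal (Real.exp (2 * s)) * G s (z - u) := by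
  unfold G
  rw [← ENNReal.ofReal_mul (Real.exp_pos _).le, ← Real.exp_add]
  apply ENNReal.ofReal_le_ofReal
  apply Real.exp_le_exp.2
  have h1 : ‖z - u‖ ≤ ‖z - ω‖ + ‖u - ω‖ := by
    have := norm_sub_le (z - ω) (u - ω)
    simpa using this
  have h2 : ‖z - u‖ ^ 2 ≤ 2 * ‖z - ω‖ ^ 2 + 2 := by
    have : ‖z - u‖ ≤ ‖z - ω‖ + 1 := by linarith
    nlinarith [norm_nonneg (z - u), norm_nonneg (z - ω), sq_nonneg (‖z - ω‖ - 1)]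
  nlinarith

lemma L1 (s : ℝ) (hs : 0 < s) (z ω : ℂ) :
    volume (ball (0 : ℂ) 1) * G (2 * s) (z - ω) ≤ ENNReal.ofReal (Real.exp (2 * s)) *
      ∫⁻ u, (ball ω 1).indicator (fun u => G s (z - u)) u := by
  rw [lintegral_indicator measurableSet_ball, ← lintegral_const_mul' _ _ ENNReal.ofReal_ne_top]
  have : volume (ball (0 : ℂ) 1) = volume (ball ω 1) := by
    exact (Measure.addHaar_ball_center volume ω 1).symm
  rw [this, mul_comm, ← setLIntegral_const]
  refine setLIntegral_mono' measurableSet_ball fun u hu => G_le s hs z ω u ?_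
  rw [mem_ball, dist_eq_norm] at hu
  exact hu.le

lemma ind_meas : Measurable (fun p : ℂ × ℂ => ({p : ℂ × ℂ | dist p.2 p.1 < 1}).indicator
    (fun _ => (1 : ℝ≥0∞)) p) :=
  measurable_const.indicator (measurableSet_lt (by fun_prop) (by fun_prop))

lemma Avg_meas (Φ : ℂ → ℝ≥0∞) (hΦ : Measurable Φ) : Measurable (Avg Φ) := by
  have : Avg Φ = fun u => ∫⁻ ω, Φ ω * ({p : ℂ × ℂ | dist p.2 p.1 < 1}).indicator
    (fun _ => (1 : ℝ≥0∞)) (u, ω) := by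
    funext u
    unfold Avg
    rw [← lintegral_indicator measurableSet_ball]
    refine lintegral_congr fun ω => ?_
    by_cases h : dist ω u < 1 <;> simp [Set.indicator, h]
  rw [this]
  exact ((hΦ.comp measurable_snd).mul ind_meas).lintegral_prod_right'

lemma core (s : ℝ) (hs : 0 < s) (Φ : ℂ → ℝ≥0∞) (hΦ : Measurable Φ) (z : ℂ) :
    volume (ball (0 : ℂ) 1) * ∫⁻ ω, Φ ω * G (2 * s) (z - ω) ≤
      ENNReal.ofReal (Real.exp (2 * s)) * ∫⁻ v, G s v * Avg Φ (z - v) := by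
  have hG : Measurable fun u => G s (z - u) := (G_meas s).comp (by fun_prop)
  calc volume (ball (0 : ℂ) 1) * ∫⁻ ω, Φ ω * G (2 * s) (z - ω)
      = ∫⁻ ω, Φ ω * (volume (ball (0 : ℂ) 1) * G (2 * s) (z - ω)) := by
        rw [← lintegral_const_mul' _ _ V_ne_top]
        refine lintegral_congr fun ω => by ring
    _ ≤ ∫⁻ ω, ENNReal.ofReal (Real.exp (2 * s)) * (Φ ω *
          ∫⁻ u, (ball ω 1).indicator (fun u => G s (z - u)) u) := by
        refine lintegral_mono fun ω => ?_
        have := mul_le_mul_right (L1 s hs z ω) (Φ ω)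
        calc _ ≤ _ := this
          _ = _ := by ring
    _ = ENNReal.ofReal (Real.exp (2 * s)) * ∫⁻ ω, ∫⁻ u, Φ ω *
          (ball ω 1).indicator (fun u => G s (z - u)) u := by
        rw [lintegral_const_mul' _ _ ENNReal.ofReal_ne_top]
        congr 1
        refine lintegral_congr fun ω => ?_
        rw [lintegral_const_mul _ (hG.indicator measurableSet_ball)]
    _ = ENNReal.ofReal (Real.exp (2 * s)) * ∫⁻ u, ∫⁻ ω, Φ ω *
          (ball ω 1).indicator (fun u => G s (z - u)) u := by
        congr 1
        apply lintegral_lintegral_swap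
        apply Measurable.aemeasurable
        have : (Function.uncurry fun ω u => Φ ω * (ball ω 1).indicator (fun u => G s (z - u)) u)
          = fun p : ℂ × ℂ => Φ p.1 * (({p : ℂ × ℂ | dist p.2 p.1 < 1}).indicator
              (fun _ => (1 : ℝ≥0∞)) p * G s (z - p.2)) := by
          funext ⟨ω, u⟩
          by_cases h : dist u ω < 1 <;> simp [Set.indicator, h, Function.uncurry]
        rw [this]
        exact (hΦ.comp measurable_fst).mul (ind_meas.mul (hG.comp measurable_snd))
    _ = ENNReal.ofReal (Real.exp (2 * s)) * ∫⁻ u, G s (z - u) * Avg Φ u := by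
        congr 1
        refine lintegral_congr fun u => ?_
        unfold Avg
        rw [← lintegral_const_mul _ hΦ, ← lintegral_indicator measurableSet_ball]
        refine lintegral_congr fun ω => ?_
        by_cases h : dist u ω < 1
        · have h' : dist ω u < 1 := by rwa [dist_comm]
          simp [Set.indicator, h, h', mul_comm]
        · have h' : ¬ dist ω u < 1 := by rwa [dist_comm]
          simp [Set.indicator, h, h']
    _ = ENNReal.ofReal (Real.exp (2 * s)) * ∫⁻ v, G s v * Avg Φ (z - v) := by
        congr 1
        rw [← lintegral_sub_left_eq_self _ z]
        simp

/-- Uniform bound. -/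
lemma unif (s : ℝ) (hs : 0 < s) : ∃ C : ℝ≥0∞, C ≠ ⊤ ∧ ∀ Φ : ℂ → ℝ≥0∞, Measurable Φ →
    ∀ B : ℝ≥0∞, (∀ u, Avg Φ u ≤ B) → ∀ z, ∫⁻ ω, Φ ω * G (2 * s) (z - ω) ≤ C * B := by
  refine ⟨(volume (ball (0 : ℂ) 1))⁻¹ * (ENNReal.ofReal (Real.exp (2 * s)) * ∫⁻ v, G s v),
    ENNReal.mul_ne_top (ENNReal.inv_ne_top.2 V_ne_zero)
      (ENNReal.mul_ne_top ENNReal.ofReal_ne_top (G_lintegral s hs)), ?_⟩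
  intro Φ hΦ B hB z
  rw [mul_assoc]
  apply le_inv_mul_V
  refine (core s hs Φ hΦ z).trans ?_
  rw [mul_assoc, ← lintegral_mul_const _ (G_meas s)]
  gcongr
  exact hB _

lemma tends (s : ℝ) (hs : 0 < s) (Φ : ℂ → ℝ≥0∞) (hΦ : Measurable Φ) (B : ℝ≥0∞) (hB : B ≠ ⊤)
    (hAB : ∀ u, Avg Φ u ≤ B) (hA : Tendsto (Avg Φ) (cocompact ℂ) (𝓝 0)) :
    Tendsto (fun z => ∫⁻ ω, Φ ω * G (2 * s) (z - ω)) (cocompact ℂ) (𝓝 0) := by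
  have h1 : Tendsto (fun z => ∫⁻ v, G s v * Avg Φ (z - v)) (cocompact ℂ) (𝓝 0) := by
    have := tendsto_lintegral_filter_of_dominated_convergence (μ := volume) (l := cocompact ℂ)
      (F := fun z v => G s v * Avg Φ (z - v)) (f := fun _ => 0) (fun v => G s v * B)
      (Eventually.of_forall fun z => (G_meas s).mul ((Avg_meas Φ hΦ).comp (by fun_prop)))
      (Eventually.of_forall fun z => Eventually.of_forall fun v => by
        gcongr; exact hAB _)
      (by rw [lintegral_mul_const _ (G_meas s)]; exact ENNReal.mul_ne_top (G_lintegral s hs) hB)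
      (Eventually.of_forall fun v => by
        have ht : Tendsto (fun z : ℂ => z - v) (cocompact ℂ) (cocompact ℂ) :=
          (Homeomorph.subRight v).isClosedEmbedding.tendsto_cocompact
        have := ENNReal.Tendsto.const_mul (a := G s v) (hA.comp ht)
          (Or.inr ENNReal.ofReal_ne_top)
        simpa using this)
    simpa using this
  have h2 := ENNReal.Tendsto.const_mul
    (a := (volume (ball (0 : ℂ) 1))⁻¹ * ENNReal.ofReal (Real.exp (2 * s))) h1
    (Or.inr (ENNReal.mul_ne_top (ENNReal.inv_ne_top.2 V_ne_zero) ENNReal.ofReal_ne_top))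
  rw [mul_zero] at h2
  refine tendsto_of_tendsto_of_tendsto_of_le_of_le tendsto_const_nhds h2 (fun _ => zero_le) ?_
  intro z
  dsimp only
  rw [mul_assoc]
  apply le_inv_mul_V
  exact core s hs Φ hΦ z

lemma Avg_le (s : ℝ) (hs : 0 < s) (Φ : ℂ → ℝ≥0∞) (z : ℂ) :
    Avg Φ z ≤ ENNReal.ofReal (Real.exp s) * ∫⁻ ω, Φ ω * G s (z - ω) := by
  rw [← lintegral_const_mul' _ _ ENNReal.ofReal_ne_top]
  unfold Avg
  refine le_trans (setLIntegral_mono' measurableSet_ball fun ω hω => ?_)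
    (setLIntegral_le_lintegral (ball z 1) _)
  have h1 : 1 ≤ ENNReal.ofReal (Real.exp s) * G s (z - ω) := by
    unfold G
    rw [← ENNReal.ofReal_mul (Real.exp_pos _).le, ← Real.exp_add, ENNReal.one_le_ofReal]
    apply Real.one_le_exp
    rw [mem_ball, dist_comm, dist_eq_norm] at hω
    have : ‖z - ω‖ ^ 2 ≤ 1 := pow_le_one₀ (norm_nonneg _) hω.le
    nlinarith
  calc Φ ω = Φ ω * 1 := (mul_one _).symm
    _ ≤ Φ ω * (ENNReal.ofReal (Real.exp s) * G s (z - ω)) := by gcongr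
    _ = _ := by ring

lemma Avg_bdd (α : ℝ) (hα : 0 < α) (φ : ℂ → ℝ) (hpos : ∀ ω, 0 ≤ φ ω) (hI : CondI1 α φ)
    (hA : Tendsto (Avg fun ω => ENNReal.ofReal (φ ω)) (cocompact ℂ) (𝓝 0)) :
    ∃ B : ℝ≥0∞, B ≠ ⊤ ∧ ∀ u, Avg (fun ω => ENNReal.ofReal (φ ω)) u ≤ B := by
  have h1 : ∀ᶠ z in cocompact ℂ, Avg (fun ω => ENNReal.ofReal (φ ω)) z < 1 :=
    hA.eventually (gt_mem_nhds one_pos)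
  obtain ⟨R, hR⟩ := (Filter.hasBasis_cocompact.eventually_iff).1 h1 |>.imp fun K hK => hK
  obtain ⟨hK, hR⟩ := hR
  obtain ⟨r, hr⟩ := hK.isBounded.exists_norm_le
  have h0 := hI 0
  refine ⟨1 + ENNReal.ofReal (Real.exp (α * (r + 1) ^ 2)) * _,
    ENNReal.add_ne_top.2 ⟨ENNReal.one_ne_top, ENNReal.mul_ne_top ENNReal.ofReal_ne_top h0.ne⟩, ?_⟩
  intro u
  by_cases hu : u ∈ R
  · refine le_trans ?_ le_add_self
    rw [← lintegral_const_mul' _ _ ENNReal.ofReal_ne_top]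
    unfold Avg
    refine le_trans (setLIntegral_mono' measurableSet_ball fun ω hω => ?_)
      (setLIntegral_le_lintegral (ball u 1) _)
    rw [← ENNReal.ofReal_mul (Real.exp_pos _).le]
    apply ENNReal.ofReal_le_ofReal
    rw [abs_of_nonneg (hpos ω), mul_left_comm, ← Real.exp_add]
    apply le_mul_of_one_le_right (hpos ω)
    apply Real.one_le_exp
    rw [mem_ball, dist_eq_norm] at hω
    have h2 : ‖ω‖ ≤ r + 1 := by
      have := norm_add_le (ω - u) u
      rw [sub_add_cancel] at this
      linarith [hr u hu]
    have : ‖ω‖ ^ 2 ≤ (r + 1) ^ 2 := pow_le_pow_left₀ (norm_nonneg _) h2 2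
    simp
    nlinarith
  · exact (hR hu).le.trans le_self_add

lemma berezin_eq (α t : ℝ) (φ : ℂ → ℝ) (hpos : ∀ ω, 0 ≤ φ ω) (z : ℂ) :
    berezinF α t φ z = ENNReal.ofReal (α / Real.pi) *
      ∫⁻ ω, ENNReal.ofReal (φ ω) * G (α * t / 2) (z - ω) := by
  unfold berezinF G
  congr 1
  refine lintegral_congr fun ω => ?_
  rw [ENNReal.ofReal_mul (hpos ω)]

/-- The normalized kernel. -/
noncomputable def ker (α : ℝ) (z w : ℂ) : ℂ :=
  Complex.exp ((α : ℂ) * w * (starRingEnd ℂ) z - ((α * ‖z‖ ^ 2 / 2 : ℝ) : ℂ))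

lemma norm_sub_sq' (z w : ℂ) :
    ‖z - w‖ ^ 2 = ‖z‖ ^ 2 + ‖w‖ ^ 2 - 2 * (z * (starRingEnd ℂ) w).re := by
  rw [Complex.sq_norm, Complex.sq_norm, Complex.sq_norm, Complex.normSq_sub]

lemma re_eq (α : ℝ) (z w : ℂ) (x : ℝ) :
    ((α : ℂ) * z * (starRingEnd ℂ) w - (x : ℂ)).re = α * (z * (starRingEnd ℂ) w).re - x := by
  rw [mul_assoc, Complex.sub_re, Complex.re_ofReal_mul, Complex.ofReal_re]

lemma ker_norm (α : ℝ) (z w : ℂ) :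
    ‖ker α z w‖ * gauss α w = Real.exp (-(α / 2) * ‖z - w‖ ^ 2) := by
  unfold ker gauss
  rw [Complex.norm_exp, ← Real.exp_add, re_eq, norm_sub_rev, norm_sub_sq']
  congr 1
  ring

lemma toep_ker (α : ℝ) (hα : 0 < α) (φ : ℂ → ℝ) (hm : Measurable φ) (hpos : ∀ ω, 0 ≤ φ ω)
    (hI : CondI1 α φ) (z : ℂ) :
    berezinF α 2 φ z ≤ fockNormInf α (toeplitzF α φ (ker α z)) := by
  refine le_trans (le_of_eq ?_) (le_iSup _ z)
  have key : ∀ ω : ℂ, (φ ω : ℂ) * ker α z ω *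
      Complex.exp ((α : ℂ) * z * (starRingEnd ℂ) ω - ((α * ‖ω‖ ^ 2 : ℝ) : ℂ)) =
      ((Real.exp (α * ‖z‖ ^ 2 / 2) * (φ ω * Real.exp (-(α * 2 / 2) * ‖z - ω‖ ^ 2)) : ℝ) : ℂ) := by
    intro ω
    unfold ker
    push_cast
    rw [mul_assoc, ← Complex.exp_add, mul_left_comm, ← Complex.exp_add]
    congr 2
    have h1 : ((‖z - ω‖ : ℂ)) ^ 2 = (z - ω) * (starRingEnd ℂ) (z - ω) := by
      rw [Complex.mul_conj, Complex.normSq_eq_norm_sq]; push_cast; rfl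
    have h2 : ((‖z‖ : ℂ)) ^ 2 = z * (starRingEnd ℂ) z := by
      rw [Complex.mul_conj, Complex.normSq_eq_norm_sq]; push_cast; rfl
    have h3 : ((‖ω‖ : ℂ)) ^ 2 = ω * (starRingEnd ℂ) ω := by
      rw [Complex.mul_conj, Complex.normSq_eq_norm_sq]; push_cast; rfl
    rw [h1, h2, h3, map_sub]
    ring
  have hnn : ∀ ω, 0 ≤ φ ω * Real.exp (-(α * 2 / 2) * ‖z - ω‖ ^ 2) :=
    fun ω => mul_nonneg (hpos ω) (Real.exp_pos _).le
  have hfin : ∫⁻ ω : ℂ, ENNReal.ofReal (φ ω * Real.exp (-(α * 2 / 2) * ‖z - ω‖ ^ 2)) < ⊤ := by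
    refine lt_of_le_of_lt (lintegral_mono fun ω => ?_) (hI z)
    apply ENNReal.ofReal_le_ofReal
    rw [abs_of_nonneg (hpos ω)]
    apply mul_le_mul_of_nonneg_left _ (hpos ω)
    apply Real.exp_le_exp.2
    rw [norm_sub_rev, norm_sub_sq', mul_comm ((starRingEnd ℂ) z)]
    nlinarith [sq_nonneg ‖z‖]
  have hint : Integrable (fun ω => φ ω * Real.exp (-(α * 2 / 2) * ‖z - ω‖ ^ 2)) := by
    refine ⟨by fun_prop, ?_⟩
    rw [hasFiniteIntegral_iff_ofReal (Eventually.of_forall hnn)]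
    exact hfin
  unfold toeplitzF
  simp_rw [key]
  rw [integral_complex_ofReal, ← Complex.ofReal_mul, integral_const_mul, Complex.norm_real,
    Real.norm_of_nonneg (by
      have := integral_nonneg (μ := volume) (f := fun ω => φ ω * Real.exp (-(α * 2 / 2) * ‖z - ω‖ ^ 2)) hnn
      positivity)]
  have : α / Real.pi * (Real.exp (α * ‖z‖ ^ 2 / 2) *
      ∫ ω, φ ω * Real.exp (-(α * 2 / 2) * ‖z - ω‖ ^ 2)) * gauss α z =
      α / Real.pi * ∫ ω, φ ω * Real.exp (-(α * 2 / 2) * ‖z - ω‖ ^ 2) := by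
    unfold gauss
    have : Real.exp (α * ‖z‖ ^ 2 / 2) * Real.exp (-α * ‖z‖ ^ 2 / 2) = 1 := by
      rw [← Real.exp_add, ← Real.exp_zero]; congr 1; ring
    linear_combination (α / Real.pi * ∫ ω, φ ω * Real.exp (-(α * 2 / 2) * ‖z - ω‖ ^ 2)) * this
  rw [this, ENNReal.ofReal_mul (by positivity),
    ofReal_integral_eq_lintegral_ofReal hint (Eventually.of_forall hnn)]
  rfl

lemma ker_mem (α : ℝ) (hα : 0 < α) (z : ℂ) : fockNormInf α (ker α z) ≤ 1 := by
  refine iSup_le fun w => ?_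
  rw [ker_norm, ENNReal.ofReal_le_one, Real.exp_le_one_iff]
  nlinarith [sq_nonneg ‖z - w‖]

lemma ker_unif (α : ℝ) (hα : 0 < α) (z : ℕ → ℂ) (hz : Tendsto z atTop (cocompact ℂ))
    (K : Set ℂ) (hK : IsCompact K) :
    TendstoUniformlyOn (fun n => ToepAux.ker α (z n)) (fun _ => 0) atTop K := by
  obtain ⟨r, hr⟩ := hK.isBounded.exists_norm_le
  have hz' : Tendsto (fun n => ‖z n‖) atTop atTop := (tendsto_norm_cocompact_atTop).comp hz
  have h1 : Tendsto (fun x : ℝ => Real.exp (x * (α * r - α / 2 * x))) atTop (𝓝 0) := by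
    refine Real.tendsto_exp_atBot.comp ?_
    refine Tendsto.atTop_mul_atBot₀ tendsto_id ?_
    refine tendsto_atBot_add_const_left _ _ ?_ |>.congr fun x => (sub_eq_add_neg _ _).symm
    exact tendsto_neg_atTop_atBot.comp (tendsto_id.const_mul_atTop (by positivity))
  rw [Metric.tendstoUniformlyOn_iff]
  intro ε hε
  filter_upwards [(h1.comp hz').eventually (gt_mem_nhds hε)] with n hn w hw
  rw [dist_zero_left]
  refine lt_of_le_of_lt ?_ hn
  unfold ker
  rw [Complex.norm_exp, re_eq]
  apply Real.exp_le_exp.2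
  have h2 : (w * (starRingEnd ℂ) (z n)).re ≤ r * ‖z n‖ := by
    refine (Complex.re_le_norm _).trans ?_
    rw [norm_mul, Complex.norm_conj]
    gcongr
    exact hr w hw
  nlinarith

lemma toep_le (α : ℝ) (hα : 0 < α) (φ : ℂ → ℝ) (hpos : ∀ ω, 0 ≤ φ ω) (f : ℂ → ℂ) (z : ℂ) :
    ENNReal.ofReal (‖toeplitzF α φ f z‖ * gauss α z) ≤ ENNReal.ofReal (α / Real.pi) *
      ∫⁻ ω, ENNReal.ofReal (φ ω) * ENNReal.ofReal (‖f ω‖ * gauss α ω) * G (α / 2) (z - ω) := by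
  unfold toeplitzF
  have hg : 0 ≤ gauss α z := (Real.exp_pos _).le
  rw [norm_mul, Complex.norm_real, Real.norm_of_nonneg (by positivity), mul_assoc,
    ENNReal.ofReal_mul (by positivity)]
  gcongr
  rw [ENNReal.ofReal_mul (norm_nonneg _), ofReal_norm]
  refine (mul_le_mul_left (enorm_integral_le_lintegral_enorm _) _).trans ?_
  rw [← lintegral_mul_const' _ _ ENNReal.ofReal_ne_top]
  refine lintegral_mono fun ω => le_of_eq ?_
  dsimp only
  have hgω : 0 ≤ gauss α ω := (Real.exp_pos _).le
  rw [← ofReal_norm, ← ENNReal.ofReal_mul (norm_nonneg _)]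
  unfold G
  rw [← ENNReal.ofReal_mul (hpos ω), ← ENNReal.ofReal_mul
    (mul_nonneg (hpos ω) (mul_nonneg (norm_nonneg _) hgω))]
  congr 1
  rw [norm_mul, norm_mul, Complex.norm_real, Real.norm_of_nonneg (hpos ω), Complex.norm_exp, re_eq,
    norm_sub_sq']
  unfold gauss
  rw [mul_assoc (φ ω * ‖f ω‖), ← Real.exp_add, ← mul_assoc (φ ω), mul_assoc (φ ω * ‖f ω‖),
    ← Real.exp_add]
  congr 2
  ring

lemma Avg_tends (α : ℝ) (hα : 0 < α) (φ : ℂ → ℝ) (hpos : ∀ ω, 0 ≤ φ ω) (t : ℝ) (ht : 0 < t)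
    (h : Tendsto (fun z => berezinF α t φ z) (cocompact ℂ) (𝓝 0)) :
    Tendsto (Avg fun ω => ENNReal.ofReal (φ ω)) (cocompact ℂ) (𝓝 0) := by
  have hc0 : ENNReal.ofReal (α / Real.pi) ≠ 0 := by
    have : 0 < α / Real.pi := by positivity
    simpa using this
  have h2 := ENNReal.Tendsto.const_mul
    (a := ENNReal.ofReal (Real.exp (α * t / 2)) * (ENNReal.ofReal (α / Real.pi))⁻¹) h
    (Or.inr (ENNReal.mul_ne_top ENNReal.ofReal_ne_top (ENNReal.inv_ne_top.2 hc0)))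
  rw [mul_zero] at h2
  refine tendsto_of_tendsto_of_tendsto_of_le_of_le tendsto_const_nhds h2 (fun _ => zero_le) ?_
  intro z
  dsimp only
  rw [berezin_eq α t φ hpos, mul_assoc, ENNReal.inv_mul_cancel_left hc0 ENNReal.ofReal_ne_top]
  exact Avg_le _ (by positivity) _ z

end ToepAux

open ToepAux

/-- For measurable `φ ≥ 0` satisfying condition (I₁), the Toeplitz operator `T_φ` is
compact on `F_α^∞` iff for every `t > 0` the `t`-Berezin transform `φ̃_t` vanishes at infinity. -/
theorem stmt15 (α : ℝ) (hα : 0 < α) (φ : ℂ → ℝ) (hmeas : Measurable φ)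
    (hpos : ∀ ω : ℂ, 0 ≤ φ ω) (hI : CondI1 α φ) :
    (∀ f : ℕ → ℂ → ℂ, (∀ n, MemFockInf α (f n)) →
      (∃ M : ℝ, ∀ n, fockNormInf α (f n) ≤ ENNReal.ofReal M) →
      (∀ K : Set ℂ, IsCompact K → TendstoUniformlyOn (fun n => f n) (fun _ => 0) atTop K) →
      Tendsto (fun n => fockNormInf α (toeplitzF α φ (f n))) atTop (𝓝 0)) ↔
      ∀ t : ℝ, 0 < t → Tendsto (fun z => berezinF α t φ z) (cocompact ℂ) (𝓝 0) := by
  have hΦ : Measurable fun ω => ENNReal.ofReal (φ ω) := hmeas.ennreal_ofReal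
  have hc0 : ENNReal.ofReal (α / Real.pi) ≠ 0 := by
    have : 0 < α / Real.pi := by positivity
    simpa using this
  constructor
  · intro h t ht
    have h2 : Tendsto (fun z => berezinF α 2 φ z) (cocompact ℂ) (𝓝 0) := by
      rw [tendsto_iff_seq_tendsto]
      intro z hz
      have := h (fun n => ToepAux.ker α (z n))
        (fun n => ⟨by unfold ToepAux.ker; fun_prop,
          ne_top_of_le_ne_top ENNReal.one_ne_top (ker_mem α hα (z n))⟩)
        ⟨1, fun n => by simpa using ker_mem α hα (z n)⟩
        (fun K hK => ker_unif α hα z hz K hK)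
      exact tendsto_of_tendsto_of_tendsto_of_le_of_le tendsto_const_nhds this (fun _ => zero_le)
        (fun n => toep_ker α hα φ hmeas hpos hI (z n))
    have hA := Avg_tends α hα φ hpos 2 two_pos h2
    obtain ⟨B, hB, hAB⟩ := Avg_bdd α hα φ hpos hI hA
    have := tends (α * t / 4) (by positivity) _ hΦ B hB hAB hA
    have := ENNReal.Tendsto.const_mul (a := ENNReal.ofReal (α / Real.pi)) this
      (Or.inr ENNReal.ofReal_ne_top)
    rw [mul_zero] at this
    refine this.congr fun z => ?_
    rw [berezin_eq α t φ hpos]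
    have e : 2 * (α * t / 4) = α * t / 2 := by ring
    rw [e]
  · intro h f hf ⟨M, hM⟩ hK
    have hA := Avg_tends α hα φ hpos 2 two_pos (h 2 two_pos)
    obtain ⟨B, hB, hAB⟩ := Avg_bdd α hα φ hpos hI hA
    obtain ⟨C, hC, hCB⟩ := unif (α / 4) (by positivity)
    have e : 2 * (α / 4) = α / 2 := by ring
    rw [e] at hCB
    -- constants
    set c := ENNReal.ofReal (α / Real.pi) with hc
    have hc1 : c ≠ ⊤ := ENNReal.ofReal_ne_top
    -- key estimate
    have main : ∀ δ : ℝ, 0 < δ → ∀ᶠ n in atTop, fockNormInf α (toeplitzF α φ (f n)) ≤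
        c * (ENNReal.ofReal δ * (C * B) + ENNReal.ofReal M * (C * ENNReal.ofReal δ)) := by
      intro δ hδ
      have h1 : ∀ᶠ z in cocompact ℂ, Avg (fun ω => ENNReal.ofReal (φ ω)) z < ENNReal.ofReal δ :=
        hA.eventually (gt_mem_nhds (by simpa using hδ))
      obtain ⟨K, hKc, hKA⟩ := (Filter.hasBasis_cocompact.eventually_iff).1 h1
      have hK2 : IsCompact (cthickening 1 K) := hKc.cthickening
      have hK2m : MeasurableSet (cthickening 1 K) := isClosed_cthickening.measurableSet
      have h2 := Metric.tendstoUniformlyOn_iff.1 (hK _ hK2) δ hδ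
      filter_upwards [h2] with n hn
      refine iSup_le fun z => (toep_le α hα φ hpos (f n) z).trans ?_
      gcongr
      have hΨ : Measurable ((cthickening 1 K)ᶜ.indicator fun ω => ENNReal.ofReal (φ ω)) :=
        hΦ.indicator hK2m.compl
      have hGm : Measurable fun ω => G (α / 2) (z - ω) := (G_meas _).comp (by fun_prop)
      calc ∫⁻ ω, ENNReal.ofReal (φ ω) * ENNReal.ofReal (‖f n ω‖ * gauss α ω) * G (α / 2) (z - ω)
          ≤ ∫⁻ ω, (ENNReal.ofReal δ * (ENNReal.ofReal (φ ω) * G (α / 2) (z - ω)) +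
              ENNReal.ofReal M * ((cthickening 1 K)ᶜ.indicator (fun ω => ENNReal.ofReal (φ ω)) ω *
                G (α / 2) (z - ω))) := by
            refine lintegral_mono fun ω => ?_
            dsimp only
            by_cases hω : ω ∈ cthickening 1 K
            · refine le_trans ?_ le_self_add
              have : ENNReal.ofReal (‖f n ω‖ * gauss α ω) ≤ ENNReal.ofReal δ := by
                apply ENNReal.ofReal_le_ofReal
                have h3 := hn ω hω
                rw [dist_zero_left] at h3
                have h4 : gauss α ω ≤ 1 := by
                  unfold gauss
                  rw [Real.exp_le_one_iff]
                  nlinarith [sq_nonneg ‖ω‖]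
                have h5 : 0 ≤ gauss α ω := (Real.exp_pos _).le
                nlinarith [norm_nonneg (f n ω)]
              rw [mul_assoc, mul_left_comm]
              gcongr
            · refine le_trans ?_ le_add_self
              have : ENNReal.ofReal (‖f n ω‖ * gauss α ω) ≤ ENNReal.ofReal M :=
                (le_iSup (fun w => ENNReal.ofReal (‖f n w‖ * gauss α w)) ω).trans (hM n)
              rw [Set.indicator_of_mem (show ω ∈ (cthickening 1 K)ᶜ from hω), mul_assoc,
                mul_left_comm]
              gcongr
        _ = ENNReal.ofReal δ * (∫⁻ ω, ENNReal.ofReal (φ ω) * G (α / 2) (z - ω)) +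
            ENNReal.ofReal M * ∫⁻ ω, ((cthickening 1 K)ᶜ.indicator
              (fun ω => ENNReal.ofReal (φ ω)) ω * G (α / 2) (z - ω)) := by
            have hm1 : Measurable fun ω => ENNReal.ofReal δ *
                (ENNReal.ofReal (φ ω) * G (α / 2) (z - ω)) := (hΦ.mul hGm).const_mul _
            rw [lintegral_add_left hm1,
              lintegral_const_mul' _ _ ENNReal.ofReal_ne_top,
              lintegral_const_mul' _ _ ENNReal.ofReal_ne_top]
        _ ≤ _ := by
            gcongr
            · exact hCB _ hΦ B hAB z
            · refine hCB _ hΨ _ (fun u => ?_) z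
              by_cases hu : u ∈ K
              · have : Avg ((cthickening 1 K)ᶜ.indicator fun ω => ENNReal.ofReal (φ ω)) u = 0 := by
                  unfold Avg
                  rw [setLIntegral_eq_zero_iff measurableSet_ball hΨ]
                  refine Eventually.of_forall fun ω hω => ?_
                  rw [Set.indicator_of_notMem]
                  rw [Set.notMem_compl_iff]
                  exact mem_cthickening_of_dist_le ω u 1 K hu (mem_ball.1 hω).le
                rw [this]
                exact zero_le
              · refine le_trans ?_ (hKA hu).le
                unfold Avg
                refine lintegral_mono fun ω => ?_
                exact Set.indicator_le_self _ _ ω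
    have hlim : Tendsto (fun δ : ℝ => c * (ENNReal.ofReal δ * (C * B) +
        ENNReal.ofReal M * (C * ENNReal.ofReal δ))) (𝓝[>] 0) (𝓝 0) := by
      have h0 : Tendsto (fun δ : ℝ => ENNReal.ofReal δ) (𝓝[>] 0) (𝓝 0) := by
        have := (ENNReal.continuous_ofReal.tendsto 0)
        rw [ENNReal.ofReal_zero] at this
        exact this.mono_left nhdsWithin_le_nhds
      have hCBt : C * B ≠ ⊤ := ENNReal.mul_ne_top hC hB
      have a1 := ENNReal.Tendsto.mul_const (b := C * B) h0 (Or.inr hCBt)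
      have a2 := ENNReal.Tendsto.const_mul (a := ENNReal.ofReal M)
        (ENNReal.Tendsto.const_mul (a := C) h0 (Or.inr hC)) (Or.inr ENNReal.ofReal_ne_top)
      have a3 := ENNReal.Tendsto.const_mul (a := c) (a1.add a2) (Or.inr hc1)
      simpa using a3
    rw [ENNReal.tendsto_nhds_zero]
    intro ε hε
    obtain ⟨δ, hδ1, hδ2⟩ :=
      ((hlim.eventually (gt_mem_nhds hε)).and self_mem_nhdsWithin).exists
    filter_upwards [main δ hδ2] with n hn
    exact hn.trans hδ1.le
end

section
/- Let α > 0 and let φ : ℂ → ℂ be Lebesgue measurable satisfying condition (I₁) and the Fock BMO bound sup_{z∈ℂ} ∫_ℂ |φ(z − ω) − φ̃_2(z)| dλ_α(ω) < ∞. Then the Toeplitz operator T_φ is bounded on F_α^∞ if and only if for every t > 0 the t-Berezin transform φ̃_t is bounded on ℂ. -/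
open MeasureTheory Filter Metric
open scoped ENNReal Topology

/-- Condition (I₁) for a complex symbol:
`(α/π) ∫ |φ(ω)| e^{2α Re(z̄ω)} e^{-α|ω|²} dA(ω) < ∞` for every `z`. -/
def CondI1C (α : ℝ) (φ : ℂ → ℂ) : Prop :=
  ∀ z : ℂ, (∫⁻ ω : ℂ,
    ENNReal.ofReal (‖φ ω‖ *
      Real.exp (2 * α * ((starRingEnd ℂ) z * ω).re - α * ‖ω‖ ^ 2))) < ⊤

/-- The Toeplitz operator with complex symbol `φ`:
`T_φ f(z) = (α/π) ∫ φ(ω) f(ω) e^{α z ω̄} e^{-α|ω|²} dA(ω)`. -/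
noncomputable def toeplitzC (α : ℝ) (φ : ℂ → ℂ) (f : ℂ → ℂ) (z : ℂ) : ℂ :=
  ((α / Real.pi : ℝ) : ℂ) *
    ∫ ω : ℂ, φ ω * f ω *
      Complex.exp ((α : ℂ) * z * (starRingEnd ℂ) ω - ((α * ‖ω‖ ^ 2 : ℝ) : ℂ))

/-- The `t`-Berezin transform of a complex symbol `φ`:
`φ̃_t(z) = (α/π) ∫ φ(ω) e^{-(αt/2)|z-ω|²} dA(ω)`. -/
noncomputable def berezinC (α t : ℝ) (φ : ℂ → ℂ) (z : ℂ) : ℂ :=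
  ((α / Real.pi : ℝ) : ℂ) *
    ∫ ω : ℂ, φ ω * ((Real.exp (-(α * t / 2) * ‖z - ω‖ ^ 2) : ℝ) : ℂ)

/-- The Fock-BMO bound: `sup_z ∫ |φ(z − ω) − φ̃_2(z)| dλ_α(ω) < ∞`. -/
def FockBMOBound (α : ℝ) (φ : ℂ → ℂ) : Prop :=
  ∃ B : ℝ, ∀ z : ℂ, (∫⁻ ω : ℂ,
      ENNReal.ofReal (α / Real.pi * Real.exp (-α * ‖ω‖ ^ 2) *
        ‖φ (z - ω) - berezinC α 2 φ z‖)) ≤ ENNReal.ofReal B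


noncomputable def absB (φ : ℂ → ℂ) (s : ℝ) (z : ℂ) : ℝ≥0∞ :=
  ∫⁻ ω : ℂ, ENNReal.ofReal (‖φ ω‖ * Real.exp (-s * ‖z - ω‖ ^ 2))

def absBdd (φ : ℂ → ℂ) (s : ℝ) : Prop := ∃ K : ℝ≥0∞, K ≠ ⊤ ∧ ∀ z, absB φ s z ≤ K

lemma gaussian_integrable (s : ℝ) (hs : 0 < s) :
    Integrable (fun ω : ℂ => Real.exp (-s * ‖ω‖ ^ 2)) := by
  have h := GaussianFourier.integrable_cexp_neg_mul_sq_norm_add (V := ℂ) (b := (s : ℂ))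
    (by simpa using hs) 0 0
  have h2 := h.norm
  refine h2.congr (Eventually.of_forall fun ω => ?_)
  simp only [Complex.norm_exp]
  congr 1
  simp [← Complex.ofReal_pow]

lemma gaussian_lint_ne_top (s : ℝ) (hs : 0 < s) :
    (∫⁻ ω : ℂ, ENNReal.ofReal (Real.exp (-s * ‖ω‖ ^ 2))) ≠ ⊤ :=
  (gaussian_integrable s hs).lintegral_lt_top.ne

lemma gaussian_lint_ne_zero (s : ℝ) :
    (∫⁻ ω : ℂ, ENNReal.ofReal (Real.exp (-s * ‖ω‖ ^ 2))) ≠ 0 := by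
  intro h
  rw [lintegral_eq_zero_iff (by fun_prop)] at h
  have : ∀ᵐ ω : ℂ, False := by
    filter_upwards [h] with ω hω
    simp only [Pi.zero_apply, ENNReal.ofReal_eq_zero] at hω
    exact absurd hω (not_le.mpr (Real.exp_pos _))
  simp only [eventually_false_iff_eq_bot, ae_eq_bot] at this
  exact NeZero.ne (volume : Measure ℂ) this

lemma absB_mono (φ : ℂ → ℂ) {s t : ℝ} (h : s ≤ t) (z : ℂ) : absB φ t z ≤ absB φ s z := by
  refine lintegral_mono fun ω => ENNReal.ofReal_le_ofReal ?_
  have : -t * ‖z - ω‖ ^ 2 ≤ -s * ‖z - ω‖ ^ 2 := by nlinarith [sq_nonneg ‖z - ω‖]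
  gcongr

lemma parallel_id (z ω u : ℂ) (s : ℝ) :
    -s * ‖u - ω‖ ^ 2 + -s * ‖z - u‖ ^ 2 =
      -(s / 2) * ‖z - ω‖ ^ 2 + -(2 * s) * ‖u - (z + ω) / 2‖ ^ 2 := by
  have e : ((z + ω) / 2).re = (z.re + ω.re) / 2 := by simp
  have e' : ((z + ω) / 2).im = (z.im + ω.im) / 2 := by simp
  simp only [Complex.sq_norm, Complex.normSq_apply, Complex.sub_re, Complex.sub_im, e, e']
  ring

lemma absBdd_half (φ : ℂ → ℂ) (hm : Measurable φ) {s : ℝ} (hs : 0 < s) (h : absBdd φ s) :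
    absBdd φ (s / 2) := by
  obtain ⟨K, hK, hb⟩ := h
  set c := ∫⁻ ω : ℂ, ENNReal.ofReal (Real.exp (-(2 * s) * ‖ω‖ ^ 2)) with hc
  set d := ∫⁻ ω : ℂ, ENNReal.ofReal (Real.exp (-s * ‖ω‖ ^ 2)) with hd
  have c0 : c ≠ 0 := gaussian_lint_ne_zero _
  have ct : c ≠ ⊤ := gaussian_lint_ne_top _ (by linarith)
  have dt : d ≠ ⊤ := gaussian_lint_ne_top _ hs
  refine ⟨K * d / c, ENNReal.div_ne_top (ENNReal.mul_ne_top hK dt) c0, fun z => ?_⟩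
  rw [ENNReal.le_div_iff_mul_le (Or.inl c0) (Or.inl ct)]
  calc absB φ (s / 2) z * c
      = ∫⁻ ω : ℂ, ENNReal.ofReal (‖φ ω‖ * Real.exp (-(s / 2) * ‖z - ω‖ ^ 2)) * c := by
        rw [absB, lintegral_mul_const _ (by fun_prop)]
    _ = ∫⁻ ω : ℂ, ∫⁻ u : ℂ, ENNReal.ofReal (‖φ ω‖ * Real.exp (-s * ‖u - ω‖ ^ 2)) *
          ENNReal.ofReal (Real.exp (-s * ‖z - u‖ ^ 2)) := by
        refine lintegral_congr fun ω => ?_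
        rw [hc, ← lintegral_sub_right_eq_self
          (fun u : ℂ => ENNReal.ofReal (Real.exp (-(2 * s) * ‖u‖ ^ 2))) ((z + ω) / 2),
          ← lintegral_const_mul _ (by fun_prop)]
        refine lintegral_congr fun u => ?_
        rw [← ENNReal.ofReal_mul (by positivity), ← ENNReal.ofReal_mul (by positivity),
          mul_assoc, mul_assoc, ← Real.exp_add, ← Real.exp_add, parallel_id]
    _ = ∫⁻ u : ℂ, ∫⁻ ω : ℂ, ENNReal.ofReal (‖φ ω‖ * Real.exp (-s * ‖u - ω‖ ^ 2)) *
          ENNReal.ofReal (Real.exp (-s * ‖z - u‖ ^ 2)) := by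
        refine lintegral_lintegral_swap (Measurable.aemeasurable ?_)
        simp only [Function.uncurry_def]
        fun_prop
    _ = ∫⁻ u : ℂ, absB φ s u * ENNReal.ofReal (Real.exp (-s * ‖z - u‖ ^ 2)) := by
        refine lintegral_congr fun u => ?_
        rw [absB, lintegral_mul_const _ (by fun_prop)]
    _ ≤ ∫⁻ u : ℂ, K * ENNReal.ofReal (Real.exp (-s * ‖z - u‖ ^ 2)) := by
        refine lintegral_mono fun u => ?_
        gcongr
        exact hb u
    _ = K * d := by
        rw [lintegral_const_mul _ (by fun_prop), hd,
          lintegral_sub_left_eq_self (fun u : ℂ => ENNReal.ofReal (Real.exp (-s * ‖u‖ ^ 2))) z]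

lemma absBdd_all (φ : ℂ → ℂ) (hm : Measurable φ) {s : ℝ} (hs : 0 < s) (h : absBdd φ s)
    {t : ℝ} (ht : 0 < t) : absBdd φ t := by
  have key : ∀ n : ℕ, absBdd φ (s * (1 / 2) ^ n) := by
    intro n
    induction n with
    | zero => simpa using h
    | succ k ih =>
      have := absBdd_half φ hm (by positivity) ih
      convert this using 1
      ring
  obtain ⟨n, hn⟩ := exists_pow_lt_of_lt_one (div_pos ht hs) (by norm_num : (1 / 2 : ℝ) < 1)
  obtain ⟨K, hK, hb⟩ := key n
  refine ⟨K, hK, fun z => (absB_mono φ ?_ z).trans (hb z)⟩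
  rw [lt_div_iff₀ hs] at hn
  linarith

lemma absBdd_of_bmo (α : ℝ) (hα : 0 < α) (φ : ℂ → ℂ) (hmeas : Measurable φ)
    (hBMO : FockBMOBound α φ) (M : ℝ) (hM : ∀ z, ‖berezinC α 2 φ z‖ ≤ M) : absBdd φ α := by
  obtain ⟨B, hB⟩ := hBMO
  set d := ∫⁻ ω : ℂ, ENNReal.ofReal (Real.exp (-α * ‖ω‖ ^ 2)) with hd
  have dt : d ≠ ⊤ := gaussian_lint_ne_top _ hα
  have hM0 : 0 ≤ M := (norm_nonneg _).trans (hM 0)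
  have hpi := Real.pi_pos
  refine ⟨ENNReal.ofReal (Real.pi / α) * ENNReal.ofReal B + ENNReal.ofReal M * d,
    ENNReal.add_ne_top.2 ⟨ENNReal.mul_ne_top ENNReal.ofReal_ne_top ENNReal.ofReal_ne_top,
      ENNReal.mul_ne_top ENNReal.ofReal_ne_top dt⟩, fun z => ?_⟩
  rw [absB, ← lintegral_sub_left_eq_self _ z]
  calc _ ≤ ∫⁻ ω : ℂ, (ENNReal.ofReal (Real.pi / α) *
        ENNReal.ofReal (α / Real.pi * Real.exp (-α * ‖ω‖ ^ 2) *
        ‖φ (z - ω) - berezinC α 2 φ z‖) +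
        ENNReal.ofReal M * ENNReal.ofReal (Real.exp (-α * ‖ω‖ ^ 2))) := by
        refine lintegral_mono fun ω => ?_
        rw [← ENNReal.ofReal_mul (by positivity), ← ENNReal.ofReal_mul (by positivity),
          ← ENNReal.ofReal_add (by positivity) (by positivity)]
        refine ENNReal.ofReal_le_ofReal ?_
        have e : Real.pi / α * (α / Real.pi * Real.exp (-α * ‖ω‖ ^ 2) *
          ‖φ (z - ω) - berezinC α 2 φ z‖) =
          ‖φ (z - ω) - berezinC α 2 φ z‖ * Real.exp (-α * ‖ω‖ ^ 2) := by
          field_simp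
        rw [e, ← add_mul, sub_sub_cancel]
        gcongr
        have := norm_le_norm_sub_add (φ (z - ω)) (berezinC α 2 φ z)
        linarith [hM z]
    _ = ENNReal.ofReal (Real.pi / α) * (∫⁻ ω : ℂ,
          ENNReal.ofReal (α / Real.pi * Real.exp (-α * ‖ω‖ ^ 2) *
        ‖φ (z - ω) - berezinC α 2 φ z‖)) + ENNReal.ofReal M * d := by
        rw [lintegral_add_right _ (by fun_prop), lintegral_const_mul _ (by fun_prop),
          lintegral_const_mul _ (by fun_prop)]
    _ ≤ _ := by
        gcongr
        exact hB z

lemma norm_int_le (φ : ℂ → ℂ) (s : ℝ) (z : ℂ) (K : ℝ≥0∞) (hK : K ≠ ⊤) (hb : absB φ s z ≤ K)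
    (N : ℝ) (hN : 0 ≤ N) (F : ℂ → ℂ)
    (hF : ∀ ω, ‖F ω‖ ≤ N * (‖φ ω‖ * Real.exp (-s * ‖z - ω‖ ^ 2))) :
    ‖∫ ω, F ω‖ ≤ N * K.toReal := by
  have h1 := norm_integral_le_lintegral_norm (μ := volume) F
  refine h1.trans ?_
  have h2 : (∫⁻ ω, ENNReal.ofReal ‖F ω‖) ≤ ENNReal.ofReal N * K := by
    calc (∫⁻ ω, ENNReal.ofReal ‖F ω‖) ≤ ∫⁻ ω, ENNReal.ofReal N *
          ENNReal.ofReal (‖φ ω‖ * Real.exp (-s * ‖z - ω‖ ^ 2)) := by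
          refine lintegral_mono fun ω => ?_
          rw [← ENNReal.ofReal_mul hN]
          exact ENNReal.ofReal_le_ofReal (hF ω)
      _ = ENNReal.ofReal N * absB φ s z := by
          rw [lintegral_const_mul' _ _ ENNReal.ofReal_ne_top, absB]
      _ ≤ _ := by gcongr
  have h3 := ENNReal.toReal_mono (ENNReal.mul_ne_top ENNReal.ofReal_ne_top hK) h2
  rwa [ENNReal.toReal_mul, ENNReal.toReal_ofReal hN] at h3

lemma berezin_bdd (α : ℝ) (hα : 0 < α) (φ : ℂ → ℂ) (t : ℝ) (h : absBdd φ (α * t / 2)) :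
    ∃ M : ℝ, ∀ z : ℂ, ‖berezinC α t φ z‖ ≤ M := by
  obtain ⟨K, hK, hb⟩ := h
  refine ⟨‖((α / Real.pi : ℝ) : ℂ)‖ * (1 * K.toReal), fun z => ?_⟩
  rw [berezinC, norm_mul]
  gcongr
  refine norm_int_le φ (α * t / 2) z K hK (hb z) 1 zero_le_one _ fun ω => ?_
  rw [norm_mul, one_mul, Complex.norm_real, Real.norm_of_nonneg (Real.exp_pos _).le]

lemma re_mul_conj_id (z ω : ℂ) : (z * (starRingEnd ℂ) ω).re =
    (‖z‖ ^ 2 + ‖ω‖ ^ 2 - ‖z - ω‖ ^ 2) / 2 := by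
  simp only [Complex.sq_norm, Complex.normSq_apply, Complex.sub_re, Complex.sub_im,
    Complex.mul_re, Complex.conj_re, Complex.conj_im]
  ring

lemma norm_ker (α : ℝ) (z ω : ℂ) :
    ‖Complex.exp ((α : ℂ) * z * (starRingEnd ℂ) ω - ((α * ‖ω‖ ^ 2 : ℝ) : ℂ))‖ =
      Real.exp (α * (z * (starRingEnd ℂ) ω).re - α * ‖ω‖ ^ 2) := by
  rw [Complex.norm_exp, Complex.sub_re, Complex.ofReal_re, mul_assoc, Complex.re_ofReal_mul]

lemma fock_pt {α : ℝ} {f : ℂ → ℂ} (hf : MemFockInf α f) (ω : ℂ) :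
    ‖f ω‖ ≤ (fockNormInf α f).toReal * Real.exp (α * ‖ω‖ ^ 2 / 2) := by
  have h : ENNReal.ofReal (‖f ω‖ * gauss α ω) ≤ fockNormInf α f :=
    le_iSup (fun z => ENNReal.ofReal (‖f z‖ * gauss α z)) ω
  have h2 := (ENNReal.ofReal_le_iff_le_toReal hf.2).1 h
  have e : ‖f ω‖ = ‖f ω‖ * gauss α ω * Real.exp (α * ‖ω‖ ^ 2 / 2) := by
    rw [gauss, mul_assoc, ← Real.exp_add]
    ring_nf
    simp
  rw [e]
  gcongr

lemma toeplitz_pt (α : ℝ) (hα : 0 < α) (φ : ℂ → ℂ) (K : ℝ≥0∞) (hK : K ≠ ⊤)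
    (hb : ∀ z, absB φ (α / 2) z ≤ K) (f : ℂ → ℂ) (hf : MemFockInf α f) (z : ℂ) :
    ‖toeplitzC α φ f z‖ * gauss α z ≤
      (α / Real.pi * K.toReal) * (fockNormInf α f).toReal := by
  set N := (fockNormInf α f).toReal
  have hpi := Real.pi_pos
  have h := norm_int_le φ (α / 2) z K hK (hb z) (N * Real.exp (α * ‖z‖ ^ 2 / 2)) (by positivity)
    (fun ω => φ ω * f ω *
      Complex.exp ((α : ℂ) * z * (starRingEnd ℂ) ω - ((α * ‖ω‖ ^ 2 : ℝ) : ℂ))) (by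
      intro ω
      rw [norm_mul, norm_mul, norm_ker, re_mul_conj_id]
      calc _ ≤ ‖φ ω‖ * (N * Real.exp (α * ‖ω‖ ^ 2 / 2)) *
            Real.exp (α * ((‖z‖ ^ 2 + ‖ω‖ ^ 2 - ‖z - ω‖ ^ 2) / 2) - α * ‖ω‖ ^ 2) := by
            gcongr
            exact fock_pt hf ω
        _ = ‖φ ω‖ * N * (Real.exp (α * ‖ω‖ ^ 2 / 2) *
            Real.exp (α * ((‖z‖ ^ 2 + ‖ω‖ ^ 2 - ‖z - ω‖ ^ 2) / 2) - α * ‖ω‖ ^ 2)) := by ring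
        _ = ‖φ ω‖ * N * (Real.exp (α * ‖z‖ ^ 2 / 2) *
            Real.exp (-(α / 2) * ‖z - ω‖ ^ 2)) := by
            rw [← Real.exp_add, ← Real.exp_add]
            ring_nf
        _ = _ := by ring
        _ ≤ _ := le_rfl)
  rw [toeplitzC, norm_mul, Complex.norm_real, Real.norm_of_nonneg (by positivity)]
  have e : Real.exp (α * ‖z‖ ^ 2 / 2) * gauss α z = 1 := by
    rw [gauss, ← Real.exp_add]
    ring_nf
    simp
  calc _ ≤ α / Real.pi * (N * Real.exp (α * ‖z‖ ^ 2 / 2) * K.toReal) * gauss α z := by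
        gcongr
        exact (Real.exp_pos _).le
    _ = α / Real.pi * K.toReal * N * (Real.exp (α * ‖z‖ ^ 2 / 2) * gauss α z) := by ring
    _ = _ := by rw [e, mul_one]

lemma toeplitz_diff (α : ℝ) (hα : 0 < α) (φ : ℂ → ℂ) (hm : Measurable φ)
    (h : absBdd φ (α / 4)) (f : ℂ → ℂ) (hf : MemFockInf α f) :
    Differentiable ℂ (toeplitzC α φ f) := by
  obtain ⟨K, hK, hb⟩ := h
  set N := (fockNormInf α f).toReal
  have hN : 0 ≤ N := ENNReal.toReal_nonneg
  have hint : Integrable (fun ω => ‖φ ω‖ * Real.exp (-(α / 4) * ‖ω‖ ^ 2)) := by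
    refine ⟨by fun_prop, ?_⟩
    rw [hasFiniteIntegral_iff_ofReal (Eventually.of_forall fun ω => by positivity)]
    have := hb 0
    simp only [absB, zero_sub, norm_neg] at this
    exact this.trans_lt hK.lt_top
  have hfc : Measurable f := hf.1.continuous.measurable
  intro z₀
  set R := ‖z₀‖ + 1
  have hR : 0 ≤ R := by positivity
  -- common bound
  have bd : ∀ z ∈ ball z₀ 1, ∀ ω : ℂ, ‖φ ω * f ω *
      Complex.exp ((α : ℂ) * z * (starRingEnd ℂ) ω - ((α * ‖ω‖ ^ 2 : ℝ) : ℂ))‖ *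
        Real.exp (α * ‖ω‖) ≤
      N * Real.exp (α * (R + 1) ^ 2) * (‖φ ω‖ * Real.exp (-(α / 4) * ‖ω‖ ^ 2)) := by
    intro z hz ω
    rw [norm_mul, norm_mul, norm_ker]
    have hzR : ‖z‖ ≤ R := by
      have := norm_le_norm_add_norm_sub' z z₀
      rw [mem_ball, dist_eq_norm] at hz
      linarith
    have h1 : (z * (starRingEnd ℂ) ω).re ≤ R * ‖ω‖ := by
      refine (Complex.re_le_norm _).trans ?_
      rw [norm_mul, RCLike.norm_conj]
      gcongr
    have h2 : α * ‖ω‖ ^ 2 / 2 + (α * (z * (starRingEnd ℂ) ω).re - α * ‖ω‖ ^ 2) + α * ‖ω‖ ≤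
        α * (R + 1) ^ 2 + -(α / 4) * ‖ω‖ ^ 2 := by
      have := mul_le_mul_of_nonneg_left h1 hα.le
      have := mul_nonneg hα.le (sq_nonneg (‖ω‖ / 2 - (R + 1)))
      nlinarith
    calc _ ≤ ‖φ ω‖ * (N * Real.exp (α * ‖ω‖ ^ 2 / 2)) *
            Real.exp (α * (z * (starRingEnd ℂ) ω).re - α * ‖ω‖ ^ 2) * Real.exp (α * ‖ω‖) := by
            gcongr
            exact fock_pt hf ω
      _ = ‖φ ω‖ * N * Real.exp (α * ‖ω‖ ^ 2 / 2 + (α * (z * (starRingEnd ℂ) ω).re - α * ‖ω‖ ^ 2)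
            + α * ‖ω‖) := by
            rw [Real.exp_add, Real.exp_add]; ring
      _ ≤ ‖φ ω‖ * N * Real.exp (α * (R + 1) ^ 2 + -(α / 4) * ‖ω‖ ^ 2) := by gcongr
      _ = _ := by rw [Real.exp_add]; ring
  have meas : ∀ z : ℂ, Measurable (fun ω => φ ω * f ω *
      Complex.exp ((α : ℂ) * z * (starRingEnd ℂ) ω - ((α * ‖ω‖ ^ 2 : ℝ) : ℂ))) := by
    intro z
    have : Measurable (fun ω : ℂ => (starRingEnd ℂ) ω) := Complex.continuous_conj.measurable
    fun_prop
  have mconj : Measurable (fun ω : ℂ => (starRingEnd ℂ) ω) := Complex.continuous_conj.measurable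
  have hbi := hint.const_mul (N * Real.exp (α * (R + 1) ^ 2))
  have key := hasDerivAt_integral_of_dominated_loc_of_deriv_le (μ := volume)
    (F := fun z ω => φ ω * f ω *
      Complex.exp ((α : ℂ) * z * (starRingEnd ℂ) ω - ((α * ‖ω‖ ^ 2 : ℝ) : ℂ)))
    (F' := fun z ω => φ ω * f ω *
      Complex.exp ((α : ℂ) * z * (starRingEnd ℂ) ω - ((α * ‖ω‖ ^ 2 : ℝ) : ℂ)) *
        ((α : ℂ) * (starRingEnd ℂ) ω))
    (bound := fun ω => N * Real.exp (α * (R + 1) ^ 2) *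
      (‖φ ω‖ * Real.exp (-(α / 4) * ‖ω‖ ^ 2)))
    (x₀ := z₀) (s := ball z₀ 1) (ball_mem_nhds z₀ one_pos)
    (Eventually.of_forall fun z => (meas z).aestronglyMeasurable)
    (hbi.mono' (meas z₀).aestronglyMeasurable (Eventually.of_forall fun ω => by
      refine le_trans ?_ (bd z₀ (mem_ball_self one_pos) ω)
      exact le_mul_of_one_le_right (norm_nonneg _) (Real.one_le_exp (by positivity))))
    (((meas z₀).mul (mconj.const_mul _)).aestronglyMeasurable)
    (Eventually.of_forall fun ω z hz => by
      refine le_trans ?_ (bd z hz ω)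
      rw [norm_mul]
      gcongr
      rw [norm_mul, RCLike.norm_conj, Complex.norm_real, Real.norm_of_nonneg hα.le]
      linarith [Real.add_one_le_exp (α * ‖ω‖)])
    hbi
    (Eventually.of_forall fun ω z _ => by
      have h1 : HasDerivAt (fun z : ℂ => (α : ℂ) * z * (starRingEnd ℂ) ω -
          ((α * ‖ω‖ ^ 2 : ℝ) : ℂ)) ((α : ℂ) * (starRingEnd ℂ) ω) z := by
        have := (((hasDerivAt_id z).const_mul (α : ℂ)).mul_const ((starRingEnd ℂ) ω)).sub_const
          ((α * ‖ω‖ ^ 2 : ℝ) : ℂ)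
        simpa using this
      have h2 := (h1.cexp).const_mul (φ ω * f ω)
      rwa [← mul_assoc] at h2)
  exact (key.2.const_mul _).differentiableAt

lemma fockNorm_le {α C : ℝ} (f : ℂ → ℂ) (h : ∀ z, ‖f z‖ * gauss α z ≤ C) :
    fockNormInf α f ≤ ENNReal.ofReal C :=
  iSup_le fun z => ENNReal.ofReal_le_ofReal (h z)

lemma berezin_two_bdd (α : ℝ) (hα : 0 < α) (φ : ℂ → ℂ) (C : ℝ) (hC : 0 ≤ C)
    (h : ∀ f : ℂ → ℂ, MemFockInf α f →
        fockNormInf α (toeplitzC α φ f) ≤ ENNReal.ofReal C * fockNormInf α f) (z : ℂ) :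
    ‖berezinC α 2 φ z‖ ≤ C := by
  set k : ℂ → ℂ := fun ω => Complex.exp ((α : ℂ) * (starRingEnd ℂ) z * ω -
    ((α * ‖z‖ ^ 2 / 2 : ℝ) : ℂ)) with hk
  have kn : fockNormInf α k ≤ ENNReal.ofReal 1 := by
    refine fockNorm_le k fun ω => ?_
    simp only [hk, gauss]
    rw [Complex.norm_exp, ← Real.exp_add, Complex.sub_re, Complex.ofReal_re, mul_assoc,
      Complex.re_ofReal_mul, mul_comm ((starRingEnd ℂ) z), re_mul_conj_id, Real.exp_le_one_iff]
    have := mul_nonneg hα.le (sq_nonneg ‖ω - z‖)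
    linarith
  have kd : Differentiable ℂ k := by
    simp only [hk]
    fun_prop
  have h1 := h k ⟨kd, ne_top_of_le_ne_top ENNReal.ofReal_ne_top kn⟩
  have h2 : ENNReal.ofReal (‖toeplitzC α φ k z‖ * gauss α z) ≤ ENNReal.ofReal C := by
    calc _ ≤ fockNormInf α (toeplitzC α φ k) :=
          le_iSup (fun z => ENNReal.ofReal (‖toeplitzC α φ k z‖ * gauss α z)) z
      _ ≤ ENNReal.ofReal C * fockNormInf α k := h1
      _ ≤ ENNReal.ofReal C * ENNReal.ofReal 1 := by gcongr
      _ = _ := by simp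
  rw [ENNReal.ofReal_le_ofReal_iff hC] at h2
  have e : berezinC α 2 φ z = toeplitzC α φ k z * ((gauss α z : ℝ) : ℂ) := by
    rw [berezinC, toeplitzC, mul_assoc, ← integral_mul_const]
    congr 2
    ext ω
    simp only [hk, gauss, mul_assoc, Complex.ofReal_exp, ← Complex.exp_add]
    congr 2
    have e1 : ((‖z - ω‖ ^ 2 : ℝ) : ℂ) = (z - ω) * (starRingEnd ℂ) (z - ω) := by
      rw [Complex.mul_conj, Complex.sq_norm]
    have e2 : ((‖z‖ ^ 2 : ℝ) : ℂ) = z * (starRingEnd ℂ) z := by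
      rw [Complex.mul_conj, Complex.sq_norm]
    have e3 : ((‖ω‖ ^ 2 : ℝ) : ℂ) = ω * (starRingEnd ℂ) ω := by
      rw [Complex.mul_conj, Complex.sq_norm]
    simp only [Complex.ofReal_mul, Complex.ofReal_div, Complex.ofReal_neg, e1, e2, e3, map_sub]
    push_cast
    ring
  have g0 : 0 ≤ gauss α z := (Real.exp_pos _).le
  rw [e, norm_mul, Complex.norm_real, Real.norm_of_nonneg g0]
  exact h2

/-- For measurable `φ` satisfying condition (I₁) and the Fock-BMO bound, `T_φ` is
bounded on `F_α^∞` iff for every `t > 0` the `t`-Berezin transform `φ̃_t` is bounded on `ℂ`. -/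
theorem stmt16 (α : ℝ) (hα : 0 < α) (φ : ℂ → ℂ) (hmeas : Measurable φ)
    (hI : CondI1C α φ) (hBMO : FockBMOBound α φ) :
    ((∀ f : ℂ → ℂ, MemFockInf α f → MemFockInf α (toeplitzC α φ f)) ∧
      ∃ C > (0 : ℝ), ∀ f : ℂ → ℂ, MemFockInf α f →
        fockNormInf α (toeplitzC α φ f) ≤ ENNReal.ofReal C * fockNormInf α f) ↔
      ∀ t : ℝ, 0 < t → ∃ M : ℝ, ∀ z : ℂ, ‖berezinC α t φ z‖ ≤ M := by
  have hpi := Real.pi_pos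
  constructor
  · rintro ⟨-, C, hC, h⟩ t ht
    exact berezin_bdd α hα φ t (absBdd_all φ hmeas hα
      (absBdd_of_bmo α hα φ hmeas hBMO C (berezin_two_bdd α hα φ C hC.le h)) (by positivity))
  · intro h
    obtain ⟨M, hM⟩ := h 2 two_pos
    have hA := absBdd_of_bmo α hα φ hmeas hBMO M hM
    obtain ⟨K, hK, hb⟩ := absBdd_all φ hmeas hα hA (t := α / 2) (by positivity)
    have hA4 := absBdd_all φ hmeas hα hA (t := α / 4) (by positivity)
    have hle : ∀ f : ℂ → ℂ, MemFockInf α f → fockNormInf α (toeplitzC α φ f) ≤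
        ENNReal.ofReal (α / Real.pi * K.toReal + 1) * fockNormInf α f := by
      intro f hf
      refine (fockNorm_le _ (toeplitz_pt α hα φ K hK hb f hf)).trans ?_
      rw [ENNReal.ofReal_mul (by positivity), ENNReal.ofReal_toReal hf.2]
      gcongr
      linarith
    refine ⟨fun f hf => ⟨toeplitz_diff α hα φ hmeas hA4 f hf, ?_⟩, _, by positivity, hle⟩
    exact ne_top_of_le_ne_top (ENNReal.mul_ne_top ENNReal.ofReal_ne_top hf.2) (hle f hf)
end
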